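/- arXiv:math/0603488 — 4 statements merged into one kernel-verified Lean document; each statement's English description precedes it below -/
import Mathlib

section
/- For every odd prime p, (-1)^((p-1)/2) * C(p-1, (p-1)/2) ≡ 4^(p-1) + (1/12) p^3 B_{p-3} (mod p^4), i.e., 12 * ((-1)^((p-1)/2) * C(p-1,(p-1)/2) - 4^(p-1)) ≡ p^3 * (12 B_{p-3}) (mod p^4) where 12 B_{p-3} is interpreted via the p-integral rational number B_{p-3}. -/
open Finset

lemma sum_refl {R : Type*} [CommRing R] (m : ℕ) (f : ℕ → R) :
    ∑ i ∈ range (2*m), f (i+1) = ∑ i ∈ range m, (f (i+1) + f (2*m+1-(i+1))) := by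
  rw [two_mul, sum_range_add, sum_add_distrib]
  congr 1
  rw [← sum_range_reflect]
  apply sum_congr rfl
  intro i hi
  rw [mem_range] at hi
  congr 1
  omega

lemma sum_evenodd {R : Type*} [CommRing R] (m : ℕ) (f : ℕ → R) :
    ∑ i ∈ range (2*m), f (i+1) = ∑ i ∈ range m, (f (2*(i+1)) + f (2*m+1-2*(i+1))) := by
  have h1 : ∑ i ∈ range (2*m), f (i+1) = ∑ i ∈ range m, (f (2*(i+1)) + f (2*i+1)) := by
    induction m with
    | zero => simp
    | succ m ih =>
      rw [sum_range_succ, ← ih, show 2*(m+1) = 2*m+1+1 by ring, sum_range_succ, sum_range_succ]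
      ring
  rw [h1, sum_add_distrib, sum_add_distrib]
  congr 1
  rw [← sum_range_reflect]
  apply sum_congr rfl
  intro i hi
  rw [mem_range] at hi
  congr 1
  omega

lemma prod_exp {R : Type*} [CommRing R] (q : R) (m : ℕ) (a : ℕ → R) :
    q^4 ∣ ∏ i ∈ range m, (1 - q^2 * a i) - (1 - q^2 * ∑ i ∈ range m, a i) := by
  induction m with
  | zero => simp
  | succ m ih =>
    obtain ⟨c, hc⟩ := ih
    rw [prod_range_succ, sum_range_succ]
    rw [sub_eq_iff_eq_add] at hc
    rw [hc]
    exact ⟨c * (1 - q^2 * a m) + a m * ∑ i ∈ range m, a i, by ring⟩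

lemma pow_refl {R : Type*} [CommRing R] (q x : R) (n : ℕ) (hn : Odd n) :
    q^2 ∣ (q - x)^(n+1) - (x^(n+1) - (n+1) * q * x^n) := by
  have h : ∀ k : ℕ, q^2 ∣ (x - q)^(k+1) - (x^(k+1) - (k+1) * q * x^k) := by
    intro k
    induction k with
    | zero => simp
    | succ k ih =>
      obtain ⟨c, hc⟩ := ih
      rw [sub_eq_iff_eq_add] at hc
      rw [pow_succ (x-q), hc]
      exact ⟨c * (x - q) + (k+1) * x^k, by push_cast; ring⟩
  have := h n
  rwa [← neg_sub q x, (hn.add_one).neg_pow] at this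

lemma bern_int (p : ℕ) [Fact p.Prime] (n : ℕ) (hn : n + 1 < p) :
    ‖((bernoulli' n : ℚ) : ℚ_[p])‖ ≤ 1 := by
  induction n using Nat.strong_induction_on with
  | _ n ih =>
    rw [bernoulli'_def]
    have h1 : ‖(((∑ k ∈ range n, (n.choose k : ℚ) / (n - k + 1) * bernoulli' k : ℚ)) : ℚ_[p])‖ ≤ 1 := by
      push_cast
      apply IsUltrametricDist.norm_sum_le_of_forall_le_of_nonneg zero_le_one
      intro k hk
      rw [mem_range] at hk
      have e : ((n:ℚ_[p]) - k + 1) = ((n - k + 1 : ℕ) : ℚ_[p]) := by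
        push_cast [Nat.cast_sub hk.le]; ring
      rw [e, norm_mul, norm_div]
      have h2 : ‖((n - k + 1 : ℕ) : ℚ_[p])‖ = 1 := by
        rw [Padic.norm_natCast_eq_one_iff]
        apply (Nat.Prime.coprime_iff_not_dvd Fact.out).2
        intro hd
        have := Nat.le_of_dvd (by omega) hd
        omega
      rw [h2, div_one]
      exact mul_le_one₀ (by exact_mod_cast Padic.norm_int_le_one (p := p) (n.choose k : ℤ)) (norm_nonneg _) (ih k hk (by omega))
    push_cast at h1 ⊢
    rw [sub_eq_add_neg]
    refine (IsUltrametricDist.norm_add_le_max _ _).trans (max_le (by simp) (by rwa [norm_neg]))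

lemma bern_int' (p : ℕ) [Fact p.Prime] (n : ℕ) (hn : n + 1 < p) :
    ‖((bernoulli n : ℚ) : ℚ_[p])‖ ≤ 1 := by
  have := bern_int p n hn
  rw [bernoulli]
  push_cast
  rw [norm_mul]
  simpa using this

lemma S_cong (p k : ℕ) [Fact p.Prime] (hk : k + 2 < p) (b : ℤ_[p])
    (hb : (b : ℚ_[p]) = ((bernoulli k : ℚ) : ℚ_[p])) :
    (p : ℤ_[p])^2 ∣ ∑ i ∈ range p, (i : ℤ_[p])^k - p * b := by
  have key : ∀ x : ℤ_[p], (p : ℤ_[p])^2 ∣ x ↔ ‖(x : ℚ_[p])‖ ≤ (p:ℝ)^(-(2:ℤ)) := by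
    intro x
    rw [← PadicInt.norm_def]
    have := PadicInt.norm_le_pow_iff_mem_span_pow x 2
    rw [Ideal.mem_span_singleton] at this
    exact_mod_cast this.symm
  rw [key, PadicInt.coe_sub, PadicInt.coe_sum, PadicInt.coe_mul, hb]
  simp only [PadicInt.coe_pow, PadicInt.coe_natCast]
  have h := congrArg (fun x : ℚ => (x : ℚ_[p])) (sum_range_pow p k)
  have hk1 : ((k:ℚ_[p]) + 1) ≠ 0 := by exact_mod_cast Nat.succ_ne_zero k
  push_cast at h
  rw [h, sum_range_succ]
  have e : ((bernoulli k : ℚ) : ℚ_[p]) * ((k+1).choose k) * (p:ℚ_[p])^(k+1-k) / (k+1) = p * ((bernoulli k : ℚ) : ℚ_[p]) := by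
    rw [show k + 1 - k = 1 by omega, Nat.choose_succ_self_right]
    push_cast
    field_simp
  rw [e, add_sub_cancel_right]
  apply IsUltrametricDist.norm_sum_le_of_forall_le_of_nonneg (by positivity)
  intro i hi
  rw [mem_range] at hi
  have h2 : ‖((k:ℚ_[p]) + 1)‖ = 1 := by
    have : ‖((k + 1 : ℕ) : ℚ_[p])‖ = 1 := by
      rw [Padic.norm_natCast_eq_one_iff]
      apply (Nat.Prime.coprime_iff_not_dvd Fact.out).2
      intro hd
      have := Nat.le_of_dvd (by omega) hd
      omega
    exact_mod_cast this
  rw [norm_div, norm_mul, norm_mul, h2, div_one]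
  have h3 : ‖((k+1).choose i : ℚ_[p])‖ ≤ 1 := by
    exact_mod_cast Padic.norm_int_le_one (p := p) ((k+1).choose i : ℤ)
  have h4 := bern_int' p i (by omega)
  have h5 : ‖(p:ℚ_[p])^(k+1-i)‖ ≤ (p:ℝ)^(-(2:ℤ)) := by
    rw [Padic.norm_p_pow]
    apply zpow_le_zpow_right₀
    · exact_mod_cast (Fact.out : p.Prime).one_lt.le
    · omega
  calc _ ≤ 1 * 1 * (p:ℝ)^(-(2:ℤ)) := by gcongr
    _ = _ := by ring

lemma cb_fact (n : ℕ) : n.centralBinom * n.factorial = 2^n * ∏ i ∈ range n, (2*i+1) := by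
  induction n with
  | zero => simp
  | succ n ih =>
    rw [prod_range_succ, Nat.factorial_succ]
    have := Nat.succ_mul_centralBinom_succ n
    calc _ = ((n+1) * (n+1).centralBinom) * n.factorial := by ring
      _ = 2*(2*n+1) * (n.centralBinom * n.factorial) := by rw [this]; ring
      _ = _ := by rw [ih]; ring

lemma cb_fact2 {R : Type*} [CommRing R] (m : ℕ) :
   (-1)^m * (m.centralBinom:R) * m.factorial = ∏ i ∈ range m, ((i+1:ℕ) - ((2*m+1:ℕ):R)) := by
  have h : m.factorial * m.centralBinom = ∏ i ∈ range m, (2*m - i) := by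
    rw [Nat.centralBinom, ← Nat.descFactorial_eq_factorial_mul_choose, Nat.descFactorial_eq_prod_range]
  have h' := congrArg (fun x : ℕ => (x:R)) h
  simp only [Nat.cast_mul, Nat.cast_prod] at h'
  rw [mul_assoc, mul_comm (m.centralBinom:R), h']
  have : (-1:R)^m = ∏ i ∈ range m, (-1) := by simp
  rw [this, ← prod_mul_distrib]
  apply prod_congr rfl
  intro i hi
  rw [mem_range] at hi
  rw [Nat.cast_sub (by omega)]
  push_cast; ring

lemma cb_fact3 {R : Type*} [CommRing R] (m : ℕ) :
   (-1)^m * (m.centralBinom:R) * m.factorial = 2^m * ∏ i ∈ range m, (2*(i+1:ℕ) - ((2*m+1:ℕ):R)) := by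
  have h' := congrArg (fun x : ℕ => (x:R)) (cb_fact m)
  rw [← prod_range_reflect] at h'
  simp only [Nat.cast_mul, Nat.cast_prod, Nat.cast_pow] at h'
  rw [mul_assoc, h']
  have : (-1:R)^m = ∏ i ∈ range m, (-1) := by simp
  rw [this, mul_left_comm, ← prod_mul_distrib]
  congr 1
  apply prod_congr rfl
  intro i hi
  rw [mem_range] at hi
  rw [show m - 1 - i = m - (i+1) by omega]
  push_cast [Nat.cast_sub (show i+1 ≤ m by omega)]; ring

/-- The purely algebraic congruence `3U + p b ≡ 0 mod p^2`, in a commutative ring. -/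
lemma U_cong {R : Type*} [CommRing R] [IsDomain R] (m n : ℕ) (q : R) (hq : q = ((2*m+1 : ℕ) : R))
    (hq0 : q ≠ 0)
    (hn : n + 4 = 2*m+1) (u : ℕ → R) (hu : ∀ j, 0 < j → j < 2*m+1 → (j:R) * u j = 1)
    (hfermat : ∀ j : ℕ, 0 < j → j < 2*m+1 → q ∣ (j:R)^(n+3) - 1) (b : R)
    (hS : q^2 ∣ ∑ i ∈ range (2*m), ((i+1 : ℕ):R)^(n+1) - q * b) :
    q^2 ∣ 3 * ∑ i ∈ range m, u (i+1) * u (2*m+1-(i+1)) + q * b := by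
  have hm : 2 ≤ m := by omega
  have hodd : Odd n := ⟨m - 2, by omega⟩
  obtain ⟨h, hh⟩ : ∃ h : R, 2 * h = 1 := ⟨u 2, by exact_mod_cast hu 2 (by omega) (by omega)⟩
  set U := ∑ i ∈ range m, u (i+1) * u (2*m+1-(i+1)) with hU
  set P2 := ∑ i ∈ range m, u (i+1)^2 with hP2
  set P3 := ∑ i ∈ range m, u (i+1)^3 with hP3
  set Q := ∑ i ∈ range m, ((i+1:ℕ):R)^(n+1) with hQ
  -- uniqueness of inverses
  have huu : ∀ i < m, u (2*(i+1)) = h * u (i+1) := by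
    intro i hi
    have h1 := hu (i+1) (by omega) (by omega)
    have h2 := hu (2*(i+1)) (by omega) (by omega)
    push_cast at h1 h2
    linear_combination (-u (2*(i+1))) * h1 - u (2*(i+1)) * (i+1) * u (i+1) * hh + h * u (i+1) * h2
  have hw : ∀ j, 0 < j → j < 2*m+1 → q^2 ∣ u j * u (2*m+1-j) + u j^2 + q * u j^3 := by
    intro j h0 h1
    have e1 := hu j h0 h1
    have e2 := hu (2*m+1-j) (by omega) (by omega)
    rw [Nat.cast_sub h1.le, ← hq] at e2
    refine ⟨u j^3 * u (2*m+1-j), ?_⟩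
    generalize u (2*m+1-j) = v at *
    generalize u j = x at *
    linear_combination (-x^2 - q * x^3) * e2 + (-x*v - q * x^2 * v) * e1
  have hU1 : q^2 ∣ U + P2 + q * P3 := by
    rw [hU, hP2, hP3, mul_sum, ← sum_add_distrib, ← sum_add_distrib]
    apply dvd_sum
    intro i hi
    rw [mem_range] at hi
    exact hw _ (by omega) (by omega)
  have hUU : U = ∑ i ∈ range m, u (2*(i+1)) * u (2*m+1-2*(i+1)) := by
    have h1 := sum_refl m (fun j => u j * u (2*m+1-j))
    have h2 := sum_evenodd m (fun j => u j * u (2*m+1-j))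
    rw [h1] at h2
    have h3 : 2 * U = 2 * ∑ i ∈ range m, u (2*(i+1)) * u (2*m+1-2*(i+1)) := by
      rw [hU, mul_sum, mul_sum]
      refine Eq.trans ?_ (h2.trans ?_)
      · apply sum_congr rfl
        intro i hi
        rw [mem_range] at hi
        rw [show 2*m+1-(2*m+1-(i+1)) = i+1 by omega]
        ring
      · apply sum_congr rfl
        intro i hi
        rw [mem_range] at hi
        rw [show 2*m+1-(2*m+1-2*(i+1)) = 2*(i+1) by omega]
        ring
    linear_combination h * h3 - (U - ∑ i ∈ range m, u (2*(i+1)) * u (2*m+1-2*(i+1))) * hh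
  have hU2 : q^2 ∣ U + h^2 * P2 + q * (h^3 * P3) := by
    rw [hUU, hP2, hP3, mul_sum, mul_sum, mul_sum, ← sum_add_distrib, ← sum_add_distrib]
    apply dvd_sum
    intro i hi
    rw [mem_range] at hi
    have := hw (2*(i+1)) (by omega) (by omega)
    rw [huu i hi] at this ⊢
    convert this using 1
    ring
  have hU3 : q^2 ∣ 3 * U - q * h * P3 := by
    obtain ⟨c, hc⟩ := hU1
    obtain ⟨d, hd⟩ := hU2
    refine ⟨4 * d - c, ?_⟩
    have hh2 : 4 * h^2 = 1 := by linear_combination (2*h+1) * hh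
    linear_combination 4 * hd - hc - P2 * hh2 - q * h * P3 * hh2 - q * P3 * hh
  -- power sums
  have hj : ∀ j : ℕ, 0 < j → j < 2*m+1 → q ∣ (j:R)^n - u j^3 := by
    intro j h0 h1
    obtain ⟨c, hc⟩ := hfermat j h0 h1
    have e1 := hu j h0 h1
    have e3 : (j:R)^3 * u j^3 = 1 := by rw [← mul_pow, e1, one_pow]
    refine ⟨c * u j^3, ?_⟩
    rw [pow_add] at hc
    linear_combination u j^3 * hc - (j:R)^n * e3
  have hqn : (n:R) + 4 = q := by rw [hq, ← hn]; push_cast; ring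
  have hpw : ∀ j, 0 < j → j < 2*m+1 → q^2 ∣ (j:R)^(n+1) + ((2*m+1-j : ℕ):R)^(n+1) - (2 * (j:R)^(n+1) + 3 * q * u j^3) := by
    intro j h0 h1
    rw [Nat.cast_sub h1.le, ← hq]
    obtain ⟨c, hc⟩ := pow_refl q (j:R) n hodd
    obtain ⟨d, hd⟩ := hj j h0 h1
    refine ⟨c - (j:R)^n + 3 * d, ?_⟩
    linear_combination hc + 3 * q * hd - q * (j:R)^n * hqn
  set S := ∑ i ∈ range (2*m), ((i+1 : ℕ):R)^(n+1) with hSdef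
  have hS1 : q^2 ∣ S - (2 * Q + 3 * q * P3) := by
    rw [hSdef, sum_refl m (fun j => (j:R)^(n+1)), hQ, hP3, mul_sum, mul_sum, ← sum_add_distrib, ← sum_sub_distrib]
    apply dvd_sum
    intro i hi
    rw [mem_range] at hi
    exact hpw _ (by omega) (by omega)
  have hS2 : q^2 ∣ S - (2 * 2^(n+1) * Q + 3 * q * h^3 * P3) := by
    rw [hSdef, sum_evenodd m (fun j => (j:R)^(n+1)), hQ, hP3, mul_sum, mul_sum, ← sum_add_distrib, ← sum_sub_distrib]
    apply dvd_sum
    intro i hi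
    rw [mem_range] at hi
    have := hpw (2*(i+1)) (by omega) (by omega)
    rw [huu i hi] at this
    convert this using 1
    push_cast
    rw [mul_pow 2]
    ring
  obtain ⟨a, ha⟩ := hfermat 2 (by omega) (by omega)
  obtain ⟨c, hc⟩ := hS1
  obtain ⟨d, hd⟩ := hS2
  obtain ⟨e, he⟩ := hS
  obtain ⟨f, hf⟩ := hU3
  push_cast at ha
  have hh3 : 8 * h^3 = 1 := by linear_combination (4*h^2+2*h+1) * hh
  have ha' : 4 * 2^(n+1) = 1 + q * a := by rw [← ha]; ring
  have hb : q ∣ 3 * (2 * b + P3) := by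
    refine ⟨2*a*b + e*(2*q*a-6) - 6*a*P3 - (2+2*q*a)*c + 8*d, ?_⟩
    apply mul_left_cancel₀ hq0
    linear_combination -(8 * 2^(n+1) * hc - 8 * hd - 2*(S-3*q*P3-q^2*c)*ha' - 3*q*P3*hh3 - (2*q*a-6)*he)
  obtain ⟨g, hg⟩ := hb
  have h3 := hu 3 (by omega) (by omega)
  push_cast at h3
  have hg' : 2 * b + P3 = q * (g * u 3) := by
    linear_combination u 3 * hg - (2*b+P3) * h3
  exact ⟨f + h * g * u 3, by linear_combination hf + q * h * hg' - q * b * hh⟩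

/-- Reduction of the binomial coefficient to `U`. -/
lemma A_cong {R : Type*} [CommRing R] [IsDomain R] [CharZero R] (m : ℕ) (q : R)
    (hq : q = ((2*m+1 : ℕ) : R)) (h : R) (hh : 2 * h = 1)
    (u : ℕ → R) (hu : ∀ j, 0 < j → j < 2*m+1 → (j:R) * u j = 1) :
    q^4 ∣ (-1)^m * (m.centralBinom : R)
      - 4^(2*m) * (1 - q^2 * (h^2 * ∑ i ∈ range m, u (i+1) * u (2*m+1-(i+1)))) := by
  set A : R := (-1)^m * (m.centralBinom : R) with hA
  have hA0 : A ≠ 0 := by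
    apply mul_ne_zero
    · exact pow_ne_zero _ (by simp)
    · exact_mod_cast m.centralBinom_ne_zero
  have hfu : (m.factorial : R) * ∏ i ∈ range m, u (i+1) = 1 := by
    rw [← prod_range_add_one_eq_factorial, Nat.cast_prod, ← prod_mul_distrib]
    apply prod_eq_one
    intro i hi
    rw [mem_range] at hi
    exact hu (i+1) (by omega) (by omega)
  have hF1 : A = ∏ i ∈ range m, (1 - q * u (i+1)) := by
    have h1 := cb_fact2 (R := R) m
    rw [← hq, ← hA] at h1
    have h2 : A = (A * m.factorial) * ∏ i ∈ range m, u (i+1) := by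
      rw [mul_assoc, hfu, mul_one]
    rw [h2, h1, ← prod_mul_distrib]
    apply prod_congr rfl
    intro i hi
    rw [mem_range] at hi
    linear_combination hu (i+1) (by omega) (by omega)
  have hF2 : A = 4^m * ∏ i ∈ range m, (1 - q * h * u (i+1)) := by
    have h1 := cb_fact3 (R := R) m
    rw [← hq, ← hA] at h1
    have h2 : A = (A * m.factorial) * ∏ i ∈ range m, u (i+1) := by
      rw [mul_assoc, hfu, mul_one]
    rw [h2, h1, mul_assoc, ← prod_mul_distrib, show (4:R) = 2 * 2 by norm_num, mul_pow, mul_assoc]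
    congr 1
    have : (2:R)^m = ∏ i ∈ range m, 2 := by simp
    rw [this, ← prod_mul_distrib]
    apply prod_congr rfl
    intro i hi
    rw [mem_range] at hi
    linear_combination 2 * hu (i+1) (by omega) (by omega) + q * u (i+1) * hh
  set W := ∏ i ∈ range m, (1 - q^2 * (h^2 * (u (i+1) * u (2*m+1-(i+1))))) with hW
  have hFW : (∏ i ∈ range m, (1 - q * h * u (i+1)))^2 = A * W := by
    rw [hF1, hW, ← prod_pow, ← prod_mul_distrib]
    apply prod_congr rfl
    intro i hi
    rw [mem_range] at hi
    have e1 := hu (i+1) (by omega) (by omega)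
    have e2 := hu (2*m+1-(i+1)) (by omega) (by omega)
    rw [Nat.cast_sub (by omega), ← hq] at e2
    generalize u (2*m+1-(i+1)) = v at *
    generalize u (i+1) = x at *
    generalize ((i+1:ℕ):R) = y at *
    linear_combination (- q * x) * hh - q^2*h^2*x^2 * e2 - q^2*h^2*x*v * e1
  have hAW : A = 4^(2*m) * W := by
    apply mul_left_cancel₀ hA0
    calc A * A = (4^m * ∏ i ∈ range m, (1 - q * h * u (i+1)))^2 := by rw [← hF2]; ring
      _ = 4^(2*m) * (∏ i ∈ range m, (1 - q * h * u (i+1)))^2 := by ring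
      _ = _ := by rw [hFW]; ring
  rw [hAW, ← mul_sub, mul_sum]
  exact Dvd.dvd.mul_left (prod_exp q m _) _

theorem carlitz_congruence (p : ℕ) [Fact p.Prime] (hodd : Odd p) :
    ‖((((-1 : ℚ) ^ ((p - 1) / 2) * ((p - 1).choose ((p - 1) / 2))
        - (4 ^ (p - 1) + (1 / 12) * (p : ℚ) ^ 3 * bernoulli (p - 3))) : ℚ) : ℚ_[p])‖
      ≤ (p : ℝ) ^ (-(4 : ℤ)) := by
  obtain ⟨m, hm⟩ := hodd
  have hp : p.Prime := Fact.out
  have hp2 := hp.two_le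
  rcases Nat.lt_or_ge m 2 with hm2 | hm2
  · have : p = 3 := by omega
    subst this
    have e : ((-1 : ℚ) ^ ((3 - 1) / 2) * ((3 - 1).choose ((3 - 1) / 2))
        - (4 ^ (3 - 1) + (1 / 12) * ((3:ℕ) : ℚ) ^ 3 * bernoulli (3 - 3))) = -(((3:ℕ):ℚ)^4 / ((4:ℕ):ℚ)) := by
      norm_num
    rw [e]
    have h4 : ‖((4:ℕ):ℚ_[3])‖ = 1 := by
      rw [Padic.norm_natCast_eq_one_iff]; norm_num
    rw [Rat.cast_neg, Rat.cast_div, Rat.cast_pow, Rat.cast_natCast, Rat.cast_natCast, norm_neg, norm_div, h4, Padic.norm_p_pow, div_one]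
    norm_num
  obtain ⟨n, hn⟩ : ∃ n, n + 4 = 2*m+1 := ⟨2*m-3, by omega⟩
  set u : ℕ → ℤ_[p] := fun j => Ring.inverse (j : ℤ_[p]) with hudef
  have hunit : ∀ j : ℕ, 0 < j → j < p → IsUnit (j : ℤ_[p]) := by
    intro j h0 h1
    rw [PadicInt.isUnit_iff, PadicInt.norm_natCast_eq_one_iff]
    exact (Nat.Prime.coprime_iff_not_dvd hp).2 (fun hd => by have := Nat.le_of_dvd h0 hd; omega)
  have hu : ∀ j, 0 < j → j < 2*m+1 → (j:ℤ_[p]) * u j = 1 := by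
    intro j h0 h1
    exact Ring.mul_inverse_cancel _ (hunit j h0 (by omega))
  have hq : (p : ℤ_[p]) = ((2*m+1 : ℕ) : ℤ_[p]) := congrArg (Nat.cast : ℕ → ℤ_[p]) hm
  have hq0 : (p : ℤ_[p]) ≠ 0 := by exact_mod_cast hp.ne_zero
  have hfermat : ∀ j : ℕ, 0 < j → j < 2*m+1 → (p:ℤ_[p]) ∣ (j:ℤ_[p])^(n+3) - 1 := by
    intro j h0 h1
    have h2 : IsCoprime (j:ℤ) p := by
      rw [Nat.isCoprime_iff_coprime, Nat.coprime_comm]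
      exact (Nat.Prime.coprime_iff_not_dvd hp).2 (fun hd => by have := Nat.le_of_dvd h0 hd; omega)
    have h3 := (Int.ModEq.pow_card_sub_one_eq_one hp h2).symm.dvd
    rw [show p - 1 = n + 3 by omega] at h3
    have := map_dvd (Int.castRingHom ℤ_[p]) h3
    simpa using this
  have hbn := bern_int' p (p-3) (by omega)
  set b : ℤ_[p] := ⟨_, hbn⟩ with hb
  have hS : (p:ℤ_[p])^2 ∣ ∑ i ∈ range (2*m), ((i+1 : ℕ):ℤ_[p])^(n+1) - p * b := by
    have := S_cong p (p-3) (by omega) b rfl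
    rw [show range p = range (2*m+1) by rw [hm], sum_range_succ', show p - 3 = n + 1 by omega] at this
    simpa using this
  obtain ⟨c, hc⟩ := U_cong m n (p:ℤ_[p]) hq hq0 hn u hu hfermat b hS
  have hh : 2 * u 2 = 1 := by exact_mod_cast hu 2 (by omega) (by omega)
  obtain ⟨d, hd⟩ := A_cong m (p:ℤ_[p]) hq (u 2) hh u hu
  obtain ⟨a, ha⟩ := hfermat 4 (by omega) (by omega)
  push_cast at ha
  rw [show n + 3 = 2*m by omega] at ha
  set U := ∑ i ∈ range m, u (i+1) * u (2*m+1-(i+1)) with hU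
  set A : ℤ_[p] := (-1)^m * (m.centralBinom : ℤ_[p]) with hA
  set h := u 2
  have hh2 : 4 * h^2 = 1 := by linear_combination (2*h+1) * hh
  have key : (p:ℤ_[p])^4 ∣ 12 * (A - 4^(2*m)) - p^3 * b := by
    refine ⟨12 * d - 4^(2*m) * c + a * b, ?_⟩
    linear_combination 12 * hd - 3 * 4^(2*m) * p^2 * U * hh2 - 4^(2*m) * p^2 * hc + p^3 * b * ha
  have hkey := (PadicInt.norm_le_pow_iff_mem_span_pow _ 4).2 (Ideal.mem_span_singleton.2 key)
  rw [PadicInt.norm_def] at hkey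
  have h12 : ‖((12:ℕ):ℚ_[p])‖ = 1 := by
    rw [Padic.norm_natCast_eq_one_iff]
    have h3 : Nat.Coprime p 3 := (Nat.coprime_primes hp Nat.prime_three).2 (by omega)
    have h2 : Nat.Coprime p 2 := (Nat.coprime_primes hp Nat.prime_two).2 (by omega)
    exact (h2.mul_right h2).mul_right h3
  rw [← one_mul ‖_‖, ← h12, ← norm_mul]
  convert hkey using 2
  swap
  · norm_num
  rw [show (p - 1)/2 = m by omega, show p - 1 = 2*m by omega]
  rw [PadicInt.coe_sub, PadicInt.coe_mul, PadicInt.coe_sub, PadicInt.coe_mul, PadicInt.coe_mul]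
  simp only [PadicInt.coe_pow, PadicInt.coe_natCast, PadicInt.coe_neg, PadicInt.coe_one]
  have e4 : ((4:ℤ_[p]):ℚ_[p]) = 4 := rfl
  have e12 : ((12:ℤ_[p]):ℚ_[p]) = 12 := rfl
  rw [e4, e12, hb, Nat.centralBinom]
  push_cast
  ring
end

section
/- Let p be an odd prime and a a positive integer. Then Σ_{k=0}^{p-1} (-1)^{(a-1)k} C(p-1,k)^a ≡ 2^{a(p-1)} + (a(a-1)(3a-4)/48) p^3 B_{p-3} (mod p^4), as a congruence of p-integral rational numbers. -/
open Finset in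
theorem pan_alt_sq (m : ℕ) :
    ∑ k ∈ range (2 * m + 1), (-1 : ℤ) ^ k * ((2 * m).choose k : ℤ) ^ 2
      = (-1) ^ m * ((2 * m).choose m : ℤ) := by
  have key : ((Polynomial.X + Polynomial.C (1:ℤ)) ^ (2 * m) *
      (Polynomial.X + Polynomial.C (-1 : ℤ)) ^ (2 * m)).coeff (2 * m)
      = (Polynomial.expand ℤ 2 ((Polynomial.X + Polynomial.C (-1 : ℤ)) ^ (2 * m))).coeff (2 * m) := by
    congr 1
    rw [← mul_pow]
    simp
    ring
  rw [mul_comm 2 m, Polynomial.coeff_expand_mul two_pos, mul_comm m 2, Polynomial.coeff_mul,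
    Finset.Nat.sum_antidiagonal_eq_sum_range_succ_mk] at key
  simp only [Polynomial.coeff_X_add_C_pow] at key
  have h2 : 2 * m - m = m := by omega
  rw [h2] at key
  rw [← key]
  refine Finset.sum_congr rfl fun k hk => ?_
  have hk' : k ≤ 2 * m := by simpa [Nat.lt_succ_iff] using hk
  rw [Nat.choose_symm hk', Nat.sub_sub_self hk']
  simp
  ring

theorem pan_pow_expand {R : Type*} [CommRing R] (y : R) (hy : y ^ 4 = 0) (a : ℕ) :
    6 * (1 + y) ^ a = 6 + 6 * a * y + 3 * a * (a - 1) * y ^ 2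
      + a * (a - 1) * (a - 2) * y ^ 3 := by
  induction a with
  | zero => simp
  | succ n ih =>
    rw [pow_succ, ← mul_assoc, ih]
    push_cast
    linear_combination ((n : R) * (n - 1) * (n - 2)) * hy

theorem pan_log_mul {R : Type*} [CommRing R] (P u v : R) (hP : P ^ 4 = 0) :
    6 * (P * u + P * v + P * u * (P * v)) - 3 * (P * u + P * v + P * u * (P * v)) ^ 2
      + 2 * (P * u + P * v + P * u * (P * v)) ^ 3
    = (6 * (P * u) - 3 * (P * u) ^ 2 + 2 * (P * u) ^ 3)
      + (6 * (P * v) - 3 * (P * v) ^ 2 + 2 * (P * v) ^ 3) := by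
  linear_combination (2*P^2*u^3*v^3 + 6*P*u^3*v^2 + 6*P*u^2*v^3 + 6*u^3*v + 9*u^2*v^2 + 6*u*v^3) * hP

theorem pan_pow_shift {R : Type*} [CommRing R] (P x : R) (hP : P ^ 4 = 0) (n : ℕ) :
    P ^ 2 * (P + x) ^ (n + 1) = P ^ 2 * x ^ (n + 1) + (n + 1 : ℕ) * P ^ 3 * x ^ n := by
  induction n with
  | zero => simp; ring
  | succ n ih =>
    rw [pow_succ (P + x), ← mul_assoc, ih]
    push_cast
    linear_combination ((n + 1 : R) * x ^ n) * hP

/-- alternating sums pair up -/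
theorem pan_alt_pair {R : Type*} [CommRing R] (g : ℕ → R) (m : ℕ) :
    ∑ k ∈ Finset.range (2 * m + 1), (-1) ^ k * g k
      = g 0 + ∑ i ∈ Finset.range m, (g (2 * i + 2) - g (2 * i + 1)) := by
  induction m with
  | zero => simp
  | succ n ih =>
    rw [show 2 * (n + 1) + 1 = 2 * n + 1 + 1 + 1 by ring, Finset.sum_range_succ,
      Finset.sum_range_succ, ih, Finset.sum_range_succ]
    simp [pow_succ, pow_mul]
    ring

theorem pan_sum_reflect {R : Type*} [CommRing R] (g : ℕ → R) (m : ℕ) :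
    ∑ k ∈ Finset.range (2 * m), g (k + 1)
      = ∑ i ∈ Finset.range m, (g (i + 1) + g (2 * m + 1 - (i + 1))) := by
  rw [two_mul, Finset.sum_range_add, Finset.sum_add_distrib]
  congr 1
  rw [← Finset.sum_range_reflect]
  refine Finset.sum_congr rfl fun i hi => ?_
  have := Finset.mem_range.1 hi
  congr 1
  omega

theorem pan_sum_parity {R : Type*} [CommRing R] (g : ℕ → R) (m : ℕ) :
    ∑ k ∈ Finset.range (2 * m), g (k + 1)
      = ∑ i ∈ Finset.range m, (g (2 * (i + 1)) + g (2 * m + 1 - 2 * (i + 1))) := by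
  have h : ∀ n, ∑ k ∈ Finset.range (2 * n), g (k + 1)
      = ∑ i ∈ Finset.range n, g (2 * (i + 1)) + ∑ i ∈ Finset.range n, g (2 * i + 1) := by
    intro n
    induction n with
    | zero => simp
    | succ n ih =>
      rw [show 2 * (n + 1) = 2 * n + 1 + 1 by ring, Finset.sum_range_succ,
      Finset.sum_range_succ, ih, Finset.sum_range_succ, Finset.sum_range_succ]
      ring_nf
  rw [h, Finset.sum_add_distrib]
  congr 1
  rw [← Finset.sum_range_reflect]
  refine Finset.sum_congr rfl fun i hi => ?_
  have := Finset.mem_range.1 hi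
  congr 1
  omega

/-- Power sums modulo `p^2` (scaled by `p^2`), two relations. -/
theorem pan_power_sums {R : Type*} [CommRing R] (p m : ℕ) (hpm : p = 2 * m + 1)
    (hP : (p : R) ^ 4 = 0) (n : ℕ) (hn : Odd n) :
    (p : R) ^ 2 * ∑ k ∈ Finset.range (2 * m), ((k + 1 : ℕ) : R) ^ (n + 1)
      = 2 * ((p : R) ^ 2 * ∑ i ∈ Finset.range m, ((i + 1 : ℕ) : R) ^ (n + 1))
        - (n + 1 : ℕ) * ((p : R) ^ 3 * ∑ i ∈ Finset.range m, ((i + 1 : ℕ) : R) ^ n) ∧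
    (p : R) ^ 2 * ∑ k ∈ Finset.range (2 * m), ((k + 1 : ℕ) : R) ^ (n + 1)
      = 2 * 2 ^ (n + 1) * ((p : R) ^ 2 * ∑ i ∈ Finset.range m, ((i + 1 : ℕ) : R) ^ (n + 1))
        - (n + 1 : ℕ) * 2 ^ n * ((p : R) ^ 3 * ∑ i ∈ Finset.range m, ((i + 1 : ℕ) : R) ^ n) := by
  have hn1 : Even (n + 1) := hn.add_one
  constructor
  · rw [pan_sum_reflect (fun k => ((k : ℕ) : R) ^ (n + 1)), Finset.mul_sum, Finset.mul_sum,
      Finset.mul_sum, Finset.mul_sum, Finset.mul_sum, ← Finset.sum_sub_distrib]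
    refine Finset.sum_congr rfl fun i hi => ?_
    have := Finset.mem_range.1 hi
    rw [← hpm, Nat.cast_sub (by omega), mul_add, sub_eq_add_neg, pan_pow_shift _ _ hP,
      hn1.neg_pow, hn.neg_pow]
    ring
  · rw [pan_sum_parity (fun k => ((k : ℕ) : R) ^ (n + 1)), Finset.mul_sum, Finset.mul_sum,
      Finset.mul_sum, Finset.mul_sum, Finset.mul_sum, ← Finset.sum_sub_distrib]
    refine Finset.sum_congr rfl fun i hi => ?_
    have := Finset.mem_range.1 hi
    rw [← hpm, Nat.cast_sub (by omega), mul_add, sub_eq_add_neg, pan_pow_shift _ _ hP,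
      hn1.neg_pow, hn.neg_pow, Nat.cast_mul, mul_pow, mul_pow, Nat.cast_two]
    ring

/-- closed form used for the central binomial -/
theorem pan_central (m : ℕ) :
    (2 * m).choose m * m.factorial = 2 ^ m * ∏ i ∈ Finset.range m, (2 * i + 1) := by
  induction m with
  | zero => simp
  | succ n ih =>
    have h := Nat.succ_mul_centralBinom_succ n
    rw [Nat.centralBinom, Nat.centralBinom] at h
    rw [Nat.factorial_succ, Finset.prod_range_succ, pow_succ]
    calc _ = ((n + 1) * (2 * (n + 1)).choose (n + 1)) * n.factorial := by ring
      _ = 2 * (2 * n + 1) * ((2 * n).choose n * n.factorial) := by rw [h]; ring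
      _ = _ := by rw [ih]; ring

/-- The signed binomial `(-1)^k C(2m,k)`. -/
def panX (R : Type*) [CommRing R] (m k : ℕ) : R := (-1) ^ k * ((2 * m).choose k : R)

/-- Six times the truncated logarithm of `1 + y`. -/
def panL {R : Type*} [CommRing R] (y : R) : R := 6 * y - 3 * y ^ 2 + 2 * y ^ 3

theorem panL_mul {R : Type*} [CommRing R] (P s t : R) (hP : P ^ 4 = 0)
    (hs : ∃ u, s = 1 + P * u) (ht : ∃ u, t = 1 + P * u) :
    panL (s * t - 1) = panL (s - 1) + panL (t - 1) := by
  obtain ⟨u, rfl⟩ := hs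
  obtain ⟨v, rfl⟩ := ht
  have h := pan_log_mul P u v hP
  unfold panL
  linear_combination h

section core
variable {R : Type*} [CommRing R] (p m : ℕ) (hpm : p = 2 * m + 1) (hP : (p : R) ^ 4 = 0)
  (v : ℕ → R) (hv : ∀ i, i < 2 * m → ((i + 1 : ℕ) : R) * v i = 1)

theorem panX_succ (p m : ℕ) (hpm : p = 2 * m + 1) (v : ℕ → R)
    (hv : ∀ i, i < 2 * m → ((i + 1 : ℕ) : R) * v i = 1) (k : ℕ) (hk : k < 2 * m) :
    panX R m (k + 1) = panX R m k * (1 - p * v k) := by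
  have h := congrArg (Nat.cast (R := R)) (Nat.choose_succ_right_eq (2 * m) k)
  rw [Nat.cast_mul, Nat.cast_mul, Nat.cast_sub hk.le] at h
  have hvk := hv k hk
  unfold panX
  rw [hpm]
  push_cast at *
  rw [pow_succ]
  linear_combination (-(-1) ^ k * v k) * h
    + (-(-1) ^ k * ((2 * m).choose (k+1) : R) * (-1) + (-1) ^ k * ((2 * m).choose k : R)) * hvk

theorem panX_one (p m : ℕ) (hpm : p = 2 * m + 1) (v : ℕ → R)
    (hv : ∀ i, i < 2 * m → ((i + 1 : ℕ) : R) * v i = 1) (k : ℕ) (hk : k ≤ 2 * m) :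
    ∃ u, panX R m k = 1 + p * u := by
  induction k with
  | zero => exact ⟨0, by simp [panX]⟩
  | succ k ih =>
    obtain ⟨u, hu⟩ := ih (by omega)
    rw [panX_succ p m hpm v hv k (by omega), hu]
    exact ⟨u - v k - p * u * v k, by ring⟩

theorem panL_neg (P t : R) : panL ((1 - P * t) - 1)
    = -6 * P * t - 3 * P ^ 2 * t ^ 2 - 2 * P ^ 3 * t ^ 3 := by
  unfold panL; ring

theorem panL_X_succ (p m : ℕ) (hpm : p = 2 * m + 1) (hP : (p : R) ^ 4 = 0) (v : ℕ → R)
    (hv : ∀ i, i < 2 * m → ((i + 1 : ℕ) : R) * v i = 1) (k : ℕ) (hk : k < 2 * m) :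
    panL (panX R m (k + 1) - 1) = panL (panX R m k - 1) + panL ((1 - p * v k) - 1) := by
  rw [panX_succ p m hpm v hv k hk]
  exact panL_mul (p : R) _ _ hP (panX_one p m hpm v hv k hk.le) ⟨- v k, by ring⟩

theorem panL_X (p m : ℕ) (hpm : p = 2 * m + 1) (hP : (p : R) ^ 4 = 0) (v : ℕ → R)
    (hv : ∀ i, i < 2 * m → ((i + 1 : ℕ) : R) * v i = 1) (k : ℕ) (hk : k ≤ 2 * m) :
    panL (panX R m k - 1) = ∑ i ∈ Finset.range k, panL ((1 - p * v i) - 1) := by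
  induction k with
  | zero => simp [panX, panL]
  | succ k ih =>
    rw [panL_X_succ p m hpm hP v hv k (by omega), ih (by omega), Finset.sum_range_succ]

theorem panL_alt (p m : ℕ) (hpm : p = 2 * m + 1) (hP : (p : R) ^ 4 = 0) (v : ℕ → R)
    (hv : ∀ i, i < 2 * m → ((i + 1 : ℕ) : R) * v i = 1) :
    ∑ k ∈ Finset.range (2 * m + 1), (-1) ^ k * panL (panX R m k - 1)
      = ∑ i ∈ Finset.range m, panL ((1 - p * v (2 * i + 1)) - 1) := by
  rw [pan_alt_pair]
  have h0 : panL (panX R m 0 - 1) = 0 := by simp [panX, panL]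
  rw [h0, zero_add]
  refine Finset.sum_congr rfl fun i hi => ?_
  have := Finset.mem_range.1 hi
  rw [panL_X_succ p m hpm hP v hv (2 * i + 1) (by omega)]
  ring

theorem panL_prod (P : R) (hP : P ^ 4 = 0) (f : ℕ → R) (n : ℕ) :
    (∃ u, ∏ i ∈ Finset.range n, (1 - P * f i) = 1 + P * u) ∧
    panL (∏ i ∈ Finset.range n, (1 - P * f i) - 1)
      = ∑ i ∈ Finset.range n, panL ((1 - P * f i) - 1) := by
  induction n with
  | zero => exact ⟨⟨0, by simp⟩, by simp [panL]⟩
  | succ n ih =>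
    obtain ⟨hu, h⟩ := ih
    rw [Finset.prod_range_succ, Finset.sum_range_succ]
    refine ⟨?_, ?_⟩
    · obtain ⟨u, hu⟩ := hu
      exact ⟨u - f n - P * u * f n, by rw [hu]; ring⟩
    · rw [panL_mul P _ _ hP hu ⟨- f n, by ring⟩, h]

theorem panX_mid (p m : ℕ) (hpm : p = 2 * m + 1) (v : ℕ → R)
    (hv : ∀ i, i < 2 * m → ((i + 1 : ℕ) : R) * v i = 1) :
    panX R m m = 2 ^ (2 * m) * ∏ i ∈ Finset.range m, (1 - p * v (2 * i + 1)) := by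
  have hf : ((m.factorial : ℕ) : R) * ∏ i ∈ Finset.range m, v i = 1 := by
    rw [← Finset.prod_range_add_one_eq_factorial, Nat.cast_prod, ← Finset.prod_mul_distrib]
    refine Finset.prod_eq_one fun i hi => hv i ?_
    have := Finset.mem_range.1 hi
    omega
  have h1 : panX R m m * (m.factorial : R)
      = 2 ^ (2 * m) * (∏ i ∈ Finset.range m, (1 - p * v (2 * i + 1))) * (m.factorial : R) := by
    have hc := congrArg (Nat.cast (R := R)) (pan_central m)
    unfold panX
    rw [mul_assoc, ← Nat.cast_mul, hc, ← Finset.prod_range_add_one_eq_factorial,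
      Nat.cast_mul, Nat.cast_prod, Nat.cast_prod, two_mul m, pow_add, mul_assoc, mul_assoc,
      ← Finset.prod_mul_distrib, Nat.cast_pow, Nat.cast_two, mul_left_comm]
    congr 1
    rw [← Finset.prod_range_reflect]
    have e1 : ∀ c : R, c ^ m = ∏ i ∈ Finset.range m, c := fun c => by simp
    rw [e1, e1, ← Finset.prod_mul_distrib, ← Finset.prod_mul_distrib]
    refine Finset.prod_congr rfl fun i hi => ?_
    have := Finset.mem_range.1 hi
    have hvi := hv (2 * i + 1) (by omega)
    have e : 2 * (m - 1 - i) + 1 + (2 * i + 2) = p := by omega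
    have e' := congrArg (Nat.cast (R := R)) e
    push_cast at *
    linear_combination (-1 : R) * e' + p * hvi
  calc panX R m m = panX R m m * (m.factorial : R) * ∏ i ∈ Finset.range m, v i := by
        rw [mul_assoc, hf, mul_one]
    _ = _ := by rw [h1, mul_assoc _ (m.factorial : R), hf, mul_one]

end core

theorem pan_core {R : Type*} [CommRing R] (p m : ℕ) (hpm : p = 2 * m + 1) (hm : 2 ≤ m)
    (hP : (p : R) ^ 4 = 0) (v : ℕ → R)
    (hv : ∀ i, i < 2 * m → ((i + 1 : ℕ) : R) * v i = 1) (β : R)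
    (hD : 3 * ((p : R) ^ 2 * ∑ i ∈ Finset.range m, v i ^ 2
      + (p : R) ^ 3 * ∑ i ∈ Finset.range m, v i ^ 3) = (p : R) ^ 3 * β) (a : ℕ) :
    48 * (∑ k ∈ Finset.range (2 * m + 1), (-1) ^ k * panX R m k ^ a - (2 ^ (2 * m)) ^ a)
      = a * (a - 1) * (3 * a - 4) * ((p : R) ^ 3 * β) := by
  have hu2 : (2 : R) * v 1 = 1 := by simpa using hv 1 (by omega)
  have hu3 : (3 : R) * v 2 = 1 := by
    have := hv 2 (by omega)
    push_cast at this
    linear_combination this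
  -- V1, V2, V3
  have hX : ∀ k, ∃ u, k < 2 * m + 1 → panX R m k = 1 + p * u := fun k => by
    by_cases hk : k < 2 * m + 1
    · obtain ⟨u, hu⟩ := panX_one p m hpm v hv k (by omega)
      exact ⟨u, fun _ => hu⟩
    · exact ⟨0, fun h => absurd h hk⟩
  choose u hu using hX
  obtain ⟨U1, hU1⟩ : ∃ U, U = ∑ k ∈ Finset.range (2 * m + 1), (-1) ^ k * u k := ⟨_, rfl⟩
  obtain ⟨U2, hU2⟩ : ∃ U, U = ∑ k ∈ Finset.range (2 * m + 1), (-1) ^ k * u k ^ 2 := ⟨_, rfl⟩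
  obtain ⟨U3, hU3⟩ : ∃ U, U = ∑ k ∈ Finset.range (2 * m + 1), (-1) ^ k * u k ^ 3 := ⟨_, rfl⟩
  have hU0 : ∑ k ∈ Finset.range (2 * m + 1), (-1 : R) ^ k = 1 := by
    have := pan_alt_pair (fun _ => (1 : R)) m
    simp only [mul_one, sub_self, Finset.sum_const_zero, add_zero] at this
    exact this
  have hs : (2 : R) ^ (2 * m) = 1 + p * U1 := by
    have h := Nat.sum_range_choose (2 * m)
    have h' := congrArg (Nat.cast (R := R)) h
    push_cast at h'
    suffices h2 : (2 : R) ^ (2 * m)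
        = ∑ k ∈ Finset.range (2 * m + 1), (-1 : R) ^ k + p * U1 by rw [h2, hU0]
    rw [← h', hU1, Finset.mul_sum, ← Finset.sum_add_distrib]
    refine Finset.sum_congr rfl fun k hk => ?_
    have := hu k (Finset.mem_range.1 hk)
    unfold panX at this
    have e : ((-1 : R) ^ k) * (-1) ^ k = 1 := by rw [← mul_pow]; simp
    linear_combination (-1) ^ k * this - ((2 * m).choose k : R) * e
  have hS2 : panX R m m = 1 + 2 * p * U1 + p ^ 2 * U2 := by
    have h := congrArg (Int.cast (R := R)) (pan_alt_sq m)
    push_cast at h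
    suffices h2 : panX R m m
        = ∑ k ∈ Finset.range (2 * m + 1), (-1 : R) ^ k + 2 * p * U1 + p ^ 2 * U2 by rw [h2, hU0]
    unfold panX
    rw [← h, hU1, hU2, Finset.mul_sum, Finset.mul_sum, ← Finset.sum_add_distrib,
      ← Finset.sum_add_distrib]
    refine Finset.sum_congr rfl fun k hk => ?_
    have := hu k (Finset.mem_range.1 hk)
    unfold panX at this
    have e : ((-1 : R) ^ k) * (-1) ^ k = 1 := by rw [← mul_pow]; simp
    linear_combination ((-1) ^ k * ((-1) ^ k * ((2 * m).choose k : R) + 1 + p * u k)) * this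
      - ((-1) ^ k * ((2 * m).choose k : R) ^ 2) * e
  have hSa : 6 * ∑ k ∈ Finset.range (2 * m + 1), (-1) ^ k * panX R m k ^ a
      = 6 + 6 * a * (p * U1) + 3 * a * (a - 1) * (p ^ 2 * U2)
        + a * (a - 1) * (a - 2) * (p ^ 3 * U3) := by
    rw [hU1, hU2, hU3]
    calc _ = 6 * ∑ k ∈ Finset.range (2 * m + 1), (-1 : R) ^ k +
        6 * a * (p * ∑ k ∈ Finset.range (2 * m + 1), (-1) ^ k * u k)
        + 3 * a * (a - 1) * (p ^ 2 * ∑ k ∈ Finset.range (2 * m + 1), (-1) ^ k * u k ^ 2)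
        + a * (a - 1) * (a - 2) *
          (p ^ 3 * ∑ k ∈ Finset.range (2 * m + 1), (-1) ^ k * u k ^ 3) := by
          simp only [Finset.mul_sum]
          rw [← Finset.sum_add_distrib, ← Finset.sum_add_distrib, ← Finset.sum_add_distrib]
          refine Finset.sum_congr rfl fun k hk => ?_
          rw [hu k (Finset.mem_range.1 hk)]
          have := pan_pow_expand ((p : R) * u k) (by rw [mul_pow, hP, zero_mul]) a
          linear_combination (-1) ^ k * this
      _ = _ := by rw [hU0]; ring
  have hE2 : ∑ k ∈ Finset.range (2 * m + 1), (-1) ^ k * panL (panX R m k - 1)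
      = 6 * (p * U1) - 3 * (p ^ 2 * U2) + 2 * (p ^ 3 * U3) := by
    rw [hU1, hU2, hU3]
    simp only [Finset.mul_sum]
    rw [← Finset.sum_sub_distrib, ← Finset.sum_add_distrib]
    refine Finset.sum_congr rfl fun k hk => ?_
    rw [hu k (Finset.mem_range.1 hk)]
    unfold panL
    ring
  rw [panL_alt p m hpm hP v hv] at hE2
  obtain ⟨hQ1, hQ⟩ := panL_prod (p : R) hP (fun i => v (2 * i + 1)) m
  have hL1 := panL_X p m hpm hP v hv m (by omega)
  have hmul : panL (panX R m m - 1) = panL ((1 + p * U1) - 1) +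
      ∑ i ∈ Finset.range m, panL ((1 - p * v (2 * i + 1)) - 1) := by
    rw [panX_mid p m hpm v hv, hs, panL_mul (p : R) _ _ hP ⟨_, rfl⟩ hQ1, hQ]
  have hDE : 2 * (2 * ∑ i ∈ Finset.range m, panL ((1 - p * v (2 * i + 1)) - 1)
      - ∑ i ∈ Finset.range m, panL ((1 - (p : R) * v i) - 1)) = p ^ 3 * β := by
    rw [← hD]
    simp only [Finset.mul_sum]
    rw [← Finset.sum_sub_distrib, ← Finset.sum_add_distrib, Finset.mul_sum, Finset.mul_sum]
    refine Finset.sum_congr rfl fun i hi => ?_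
    have hi' := Finset.mem_range.1 hi
    have h1 := hv i (by omega)
    have h2 := hv (2 * i + 1) (by omega)
    have h3 : v i = 2 * v (2 * i + 1) := by
      push_cast at h1 h2
      linear_combination (2 * v (2 * i + 1)) * h1 - v i * h2
    rw [panL_neg, panL_neg, h3]
    ring
  rw [← hL1] at hDE
  rw [hS2] at hDE hmul
  rw [hE2] at hDE hmul
  rw [hs]
  have hsa := pan_pow_expand ((p : R) * U1) (by rw [mul_pow, hP, zero_mul]) a
  -- abstract algebra
  generalize (p : R) = P at *
  generalize hSS : ∑ k ∈ Finset.range (2 * m + 1), (-1) ^ k * panX R m k ^ a = S at *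
  unfold panL at hDE hmul
  obtain ⟨d, hd⟩ : ∃ d, d = U2 - U1 ^ 2 := ⟨_, rfl⟩
  obtain rfl : U2 = U1 ^ 2 + d := by rw [hd]; ring
  have k1 : 12 * P ^ 2 * d - 24 * P ^ 3 * U1 * d = P ^ 3 * β := by
    linear_combination hDE + 4 * hmul - 2 * (-3 * (U1 ^ 2 + d) ^ 2 + 24 * U1 ^ 2 * (U1 ^ 2 + d)
      + 12 * P * U1 * (U1 ^ 2 + d) ^ 2 + 2 * P ^ 2 * (U1 ^ 2 + d) ^ 3) * hP
  have k2 : P ^ 3 * d = 0 := by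
    have h12 : 12 * (v 1 ^ 2 * v 2) = 1 := by
      linear_combination 3 * v 2 * (2 * v 1 + 1) * hu2 + hu3
    have h : 12 * (P ^ 3 * d) = 0 := by
      linear_combination P * k1 + (β + 24 * U1 * d) * hP
    linear_combination (v 1 ^ 2 * v 2) * h - P ^ 3 * d * h12
  have k3 : 2 * (P ^ 3 * U3) = 9 * (P ^ 2 * d) + 2 * (P ^ 3 * U1 ^ 3) := by
    linear_combination -hmul + (-3 * (U1 ^ 2 + d) ^ 2 + 24 * U1 ^ 2 * (U1 ^ 2 + d)
      + 12 * P * U1 * (U1 ^ 2 + d) ^ 2 + 2 * P ^ 2 * (U1 ^ 2 + d) ^ 3) * hP - 12 * U1 * k2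
  have k4 : 12 * (P ^ 2 * d) = P ^ 3 * β := by
    linear_combination k1 + 24 * U1 * k2
  linear_combination 8 * hSa - 8 * hsa + 4 * a * (a - 1) * (a - 2) * k3
    + a * (a - 1) * (3 * a - 4) * k4

theorem pan_arith (p m : ℕ) [hp : Fact p.Prime] (hpm : p = 2 * m + 1) (hm : 2 ≤ m)
    (β : ZMod (p ^ 4))
    (hβ : (p : ZMod (p ^ 4)) ^ 2 * ∑ k ∈ Finset.range (2 * m), ((k + 1 : ℕ) : ZMod (p ^ 4)) ^ (p - 3)
      = (p : ZMod (p ^ 4)) ^ 3 * β) :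
    ∃ v : ℕ → ZMod (p ^ 4), (∀ i, i < 2 * m → ((i + 1 : ℕ) : ZMod (p ^ 4)) * v i = 1) ∧
      3 * ((p : ZMod (p ^ 4)) ^ 2 * ∑ i ∈ Finset.range m, v i ^ 2
      + (p : ZMod (p ^ 4)) ^ 3 * ∑ i ∈ Finset.range m, v i ^ 3) = (p : ZMod (p ^ 4)) ^ 3 * β := by
  have hP : (p : ZMod (p ^ 4)) ^ 4 = 0 := by
    rw [← Nat.cast_pow]; exact ZMod.natCast_self _
  obtain ⟨N, hN⟩ : ∃ N, N = (p ^ 4).totient := ⟨_, rfl⟩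
  have hN' : N = p ^ 3 * (p - 1) := by
    rw [hN, Nat.totient_prime_pow hp.out (by norm_num)]
  have hN5 : 5 ≤ N := by
    rw [hN']
    have : 5 ^ 3 ≤ p ^ 3 := Nat.pow_le_pow_left (by omega) 3
    have h2 : 1 ≤ p - 1 := by omega
    nlinarith
  have hNpos : 1 ≤ N := by omega
  have hcop : ∀ i, i < 2 * m → (i + 1).Coprime p := fun i hi =>
    (Nat.coprime_of_lt_prime (by omega) (by omega) hp.out).symm
  have hE : ∀ i, i < 2 * m → ((i + 1 : ℕ) : ZMod (p ^ 4)) ^ N = 1 := by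
    intro i hi
    have h := ZMod.pow_totient (ZMod.unitOfCoprime (i + 1) ((hcop i hi).pow_right 4))
    have h' := congrArg Units.val h
    rw [Units.val_pow_eq_pow_val, ZMod.coe_unitOfCoprime, ← hN] at h'
    exact h'
  have hF : ∀ i, i < 2 * m → ∃ q, ((i + 1 : ℕ) : ZMod (p ^ 4)) ^ (p - 1) = 1 + p * q := by
    intro i hi
    have h := Nat.ModEq.pow_totient (hcop i hi)
    rw [Nat.totient_prime hp.out] at h
    obtain ⟨q, hq⟩ := (Nat.modEq_iff_dvd.1 h.symm)
    refine ⟨(q : ℤ), ?_⟩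
    have := congrArg (Int.cast (R := ZMod (p ^ 4))) hq
    push_cast at *
    linear_combination this
  have hpN : (p : ZMod (p ^ 4)) ^ 3 * (N : ZMod (p ^ 4)) = 0 := by
    rw [hN']
    push_cast
    linear_combination ((p : ZMod (p ^ 4)) ^ 2 * ((p - 1 : ℕ) : ZMod (p ^ 4))) * hP
  refine ⟨fun i => ((i + 1 : ℕ) : ZMod (p ^ 4)) ^ (N - 1), fun i hi => ?_, ?_⟩
  · rw [← pow_succ', Nat.sub_add_cancel hNpos]; exact hE i hi
  have hu2 : (2 : ZMod (p ^ 4)) * 2 ^ (N - 1) = 1 := by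
    rw [← pow_succ', Nat.sub_add_cancel hNpos]; simpa using hE 1 (by omega)
  have hu3 : (3 : ZMod (p ^ 4)) * 3 ^ (N - 1) = 1 := by
    rw [← pow_succ', Nat.sub_add_cancel hNpos]
    have := hE 2 (by omega)
    norm_num at this ⊢
    exact this
  have a2 : ∑ i ∈ Finset.range m, (((i + 1 : ℕ) : ZMod (p ^ 4)) ^ (N - 1)) ^ 2
      = ∑ i ∈ Finset.range m, ((i + 1 : ℕ) : ZMod (p ^ 4)) ^ (2 * N - 3 + 1) := by
    refine Finset.sum_congr rfl fun i _ => ?_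
    rw [← pow_mul]; congr 1; omega
  have a3 : ∑ i ∈ Finset.range m, (((i + 1 : ℕ) : ZMod (p ^ 4)) ^ (N - 1)) ^ 3
      = ∑ i ∈ Finset.range m, ((i + 1 : ℕ) : ZMod (p ^ 4)) ^ (2 * N - 3) := by
    refine Finset.sum_congr rfl fun i hi => ?_
    have := Finset.mem_range.1 hi
    rw [← pow_mul, show (N - 1) * 3 = N + (2 * N - 3) by omega, pow_add, hE i (by omega), one_mul]
  have a4 : (p : ZMod (p ^ 4)) ^ 3 * ∑ i ∈ Finset.range m, ((i + 1 : ℕ) : ZMod (p ^ 4)) ^ (2 * N - 3)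
      = (p : ZMod (p ^ 4)) ^ 3 * ∑ i ∈ Finset.range m, ((i + 1 : ℕ) : ZMod (p ^ 4)) ^ (p - 4) := by
    rw [Finset.mul_sum, Finset.mul_sum]
    refine Finset.sum_congr rfl fun i hi => ?_
    have := Finset.mem_range.1 hi
    obtain ⟨q, hq⟩ := hF i (by omega)
    have hpow : ∀ t : ℕ, (p : ZMod (p ^ 4)) ^ 3 * (1 + p * q) ^ t = (p : ZMod (p ^ 4)) ^ 3 := by
      intro t
      induction t with
      | zero => simp
      | succ t ih =>
        rw [pow_succ (1 + (p : ZMod (p ^ 4)) * q), ← mul_assoc, ih]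
        linear_combination q * hP
    have hexp : 2 * N - 3 = (p - 1) * (2 * p ^ 3 - 1) + (p - 4) := by
      obtain ⟨r, rfl⟩ : ∃ r, p = r + 5 := ⟨p - 5, by omega⟩
      have : 1 ≤ (r + 5) ^ 3 := Nat.one_le_pow _ _ (by omega)
      obtain ⟨c, hc⟩ : ∃ c, (r + 5) ^ 3 = c + 1 := ⟨(r + 5) ^ 3 - 1, by omega⟩
      rw [hN', hc]
      have e1 : r + 5 - 1 = r + 4 := by omega
      have e2 : r + 5 - 4 = r + 1 := by omega
      have e3 : 2 * (c + 1) - 1 = 2 * c + 1 := by omega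
      rw [e1, e2, e3]
      have : 2 * ((c + 1) * (r + 4)) = (r + 4) * (2 * c + 1) + (r + 1) + 3 := by ring
      omega
    rw [hexp, pow_add, pow_mul, hq, ← mul_assoc, hpow]
  obtain ⟨e1, e2⟩ := pan_power_sums p m hpm hP (2 * N - 3) ⟨N - 2, by omega⟩
  obtain ⟨e3, e4⟩ := pan_power_sums p m hpm hP (p - 4) ⟨m - 2, by omega⟩
  rw [← a4] at e3 e4
  rw [show p - 4 + 1 = p - 3 by omega, hβ] at e3 e4
  simp only [a2, a3]
  have c1 : ((2 * N - 3 + 1 : ℕ) : ZMod (p ^ 4)) = 2 * N - 2 := by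
    rw [show 2 * N - 3 + 1 = 2 * N - 2 by omega, Nat.cast_sub (by omega)]; push_cast; ring
  have c2 : ((p - 3 : ℕ) : ZMod (p ^ 4)) = p - 3 := by
    rw [Nat.cast_sub (by omega)]; push_cast; ring
  have c3 : (8 : ZMod (p ^ 4)) * 2 ^ (2 * N - 3) = 1 := by
    have h : (2 : ZMod (p ^ 4)) ^ N = 1 := by simpa using hE 1 (by omega)
    calc _ = (2 : ZMod (p ^ 4)) ^ (2 * N - 3 + 3) := by rw [pow_add]; ring
      _ = (2 ^ N) ^ 2 := by rw [← pow_mul]; congr 1; omega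
      _ = 1 := by rw [h, one_pow]
  obtain ⟨q, hq⟩ := hF 1 (by omega)
  have c4 : (8 : ZMod (p ^ 4)) * 2 ^ (p - 4) = 1 + p * q := by
    rw [← hq]
    calc _ = (2 : ZMod (p ^ 4)) ^ (p - 4 + 3) := by rw [pow_add]; ring
      _ = _ := by rw [show p - 4 + 3 = p - 1 by omega]; norm_num
  rw [c1, pow_succ (2 : ZMod (p ^ 4))] at e2
  rw [c1] at e1
  rw [c2] at e3 e4
  rw [show p - 3 = p - 4 + 1 by omega, pow_succ (2 : ZMod (p ^ 4))] at e4
  rw [show p - 3 = p - 4 + 1 by omega] at e3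
  generalize (p : ZMod (p ^ 4)) = P at *
  generalize (2 : ZMod (p ^ 4)) ^ (N - 1) = w2 at *
  generalize (3 : ZMod (p ^ 4)) ^ (N - 1) = w3 at *
  generalize (2 : ZMod (p ^ 4)) ^ (2 * N - 3) = t at *
  generalize (2 : ZMod (p ^ 4)) ^ (p - 4) = t' at *
  generalize ∑ i ∈ Finset.range m, ((i + 1 : ℕ) : ZMod (p ^ 4)) ^ (2 * N - 3 + 1) = A2 at *
  generalize ∑ i ∈ Finset.range m, ((i + 1 : ℕ) : ZMod (p ^ 4)) ^ (2 * N - 3) = A3 at *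
  generalize ∑ i ∈ Finset.range m, ((i + 1 : ℕ) : ZMod (p ^ 4)) ^ (p - 4 + 1) = B2 at *
  generalize ∑ k ∈ Finset.range (2 * m), ((k + 1 : ℕ) : ZMod (p ^ 4)) ^ (2 * N - 3 + 1) = T at *
  have f1 : P ^ 2 * T = 2 * (P ^ 2 * A2) + 2 * (P ^ 3 * A3) := by
    linear_combination e1 - 2 * A3 * hpN
  have f2 : 4 * (P ^ 2 * T) = 2 * (P ^ 2 * A2) + P ^ 3 * A3 := by
    linear_combination 4 * e2 - 8 * t * A3 * hpN + (2 * (P ^ 2 * A2) + P ^ 3 * A3) * c3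
  have f3 : P ^ 3 * β = 2 * (P ^ 2 * B2) + 3 * (P ^ 3 * A3) := by
    linear_combination e3 - A3 * hP
  have f5 : P ^ 3 * B2 = 0 := by
    linear_combination (-w2 * P) * f3 - P ^ 3 * B2 * hu2 + w2 * (β - 3 * A3) * hP
  have f4 : 8 * (P ^ 3 * β) = 4 * (P ^ 2 * B2) + 3 * (P ^ 3 * A3) := by
    linear_combination 8 * e4 + (4 * (P ^ 2 * B2) + 3 * (P ^ 3 * A3) - P ^ 4 * A3) * c4
      + 4 * q * f5 + (3 * q * A3 - A3 * (1 + P * q)) * hP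
  have f6 : P ^ 3 * A3 = -2 * (P ^ 3 * β) := by
    linear_combination w3 * (f4 - 2 * f3) - (P ^ 3 * A3 + 2 * P ^ 3 * β) * hu3
  linear_combination w2 * (f2 - 4 * f1 - f6) - (3 * P ^ 2 * A2 + 3 * P ^ 3 * A3 - P ^ 3 * β) * hu2

theorem pan_bern_integral (p : ℕ) [hp : Fact p.Prime] (k : ℕ) (hk : k + 1 < p) :
    ‖((bernoulli k : ℚ) : ℚ_[p])‖ ≤ 1 := by
  induction k using Nat.strong_induction_on with
  | _ k ih =>
    rcases Nat.eq_zero_or_pos k with rfl | hk0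
    · simp
    have h := sum_bernoulli (k + 1)
    rw [if_neg (by omega), Finset.sum_range_succ] at h
    have h2 : ((k + 1 : ℕ) : ℚ) * bernoulli k
        = -∑ i ∈ Finset.range k, ((k + 1).choose i : ℚ) * bernoulli i := by
      rw [Nat.choose_succ_self_right] at h
      linear_combination h
    have h3 := congrArg (fun q : ℚ => ‖((q : ℚ) : ℚ_[p])‖) h2
    have hunit : ‖((k + 1 : ℕ) : ℚ_[p])‖ = 1 := by
      rw [Padic.norm_natCast_eq_one_iff]
      exact (Nat.coprime_of_lt_prime (by omega) hk hp.out)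
    rw [Rat.cast_mul, norm_mul, Rat.cast_natCast, hunit, one_mul] at h3
    rw [h3, Rat.cast_neg, norm_neg, Rat.cast_sum]
    refine IsUltrametricDist.norm_sum_le_of_forall_le_of_nonneg zero_le_one fun i hi => ?_
    have hi' := Finset.mem_range.1 hi
    rw [Rat.cast_mul, norm_mul, Rat.cast_natCast]
    exact mul_le_one₀ (by simpa using Padic.norm_int_le_one (p := p) ((k + 1).choose i : ℤ)) (norm_nonneg _) (ih i hi' (by omega))

/-- `∑ j^(p-3) ≡ p B_{p-3}` modulo `p^2`. -/
theorem pan_faulhaber (p : ℕ) [hp : Fact p.Prime] (hp5 : 5 ≤ p) :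
    ‖(((∑ k ∈ Finset.range p, (k : ℚ) ^ (p - 3)) - p * bernoulli (p - 3) : ℚ) : ℚ_[p])‖
      ≤ (p : ℝ) ^ (-(2 : ℤ)) := by
  rw [sum_range_pow, Finset.sum_range_succ]
  have e : bernoulli (p - 3) * ((p - 3 + 1).choose (p - 3) : ℚ) * (p : ℚ) ^ (p - 3 + 1 - (p - 3))
      / ((p - 3 : ℕ) + 1) = p * bernoulli (p - 3) := by
    rw [Nat.choose_succ_self_right, Nat.add_sub_cancel_left]
    have : (((p - 3 : ℕ) : ℚ) + 1) ≠ 0 := by positivity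
    push_cast
    field_simp
  rw [e, add_sub_cancel_right, Rat.cast_sum]
  refine IsUltrametricDist.norm_sum_le_of_forall_le_of_nonneg (by positivity) fun i hi => ?_
  have hi' := Finset.mem_range.1 hi
  have hunit : ‖((p - 3 + 1 : ℕ) : ℚ_[p])‖ = 1 := by
    rw [Padic.norm_natCast_eq_one_iff]
    exact (Nat.coprime_of_lt_prime (by omega) (by omega) hp.out)
  have hr : (bernoulli i * ((p - 3 + 1).choose i : ℚ) * (p : ℚ) ^ (p - 3 + 1 - i)
      / ((p - 3 : ℕ) + 1)) = bernoulli i * (((p - 3 + 1).choose i * p ^ (p - 3 + 1 - i - 2) : ℕ) : ℚ)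
        * (p : ℚ) ^ 2 / ((p - 3 + 1 : ℕ) : ℚ) := by
    obtain ⟨c, hc⟩ : ∃ c, p - 3 + 1 - i = c + 2 := ⟨p - 3 + 1 - i - 2, by omega⟩
    rw [hc]
    rw [Nat.add_sub_cancel]
    push_cast
    ring
  rw [hr]
  rw [Rat.cast_div, Rat.cast_mul, Rat.cast_mul, Rat.cast_natCast, Rat.cast_natCast, norm_div, hunit,
    div_one, norm_mul, norm_mul]
  have h1 := pan_bern_integral p i (by omega)
  have h2 : ‖(((p - 3 + 1).choose i * p ^ (p - 3 + 1 - i - 2) : ℕ) : ℚ_[p])‖ ≤ 1 := by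
    simpa using Padic.norm_int_le_one (p := p) (((p - 3 + 1).choose i * p ^ (p - 3 + 1 - i - 2) : ℕ) : ℤ)
  have h3 : ‖(((p : ℚ) ^ 2 : ℚ) : ℚ_[p])‖ = (p : ℝ) ^ (-(2 : ℤ)) := by
    push_cast
    simpa using Padic.norm_p_pow (p := p) 2
  rw [h3]
  exact mul_le_of_le_one_left (by positivity) (mul_le_one₀ h1 (norm_nonneg _) h2)

theorem pan_three_dvd (b : ℕ) :
    (81 : ℤ) ∣ 16 * (2 + 2 * (-2) ^ b - 4 * 4 ^ b) - 9 * ((b + 1) * b * (3 * b - 1)) := by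
  induction b using Nat.strong_induction_on with
  | _ b ih =>
    by_cases hb : b < 27
    · interval_cases b <;> norm_num
    · obtain ⟨c, rfl⟩ : ∃ c, b = c + 27 := ⟨b - 27, by omega⟩
      have h := ih c (by omega)
      have e1 : (81 : ℤ) ∣ (-2) ^ 27 - 1 := by norm_num
      have e2 : (81 : ℤ) ∣ 4 ^ 27 - 1 := by norm_num
      obtain ⟨r, hr⟩ := h
      obtain ⟨s, hs⟩ := e1
      obtain ⟨t, ht⟩ := e2
      refine ⟨r + 32 * (-2) ^ c * s - 64 * 4 ^ c * t - (9 * (c : ℤ) ^ 2 + 247 * c + 2240) * 3, ?_⟩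
      rw [pow_add, pow_add]
      push_cast
      linear_combination hr + 32 * (-2) ^ c * hs - 64 * 4 ^ c * ht

theorem pan_main_three (a : ℕ) (ha : 1 ≤ a) [Fact (Nat.Prime 3)] :
    ‖(((∑ k ∈ Finset.range 3, (-1 : ℚ) ^ ((a - 1) * k) * ((3 - 1).choose k : ℚ) ^ a)
        - (2 ^ (a * (3 - 1))
          + ((a : ℚ) * (a - 1) * (3 * a - 4) / 48) * ((3 : ℕ) : ℚ) ^ 3 * bernoulli (3 - 3)) : ℚ) : ℚ_[3])‖
      ≤ ((3 : ℕ) : ℝ) ^ (-(4 : ℤ)) := by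
  obtain ⟨b, rfl⟩ : ∃ b, a = b + 1 := ⟨a - 1, by omega⟩
  have hz := pan_three_dvd b
  obtain ⟨z, hzz⟩ : ∃ z, z = 16 * (2 + 2 * (-2) ^ b - 4 * 4 ^ b) - 9 * (((b : ℤ) + 1) * b * (3 * b - 1)) :=
    ⟨_, rfl⟩
  rw [← hzz] at hz
  have hn : ‖((z : ℤ) : ℚ_[3])‖ ≤ ((3 : ℕ) : ℝ) ^ (-(4 : ℕ) : ℤ) :=
    (Padic.norm_int_le_pow_iff_dvd z 4).2 (by simpa using hz)
  have hu : ‖((16 : ℕ) : ℚ_[3])‖ = 1 := by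
    rw [Padic.norm_natCast_eq_one_iff]; norm_num
  have hE : ((∑ k ∈ Finset.range 3, (-1 : ℚ) ^ ((b + 1 - 1) * k) * ((3 - 1).choose k : ℚ) ^ (b + 1))
        - (2 ^ ((b + 1) * (3 - 1))
          + (((b + 1 : ℕ) : ℚ) * ((b + 1 : ℕ) - 1) * (3 * (b + 1 : ℕ) - 4) / 48) * ((3 : ℕ) : ℚ) ^ 3
            * bernoulli (3 - 3)) : ℚ) = (z : ℚ) / ((16 : ℕ) : ℚ) := by
    have e1 : (2 : ℚ) ^ ((b + 1) * (3 - 1)) = 4 * 4 ^ b := by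
      rw [mul_comm, pow_mul, pow_succ]; norm_num; ring
    have e2 : (-2 : ℚ) ^ b = (-1) ^ b * 2 ^ b := by rw [← mul_pow]; norm_num
    have e3 : (-1 : ℚ) ^ (b * 2) = 1 := by rw [mul_comm, pow_mul]; norm_num
    rw [e1, hzz]
    push_cast
    rw [e2]
    simp [Finset.sum_range_succ, e3, pow_succ]
    ring
  rw [hE, Rat.cast_div, Rat.cast_intCast, Rat.cast_natCast, norm_div, hu, div_one]
  exact_mod_cast hn

theorem pan_main_ge_five (p : ℕ) [hp : Fact p.Prime] (hodd : Odd p) (hp5 : 5 ≤ p) (a : ℕ)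
    (ha : 1 ≤ a) :
    ‖(((∑ k ∈ Finset.range p, (-1 : ℚ) ^ ((a - 1) * k) * ((p - 1).choose k : ℚ) ^ a)
        - (2 ^ (a * (p - 1))
          + ((a : ℚ) * (a - 1) * (3 * a - 4) / 48) * (p : ℚ) ^ 3 * bernoulli (p - 3)) : ℚ) : ℚ_[p])‖
      ≤ (p : ℝ) ^ (-(4 : ℤ)) := by
  obtain ⟨m, hpm⟩ := hodd
  have hm : 2 ≤ m := by omega
  obtain ⟨β0, hβ0⟩ : ∃ β0 : ℤ_[p], (β0 : ℚ_[p]) = ((bernoulli (p - 3) : ℚ) : ℚ_[p]) :=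
    ⟨⟨_, pan_bern_integral p (p - 3) (by omega)⟩, rfl⟩
  have hc : ∀ x : ℤ_[p], (x : ℚ_[p]) = PadicInt.Coe.ringHom x := fun _ => rfl
  have hker : ∀ x : ℤ_[p], PadicInt.toZModPow 4 x = 0 ↔ ‖x‖ ≤ (p : ℝ) ^ (-(4 : ℕ) : ℤ) := by
    intro x
    rw [PadicInt.norm_le_pow_iff_mem_span_pow, ← PadicInt.ker_toZModPow, RingHom.mem_ker]
  have hP : (p : ZMod (p ^ 4)) ^ 4 = 0 := by
    rw [← Nat.cast_pow]; exact ZMod.natCast_self _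
  have hβ : (p : ZMod (p ^ 4)) ^ 2 *
      ∑ k ∈ Finset.range (2 * m), ((k + 1 : ℕ) : ZMod (p ^ 4)) ^ (p - 3)
      = (p : ZMod (p ^ 4)) ^ 3 * PadicInt.toZModPow 4 β0 := by
    have h := pan_faulhaber p hp5
    have h0 : ‖((∑ k ∈ Finset.range p, (k : ℤ_[p]) ^ (p - 3)) - p * β0 : ℤ_[p])‖
        ≤ (p : ℝ) ^ (-(2 : ℕ) : ℤ) := by
      rw [PadicInt.norm_def, hc]
      simp only [map_mul, map_sub, map_sum, map_pow, map_natCast]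
      rw [← hc, hβ0]
      push_cast at h ⊢
      exact h
    have h1 : PadicInt.toZModPow 4 ((p : ℤ_[p]) ^ 2 *
        ((∑ k ∈ Finset.range p, (k : ℤ_[p]) ^ (p - 3)) - (p : ℤ_[p]) * β0)) = 0 := by
      rw [hker, norm_mul, PadicInt.norm_p_pow]
      calc _ ≤ (p : ℝ) ^ (-(2 : ℕ) : ℤ) * (p : ℝ) ^ (-(2 : ℕ) : ℤ) := by gcongr
        _ = _ := by rw [← zpow_add₀ (by exact_mod_cast hp.out.ne_zero)]; norm_num
    have h2 : ∑ k ∈ Finset.range p, (k : ZMod (p ^ 4)) ^ (p - 3)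
        = ∑ k ∈ Finset.range (2 * m), ((k + 1 : ℕ) : ZMod (p ^ 4)) ^ (p - 3) := by
      have e : Finset.range p = Finset.range (2 * m + 1) := by rw [hpm]
      rw [e, Finset.sum_range_succ', Nat.cast_zero, zero_pow (by omega), add_zero]
    simp only [map_mul, map_sub, map_sum, map_pow, map_natCast] at h1
    rw [h2] at h1
    linear_combination h1
  obtain ⟨v, hv, hD⟩ := pan_arith p m hpm hm _ hβ
  have hcore := pan_core p m hpm hm hP v hv _ hD a
  have hW : ‖(48 * ((∑ k ∈ Finset.range p, (-1 : ℤ_[p]) ^ ((a - 1) * k) *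
      ((p - 1).choose k : ℤ_[p]) ^ a) - 2 ^ (a * (p - 1)))
      - a * (a - 1) * (3 * a - 4) * ((p : ℤ_[p]) ^ 3 * β0) : ℤ_[p])‖
      ≤ (p : ℝ) ^ (-(4 : ℕ) : ℤ) := by
    rw [← hker]
    have hsum : ∑ k ∈ Finset.range p, (-1 : ZMod (p ^ 4)) ^ ((a - 1) * k) *
        ((p - 1).choose k : ZMod (p ^ 4)) ^ a
        = ∑ k ∈ Finset.range (2 * m + 1), (-1) ^ k * panX (ZMod (p ^ 4)) m k ^ a := by
      have e : Finset.range p = Finset.range (2 * m + 1) := by rw [hpm]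
      rw [e]
      refine Finset.sum_congr rfl fun k _ => ?_
      unfold panX
      rw [mul_pow, ← mul_assoc, ← pow_mul, ← pow_add, show p - 1 = 2 * m by omega]
      congr 1
      obtain ⟨b, rfl⟩ : ∃ b, a = b + 1 := ⟨a - 1, by omega⟩
      rw [Nat.add_sub_cancel, show k + k * (b + 1) = b * k + 2 * k by ring, pow_add, pow_mul _ 2 k]
      simp
    have e2 : (2 : ZMod (p ^ 4)) ^ (a * (p - 1)) = (2 ^ (2 * m)) ^ a := by
      rw [← pow_mul]; congr 1; rw [show p - 1 = 2 * m by omega]; ring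
    simp only [map_mul, map_sub, map_sum, map_pow, map_natCast, map_neg, map_one, map_ofNat]
    rw [hsum, e2, hcore]
    ring
  have hu : ‖((48 : ℕ) : ℚ_[p])‖ = 1 := by
    rw [Padic.norm_natCast_eq_one_iff]
    have h2 : p.Coprime 2 := (Nat.coprime_primes hp.out Nat.prime_two).2 (by omega)
    have h3 : p.Coprime 3 := (Nat.coprime_primes hp.out Nat.prime_three).2 (by omega)
    exact (h2.pow_right 4).mul_right h3
  have hne : ((48 : ℕ) : ℚ_[p]) ≠ 0 := by
    intro h0; rw [h0, norm_zero] at hu; exact zero_ne_one hu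
  rw [PadicInt.norm_def, hc] at hW
  simp only [map_mul, map_sub, map_sum, map_pow, map_natCast, map_neg, map_one, map_ofNat] at hW
  rw [← hc, hβ0] at hW
  push_cast at hW ⊢
  rw [← one_mul ‖_ - _‖, ← hu, ← norm_mul]
  convert hW using 2
  push_cast at hne ⊢
  field_simp
  ring

theorem pan_main_theorem (p : ℕ) [Fact p.Prime] (hodd : Odd p) (a : ℕ) (ha : 1 ≤ a) :
    ‖(((∑ k ∈ Finset.range p, (-1 : ℚ) ^ ((a - 1) * k) * ((p - 1).choose k : ℚ) ^ a)
        - (2 ^ (a * (p - 1))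
          + ((a : ℚ) * (a - 1) * (3 * a - 4) / 48) * (p : ℚ) ^ 3 * bernoulli (p - 3)) : ℚ) : ℚ_[p])‖
      ≤ (p : ℝ) ^ (-(4 : ℤ)) := by
  by_cases h3 : p = 3
  · subst h3
    exact pan_main_three a ha
  · have hpr : p.Prime := Fact.out
    have h2 := hpr.two_le
    have h5 : 5 ≤ p := by
      obtain ⟨m, hm⟩ := hodd
      omega
    exact pan_main_ge_five p hodd h5 a ha
end

section
/- For every odd prime p, Σ_{k=0}^{p-1} C(p-1,k)^3 ≡ 8^{p-1} + (5/8) p^3 B_{p-3} (mod p^4), as a congruence of p-integral rationals. -/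
namespace PanCube

/-- Elements of `ℚ_[p]` divisible by `p ^ n`. -/
def I (p : ℕ) [Fact p.Prime] (n : ℕ) : AddSubgroup ℚ_[p] where
  carrier := {x | ∃ z : ℤ_[p], x = (p : ℚ_[p]) ^ n * z}
  add_mem' := by
    rintro a b ⟨z, rfl⟩ ⟨w, rfl⟩
    exact ⟨z + w, by push_cast; ring⟩
  zero_mem' := ⟨0, by simp⟩
  neg_mem' := by
    rintro a ⟨z, rfl⟩
    exact ⟨-z, by push_cast; ring⟩

section basics
variable {p : ℕ} [Fact p.Prime]

lemma mul_mem {m n : ℕ} {x y : ℚ_[p]} (hx : x ∈ I p m) (hy : y ∈ I p n) :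
    x * y ∈ I p (m + n) := by
  obtain ⟨z, rfl⟩ := hx
  obtain ⟨w, rfl⟩ := hy
  exact ⟨z * w, by push_cast; ring⟩

lemma mono {m n : ℕ} (h : n ≤ m) {x : ℚ_[p]} (hx : x ∈ I p m) : x ∈ I p n := by
  obtain ⟨z, rfl⟩ := hx
  obtain ⟨k, rfl⟩ := Nat.exists_eq_add_of_le h
  exact ⟨(p : ℤ_[p]) ^ k * z, by push_cast; ring⟩

lemma ppow_mem (n : ℕ) : (p : ℚ_[p]) ^ n ∈ I p n := ⟨1, by simp⟩

lemma p_mem : (p : ℚ_[p]) ∈ I p 1 := by simpa using ppow_mem (p := p) 1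

lemma int_mem (a : ℤ) : (a : ℚ_[p]) ∈ I p 0 := ⟨a, by simp⟩

lemma nat_mem (a : ℕ) : (a : ℚ_[p]) ∈ I p 0 := ⟨a, by simp⟩

lemma mul0 {n : ℕ} {x y : ℚ_[p]} (hx : x ∈ I p 0) (hy : y ∈ I p n) : x * y ∈ I p n := by
  simpa using mul_mem hx hy

lemma pow0 {x : ℚ_[p]} (hx : x ∈ I p 0) (k : ℕ) : x ^ k ∈ I p 0 := by
  induction k with
  | zero => simpa using nat_mem (p := p) 1
  | succ k ih => rw [pow_succ]; exact mul0 ih hx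

lemma pow_mem {n : ℕ} {x : ℚ_[p]} (hx : x ∈ I p n) (k : ℕ) : x ^ k ∈ I p (n * k) := by
  induction k with
  | zero => simpa using nat_mem (p := p) 1
  | succ k ih => rw [pow_succ, Nat.mul_succ]; exact mul_mem ih hx

lemma p_ne : (p : ℚ_[p]) ≠ 0 := by
  exact_mod_cast (Fact.out : p.Prime).ne_zero

lemma mem_iff_norm {n : ℕ} {x : ℚ_[p]} : x ∈ I p n ↔ ‖x‖ ≤ (p : ℝ) ^ (-(n : ℤ)) := by
  have hp : (0 : ℝ) < p := by exact_mod_cast (Fact.out : p.Prime).pos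
  constructor
  · rintro ⟨z, rfl⟩
    rw [norm_mul, norm_pow, Padic.norm_p, zpow_neg, zpow_natCast, inv_pow]
    exact mul_le_of_le_one_right (by positivity) z.2
  · intro h
    refine ⟨⟨x / p ^ n, ?_⟩, ?_⟩
    · rw [norm_div, norm_pow, Padic.norm_p, inv_pow]
      rw [zpow_neg, zpow_natCast] at h
      exact div_le_one_of_le₀ h (by positivity)
    · have := p_ne (p := p)
      simp only
      field_simp

lemma inv_mem_int {a : ℤ} (ha : ¬ (p : ℤ) ∣ a) : ((a : ℚ_[p]))⁻¹ ∈ I p 0 := by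
  rw [mem_iff_norm, norm_inv]
  have h1 : ¬ ‖(a : ℚ_[p])‖ < 1 := fun h => ha (Padic.norm_intCast_lt_one_iff.1 h)
  have h2 : ‖(a : ℚ_[p])‖ = 1 := le_antisymm (Padic.norm_int_le_one a) (not_lt.1 h1)
  simp [h2]

lemma inv_mem {a : ℕ} (ha : ¬ p ∣ a) : ((a : ℚ_[p]))⁻¹ ∈ I p 0 := by
  have := inv_mem_int (p := p) (a := (a : ℤ)) (by exact_mod_cast ha)
  simpa using this

lemma inv_mem_lt {a : ℕ} (h0 : 0 < a) (h : a < p) : ((a : ℚ_[p]))⁻¹ ∈ I p 0 :=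
  inv_mem (Nat.not_dvd_of_pos_of_lt h0 h)

lemma div_p {n : ℕ} {x : ℚ_[p]} (h : (p : ℚ_[p]) * x ∈ I p (n + 1)) : x ∈ I p n := by
  obtain ⟨z, hz⟩ := h
  refine ⟨z, ?_⟩
  have := p_ne (p := p)
  apply mul_left_cancel₀ this
  rw [hz]; ring

lemma bern_mem : ∀ n : ℕ, n + 1 < p → ((bernoulli n : ℚ) : ℚ_[p]) ∈ I p 0 := by
  intro n
  induction n using Nat.strong_induction_on with
  | _ n ih =>
    intro hn
    have h := sum_bernoulli (n + 1)
    rw [Finset.sum_range_succ] at h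
    have h2 : (bernoulli n : ℚ) = ((n + 1 : ℕ) : ℚ)⁻¹ * ((if n + 1 = 1 then 1 else 0) -
        ∑ k ∈ Finset.range n, ((n + 1).choose k : ℚ) * bernoulli k) := by
      rw [← h]
      have : ((n + 1 : ℕ) : ℚ) ≠ 0 := by positivity
      field_simp
      simp [Nat.choose_succ_self_right]
    rw [h2]
    push_cast
    have hinv := inv_mem_lt (p := p) (a := n + 1) (by omega) hn
    push_cast at hinv
    refine mul0 hinv (sub_mem ?_ (sum_mem ?_))
    · split_ifs
      · simpa using nat_mem (p := p) 1
      · exact zero_mem _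
    · intro k hk
      have hk := Finset.mem_range.1 hk
      exact mul0 (nat_mem _) (ih k hk (by omega))

end basics

/-- Power sums over `1..p-1`. -/
lemma sum_pow_p {p : ℕ} [Fact p.Prime] (hp5 : 5 ≤ p) :
    (∑ k ∈ Finset.range (p - 1), ((k + 1 : ℕ) : ℚ_[p]) ^ (p - 3)) - p * ((bernoulli (p - 3) : ℚ) : ℚ_[p])
      ∈ I p 2 := by
  obtain ⟨q, rfl⟩ : ∃ q, p = q + 3 := ⟨p - 3, by omega⟩
  have h := sum_range_pow (q + 3) q
  rw [Finset.sum_range_succ', Finset.sum_range_succ _ q] at h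
  have h' := congrArg (fun x : ℚ => (x : ℚ_[q + 3])) h
  simp only [Nat.add_sub_cancel, show q + 3 - 1 = q + 2 by omega]
  have hq0 : q ≠ 0 := by omega
  have hne : ((q : ℚ_[q + 3]) + 1) ≠ 0 := by exact_mod_cast Nat.succ_ne_zero q
  have e : (∑ k ∈ Finset.range (q + 2), ((k + 1 : ℕ) : ℚ_[q + 3]) ^ q) -
      ((q + 3 : ℕ) : ℚ_[q + 3]) * ((bernoulli q : ℚ) : ℚ_[q + 3]) =
      ∑ i ∈ Finset.range q, ((bernoulli i : ℚ) : ℚ_[q + 3]) * ((q + 1).choose i : ℕ) *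
        ((q + 3 : ℕ) : ℚ_[q + 3]) ^ (q + 1 - i) * ((q + 1 : ℕ) : ℚ_[q + 3])⁻¹ := by
    rw [sub_eq_iff_eq_add]
    push_cast at h' ⊢
    simp only [zero_pow hq0, add_zero] at h'
    rw [h']
    congr 1
    simp only [Nat.choose_succ_self_right, Nat.add_sub_cancel_left, pow_one]
    push_cast
    field_simp
  rw [e]
  refine sum_mem fun i hi => ?_
  have hi := Finset.mem_range.1 hi
  have h1 := bern_mem (p := q + 3) i (by omega)
  have h2 := inv_mem_lt (p := q + 3) (a := q + 1) (by omega) (by omega)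
  have h3 := mono (n := 2) (by omega) (ppow_mem (p := q + 3) (q + 1 - i))
  have := mul0 (mul0 h1 (nat_mem ((q + 1).choose i))) (mul0 h2 h3)
  convert this using 1
  ring

section fin
open Finset
variable {M : Type*} [AddCommMonoid M]

lemma split_half (m : ℕ) (f : ℕ → M) :
    ∑ k ∈ range (2 * m), f (k + 1) = ∑ j ∈ range m, (f (j + 1) + f (2 * m + 1 - (j + 1))) := by
  rw [two_mul, sum_range_add, sum_add_distrib]
  congr 1
  rw [← sum_range_reflect]
  refine sum_congr rfl fun j hj => ?_
  have := mem_range.1 hj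
  congr 1
  omega

lemma split_reflect (m : ℕ) (f : ℕ → M) :
    ∑ k ∈ range (2 * m), f (k + 1) = ∑ j ∈ range (2 * m), f (2 * m + 1 - (j + 1)) := by
  rw [← sum_range_reflect]
  refine sum_congr rfl fun j hj => ?_
  have := mem_range.1 hj
  congr 1
  omega

lemma split_parity (m : ℕ) (f : ℕ → M) :
    ∑ k ∈ range (2 * m), f (k + 1) =
      ∑ j ∈ range m, (f (2 * (j + 1)) + f (2 * m + 1 - 2 * (j + 1))) := by
  have h1 : ∀ m : ℕ, ∑ k ∈ range (2 * m), f (k + 1) =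
      ∑ j ∈ range m, f (2 * (j + 1)) + ∑ j ∈ range m, f (2 * j + 1) := by
    intro m
    induction m with
    | zero => simp
    | succ m ih =>
      rw [show 2 * (m + 1) = 2 * m + 1 + 1 by ring, sum_range_succ, sum_range_succ, ih,
        sum_range_succ, sum_range_succ, show 2 * (m + 1) = 2 * m + 1 + 1 by ring]
      abel
  rw [h1, sum_add_distrib]
  congr 1
  rw [← sum_range_reflect]
  refine sum_congr rfl fun j hj => ?_
  have := mem_range.1 hj
  congr 1
  omega

end fin

section harm
open Finset
variable {p : ℕ} [Fact p.Prime]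

lemma inv_facts {y : ℕ} (hy0 : 0 < y) (hyp : y < p) :
    ∃ u w : ℚ_[p], u = (y : ℚ_[p])⁻¹ ∧ w = ((p - y : ℕ) : ℚ_[p])⁻¹ ∧ u ∈ I p 0 ∧ w ∈ I p 0 ∧
      u + w = p * (u * w) ∧ w + u ∈ I p 1 ∧ w + u + p * u ^ 2 ∈ I p 2 ∧
      w ^ 2 - u ^ 2 - 2 * p * u ^ 3 ∈ I p 2 ∧ w ^ 3 + u ^ 3 ∈ I p 1 := by
  refine ⟨_, _, rfl, rfl, ?_⟩
  have hu := inv_mem_lt hy0 hyp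
  have hw := inv_mem_lt (p := p) (a := p - y) (by omega) (by omega)
  have rel : (y : ℚ_[p])⁻¹ + ((p - y : ℕ) : ℚ_[p])⁻¹ =
      p * ((y : ℚ_[p])⁻¹ * ((p - y : ℕ) : ℚ_[p])⁻¹) := by
    have h1 : (y : ℚ_[p]) ≠ 0 := by exact_mod_cast hy0.ne'
    have h2 : ((p - y : ℕ) : ℚ_[p]) ≠ 0 := by
      have : p - y ≠ 0 := by omega
      exact_mod_cast this
    have h3 : (p : ℚ_[p]) = y + (p - y : ℕ) := by
      rw [← Nat.cast_add]; congr 1; omega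
    rw [h3]
    field_simp
    ring
  generalize (y : ℚ_[p])⁻¹ = u at *
  generalize ((p - y : ℕ) : ℚ_[p])⁻¹ = w at *
  have h1 : w + u ∈ I p 1 := by
    rw [add_comm, rel]; exact mul_mem (m := 1) (n := 0) p_mem (mul0 hu hw)
  have h2 : w + u + p * u ^ 2 ∈ I p 2 := by
    have e : w + u + p * u ^ 2 = p * (u * (w + u)) := by linear_combination rel
    rw [e]; exact mul_mem (m := 1) (n := 1) p_mem (mul0 hu h1)
  refine ⟨hu, hw, rel, h1, h2, ?_, ?_⟩
  · have e : w ^ 2 - u ^ 2 - 2 * p * u ^ 3 =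
      (w - u - p * u ^ 2) * (w + u + p * u ^ 2) + p ^ 2 * u ^ 4 := by ring
    rw [e]
    refine add_mem (mul0 (sub_mem (sub_mem hw hu) (mul0 (nat_mem p) (pow0 hu 2))) h2) ?_
    exact mul_mem (n := 0) (ppow_mem 2) (pow0 hu 4)
  · have e : w ^ 3 + u ^ 3 = (w ^ 2 - w * u + u ^ 2) * (w + u) := by ring
    rw [e]
    exact mul0 (add_mem (sub_mem (pow0 hw 2) (mul0 hw hu)) (pow0 hu 2)) h1

/-- harmonic numbers -/
noncomputable def H (p : ℕ) [Fact p.Prime] (s n : ℕ) : ℚ_[p] :=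
  ∑ k ∈ range n, (((k + 1 : ℕ) : ℚ_[p])⁻¹) ^ s

lemma H_mem {s n : ℕ} (h : n < p) : H p s n ∈ I p 0 := by
  refine sum_mem fun k hk => pow0 (inv_mem_lt (by omega) ?_) s
  have := mem_range.1 hk
  omega

lemma half_mem (h5 : 5 ≤ p) : (2 : ℚ_[p])⁻¹ ∈ I p 0 := by
  simpa using inv_mem_lt (p := p) (a := 2) (by omega) (by omega)

lemma third_mem (h5 : 5 ≤ p) : (3 : ℚ_[p])⁻¹ ∈ I p 0 := by
  simpa using inv_mem_lt (p := p) (a := 3) (by omega) (by omega)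

variable {m : ℕ}

lemma A3_mem (hm : p = 2 * m + 1) : H p 3 (2 * m) ∈ I p 1 := by
  have e : H p 3 (2 * m) = ∑ j ∈ range m, ((((p - (j + 1) : ℕ) : ℚ_[p])⁻¹) ^ 3 +
      (((j + 1 : ℕ) : ℚ_[p])⁻¹) ^ 3) := by
    unfold H
    rw [split_half m (fun k => ((k : ℚ_[p])⁻¹) ^ 3), ← hm]
    exact sum_congr rfl fun j hj => add_comm _ _
  rw [e]
  refine sum_mem fun j hj => ?_
  have hj := mem_range.1 hj
  obtain ⟨u, w, rfl, rfl, -, -, -, -, -, -, h⟩ := inv_facts (p := p) (y := j + 1) (by omega) (by omega)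
  exact h

lemma A2_half (hm : p = 2 * m + 1) :
    H p 2 (2 * m) - 2 * H p 2 m - 2 * p * H p 3 m ∈ I p 2 := by
  have e : H p 2 (2 * m) - 2 * H p 2 m - 2 * p * H p 3 m =
      ∑ j ∈ range m, ((((p - (j + 1) : ℕ) : ℚ_[p])⁻¹) ^ 2 -
      (((j + 1 : ℕ) : ℚ_[p])⁻¹) ^ 2 - 2 * p * (((j + 1 : ℕ) : ℚ_[p])⁻¹) ^ 3) := by
    unfold H
    rw [split_half m (fun k => ((k : ℚ_[p])⁻¹) ^ 2), ← hm]
    simp only [mul_sum, ← sum_sub_distrib]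
    refine sum_congr rfl fun j hj => ?_
    ring
  rw [e]
  refine sum_mem fun j hj => ?_
  have hj := mem_range.1 hj
  obtain ⟨u, w, rfl, rfl, -, -, -, -, -, h, -⟩ := inv_facts (p := p) (y := j + 1) (by omega) (by omega)
  exact h

lemma A2_parity (hm : p = 2 * m + 1) :
    H p 2 (2 * m) - 2⁻¹ * H p 2 m - 4⁻¹ * p * H p 3 m ∈ I p 2 := by
  have e : H p 2 (2 * m) - 2⁻¹ * H p 2 m - 4⁻¹ * p * H p 3 m =
      ∑ j ∈ range m, ((((p - 2 * (j + 1) : ℕ) : ℚ_[p])⁻¹) ^ 2 -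
      (((2 * (j + 1) : ℕ) : ℚ_[p])⁻¹) ^ 2 - 2 * p * (((2 * (j + 1) : ℕ) : ℚ_[p])⁻¹) ^ 3) := by
    unfold H
    rw [split_parity m (fun k => ((k : ℚ_[p])⁻¹) ^ 2), ← hm]
    simp only [mul_sum, ← sum_sub_distrib]
    refine sum_congr rfl fun j hj => ?_
    rw [Nat.cast_mul, mul_inv]
    push_cast
    ring
  rw [e]
  refine sum_mem fun j hj => ?_
  have hj := mem_range.1 hj
  obtain ⟨u, w, rfl, rfl, -, -, -, -, -, h, -⟩ :=
    inv_facts (p := p) (y := 2 * (j + 1)) (by omega) (by omega)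
  exact h

lemma A1_A2 (hm : p = 2 * m + 1) :
    2 * H p 1 (2 * m) + p * H p 2 (2 * m) + p ^ 2 * H p 3 (2 * m) ∈ I p 3 := by
  have e : 2 * H p 1 (2 * m) + p * H p 2 (2 * m) + p ^ 2 * H p 3 (2 * m) =
      ∑ j ∈ range (2 * m), ((((p - (j + 1) : ℕ) : ℚ_[p])⁻¹) + (((j + 1 : ℕ) : ℚ_[p])⁻¹) +
       p * (((j + 1 : ℕ) : ℚ_[p])⁻¹) ^ 2 + p ^ 2 * (((j + 1 : ℕ) : ℚ_[p])⁻¹) ^ 3) := by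
    have := split_reflect m (fun k => ((k : ℚ_[p])⁻¹) ^ 1)
    rw [← hm] at this
    rw [two_mul (H p 1 (2 * m))]
    conv_lhs => enter [1, 1, 1]; unfold H; rw [this]
    unfold H
    simp only [mul_sum, ← sum_add_distrib]
    refine sum_congr rfl fun j hj => ?_
    ring
  rw [e]
  refine sum_mem fun j hj => ?_
  have hj := mem_range.1 hj
  obtain ⟨u, w, hu, hw, hu0, hw0, rel, h1, h2, h, -⟩ :=
    inv_facts (p := p) (y := j + 1) (by omega) (by omega)
  rw [← hu, ← hw]
  have e : w + u + p * u ^ 2 + p ^ 2 * u ^ 3 = p * (u * (w + u + p * u ^ 2)) := by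
    linear_combination rel
  rw [e]
  simpa using mul_mem p_mem (mul0 hu0 h2)

/-- the three consequences -/
lemma a2_val (h5 : 5 ≤ p) (hm : p = 2 * m + 1) :
    H p 2 m + 7 * 6⁻¹ * p * H p 3 m ∈ I p 2 := by
  have e : H p 2 m + 7 * 6⁻¹ * p * H p 3 m =
    (2 * 3⁻¹) * ((H p 2 (2 * m) - 2⁻¹ * H p 2 m - 4⁻¹ * p * H p 3 m) -
      (H p 2 (2 * m) - 2 * H p 2 m - 2 * p * H p 3 m)) := by ring
  rw [e]
  exact mul0 (mul0 (by simpa using nat_mem (p := p) 2) (third_mem h5))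
    (sub_mem (A2_parity hm) (A2_half hm))

lemma A2_val (h5 : 5 ≤ p) (hm : p = 2 * m + 1) :
    H p 2 (2 * m) + 3⁻¹ * p * H p 3 m ∈ I p 2 := by
  have e : H p 2 (2 * m) + 3⁻¹ * p * H p 3 m =
    (H p 2 (2 * m) - 2 * H p 2 m - 2 * p * H p 3 m) +
     2 * (H p 2 m + 7 * 6⁻¹ * p * H p 3 m) := by ring
  rw [e]
  exact add_mem (A2_half hm) (mul0 (by simpa using nat_mem (p := p) 2) (a2_val h5 hm))

lemma A1_val (h5 : 5 ≤ p) (hm : p = 2 * m + 1) :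
    H p 1 (2 * m) - 6⁻¹ * p ^ 2 * H p 3 m ∈ I p 3 := by
  have e : H p 1 (2 * m) - 6⁻¹ * p ^ 2 * H p 3 m =
    2⁻¹ * ((2 * H p 1 (2 * m) + p * H p 2 (2 * m) + p ^ 2 * H p 3 (2 * m)) -
     p * (H p 2 (2 * m) + 3⁻¹ * p * H p 3 m) - p ^ 2 * H p 3 (2 * m)) := by ring
  rw [e]
  refine mul0 (half_mem h5) (sub_mem (sub_mem (A1_A2 hm) ?_) ?_)
  · simpa using mul_mem p_mem (A2_val h5 hm)
  · simpa using mul_mem (ppow_mem 2) (A3_mem hm)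

lemma fermat {a : ℕ} (ha : ¬ p ∣ a) : (a : ℚ_[p]) ^ (p - 1) - 1 ∈ I p 1 := by
  have h : (p : ℤ) ∣ (a : ℤ) ^ (p - 1) - 1 := by
    have := Int.ModEq.pow_card_sub_one_eq_one (Fact.out : p.Prime) (n := (a : ℤ)) ?_
    · exact this.symm.dvd
    · exact (Nat.isCoprime_iff_coprime.2
        (((Fact.out : p.Prime).coprime_iff_not_dvd.2 ha).symm))
  obtain ⟨c, hc⟩ := h
  have h2 := congrArg (fun x : ℤ => (x : ℚ_[p])) hc
  push_cast at h2
  rw [h2]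
  exact mul_mem (n := 0) p_mem (int_mem c)

/-- `(p - y)^(n+1)` modulo `p^2`, `n` odd -/
lemma sub_pow_mem {y n : ℕ} (hn : Odd n) (hyp : y ≤ p) :
    ((p - y : ℕ) : ℚ_[p]) ^ (n + 1) - (y : ℚ_[p]) ^ (n + 1) + (n + 1) * p * (y : ℚ_[p]) ^ n ∈ I p 2 := by
  have key : ∀ k : ℕ, ((y : ℚ_[p]) - p) ^ (k + 1) - (y : ℚ_[p]) ^ (k + 1) +
      (k + 1) * p * (y : ℚ_[p]) ^ k ∈ I p 2 := by
    intro k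
    induction k with
    | zero => simp
    | succ k ih =>
      have e : ((y : ℚ_[p]) - p) ^ (k + 1 + 1) - (y : ℚ_[p]) ^ (k + 1 + 1) +
        ((k + 1 : ℕ) + 1) * p * (y : ℚ_[p]) ^ (k + 1) =
        ((y : ℚ_[p]) - p) * (((y : ℚ_[p]) - p) ^ (k + 1) - (y : ℚ_[p]) ^ (k + 1) +
      (k + 1) * p * (y : ℚ_[p]) ^ k) + p ^ 2 * ((k + 1 : ℕ) * (y : ℚ_[p]) ^ k) := by
        push_cast; ring
      rw [e]
      exact add_mem (mul0 (sub_mem (nat_mem y) (nat_mem p)) ih)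
        (mul_mem (n := 0) (ppow_mem 2) (mul0 (nat_mem _) (pow0 (nat_mem y) k)))
  have h := key n
  rw [Nat.cast_sub hyp, ← Even.neg_pow (show Even (n + 1) by exact hn.add_one) ((p : ℚ_[p]) - y), neg_sub]
  exact h

lemma a3_val (h5 : 5 ≤ p) (hm : p = 2 * m + 1) :
    H p 3 m + 2 * ((bernoulli (p - 3) : ℚ) : ℚ_[p]) ∈ I p 1 := by
  obtain ⟨n, hn⟩ : ∃ n, p = n + 4 := ⟨p - 4, by omega⟩
  have hodd : Odd n := ⟨m - 2, by omega⟩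
  have hS := sum_pow_p (p := p) h5
  rw [show p - 3 = n + 1 by omega, show p - 1 = 2 * m by omega] at hS
  rw [show p - 3 = n + 1 by omega]
  set B := ((bernoulli (n + 1) : ℚ) : ℚ_[p]) with hBdef
  have hB : B ∈ I p 0 := bern_mem _ (by omega)
  set S := ∑ k ∈ range (2 * m), ((k + 1 : ℕ) : ℚ_[p]) ^ (n + 1) with hSdef
  set G := ∑ k ∈ range m, ((k + 1 : ℕ) : ℚ_[p]) ^ (n + 1) with hGdef
  set L := ∑ k ∈ range m, ((k + 1 : ℕ) : ℚ_[p]) ^ n with hLdef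
  have hL0 : L ∈ I p 0 := sum_mem fun k _ => pow0 (nat_mem _) _
  have h1 : S - 2 * G + (n + 1) * p * L ∈ I p 2 := by
    have e : S - 2 * G + (n + 1) * p * L = ∑ j ∈ range m, (((p - (j + 1) : ℕ) : ℚ_[p]) ^ (n + 1)
      - ((j + 1 : ℕ) : ℚ_[p]) ^ (n + 1) + (n + 1) * p * ((j + 1 : ℕ) : ℚ_[p]) ^ n) := by
      rw [hSdef, split_half m (fun k => (k : ℚ_[p]) ^ (n + 1)), ← hm, hGdef, hLdef]
      simp only [mul_sum, ← sum_sub_distrib, ← sum_add_distrib]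
      refine sum_congr rfl fun j hj => ?_
      ring
    rw [e]
    refine sum_mem fun j hj => sub_pow_mem hodd ?_
    have := mem_range.1 hj
    omega
  have h2 : S - 2 ^ (n + 2) * G + (n + 1) * p * 2 ^ n * L ∈ I p 2 := by
    have e : S - 2 ^ (n + 2) * G + (n + 1) * p * 2 ^ n * L =
      ∑ j ∈ range m, (((p - 2 * (j + 1) : ℕ) : ℚ_[p]) ^ (n + 1)
      - ((2 * (j + 1) : ℕ) : ℚ_[p]) ^ (n + 1) + (n + 1) * p * ((2 * (j + 1) : ℕ) : ℚ_[p]) ^ n) := by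
      rw [hSdef, split_parity m (fun k => (k : ℚ_[p]) ^ (n + 1)), ← hm, hGdef, hLdef]
      simp only [mul_sum, ← sum_sub_distrib, ← sum_add_distrib]
      refine sum_congr rfl fun j hj => ?_
      rw [Nat.cast_mul, mul_pow, mul_pow]
      push_cast
      ring
    rw [e]
    refine sum_mem fun j hj => sub_pow_mem hodd ?_
    have := mem_range.1 hj
    omega
  have h2m := half_mem (p := p) h5
  have hI2 : (2 : ℚ_[p]) ∈ I p 0 := by simpa using nat_mem (p := p) 2
  have hf : (2 : ℚ_[p]) ^ (n + 3) - 1 ∈ I p 1 := by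
    have := fermat (p := p) (a := 2) (Nat.not_dvd_of_pos_of_lt (by omega) (by omega))
    rw [show p - 1 = n + 3 by omega] at this
    exact_mod_cast this
  have hn1 : (n : ℚ_[p]) + 1 = p - 3 := by
    have := congrArg (fun x : ℕ => (x : ℚ_[p])) hn
    push_cast at this
    linear_combination -this
  have hS1 : S ∈ I p 1 := by
    have := add_mem (mono (n := 1) (by omega) hS) (mul_mem (n := 0) p_mem hB)
    simpa using this
  have hpL : (n + 1) * p * L ∈ I p 1 := by
    have := mul_mem (n := 0) (p_mem (p := p)) (mul0 (nat_mem (n + 1)) hL0)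
    push_cast at this
    convert this using 1
    ring
  have hG : G ∈ I p 1 := by
    have := mul0 h2m (sub_mem (add_mem hS1 hpL) (mono (n := 1) (by omega) h1))
    convert this using 1
    ring
  have hLB : L + 2 * B ∈ I p 1 := by
    apply div_p (n := 1)
    -- 4 * second - first
    have hfG := mul_mem hf hG
    have hfL := mul_mem (n := 0) (mul_mem hf (p_mem (p := p))) hL0
    have hppL := mul_mem (n := 0) (ppow_mem (p := p) 2) hL0
    have hpow : (2 : ℚ_[p]) ^ n ∈ I p 0 := pow0 hI2 n
    have hq : (p : ℚ_[p]) * (L + 2 * B) =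
      (2 * 3⁻¹) * ((4 * (S - 2 ^ (n + 2) * G + (n + 1) * p * 2 ^ n * L) - (S - 2 * G + (n + 1) * p * L))
        + 2 * ((2 ^ (n + 3) - 1) * G) - (-3) * 2⁻¹ * ((2 ^ (n + 3) - 1) * p * L)
        - (4 * 2 ^ n - 1) * (p ^ 2 * L) - 3 * (S - p * B)) := by
      rw [hn1]; ring
    rw [hq]
    have hI3 : (3 : ℚ_[p]) ∈ I p 0 := by simpa using nat_mem (p := p) 3
    have hI4 : (4 : ℚ_[p]) ∈ I p 0 := by simpa using nat_mem (p := p) 4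
    have hI1 : (1 : ℚ_[p]) ∈ I p 0 := by simpa using nat_mem (p := p) 1
    refine mul0 (mul0 hI2 (third_mem h5)) ?_
    refine sub_mem (sub_mem (sub_mem (add_mem (sub_mem (mul0 hI4 h2) h1) (mul0 hI2 hfG)) ?_) ?_) ?_
    · exact mul0 (mul0 (neg_mem hI3) h2m) hfL
    · exact mul0 (sub_mem (mul0 hI4 hpow) hI1) hppL
    · exact mul0 hI3 hS
  have hHL : H p 3 m - L ∈ I p 1 := by
    have e : H p 3 m - L = ∑ j ∈ range m, -((((j + 1 : ℕ) : ℚ_[p])⁻¹) ^ 3 *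
        (((j + 1 : ℕ) : ℚ_[p]) ^ (n + 3) - 1)) := by
      unfold H
      rw [hLdef, ← sum_sub_distrib]
      refine sum_congr rfl fun j hj => ?_
      have : ((j + 1 : ℕ) : ℚ_[p]) ≠ 0 := by exact_mod_cast Nat.succ_ne_zero j
      field_simp
      ring
    rw [e]
    refine sum_mem fun j hj => neg_mem ?_
    have hj := mem_range.1 hj
    have := fermat (p := p) (a := j + 1) (Nat.not_dvd_of_pos_of_lt (by omega) (by omega))
    rw [show p - 1 = n + 3 by omega] at this
    exact mul0 (pow0 (inv_mem_lt (by omega) (by omega)) 3) this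
  have := add_mem hHL hLB
  convert this using 1
  ring

end harm

section comb
open Finset

lemma sum_inv_choose (K : Type*) [Field K] [CharZero K] (n : ℕ) :
    ∑ k ∈ range (n + 1), ((n.choose k : ℕ) : K)⁻¹ =
      (n + 1) / 2 ^ (n + 1) * ∑ j ∈ range (n + 1), 2 ^ (j + 1) / ((j + 1 : ℕ) : K) := by
  induction n with
  | zero => simp
  | succ n ih =>
    have hpair : ∀ k ∈ range (n + 1), (((n + 1).choose k : ℕ) : K)⁻¹ + (((n + 1).choose (k + 1) : ℕ) : K)⁻¹
        = ((n : K) + 2) / (n + 1) * ((n.choose k : ℕ) : K)⁻¹ := by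
      intro k hk
      have hk := mem_range.1 hk
      have a1 : ((n.choose k : ℕ) : K) ≠ 0 := by
        exact_mod_cast (Nat.choose_pos (by omega)).ne'
      have a2 : (((n + 1).choose k : ℕ) : K) ≠ 0 := by
        exact_mod_cast (Nat.choose_pos (by omega)).ne'
      have a3 : (((n + 1).choose (k + 1) : ℕ) : K) ≠ 0 := by
        exact_mod_cast (Nat.choose_pos (by omega)).ne'
      have e1 : ((n + 1).choose (k + 1) : K) * (k + 1) = (n + 1) * (n.choose k) := by
        exact_mod_cast (Nat.add_one_mul_choose_eq n k).symm
      have e2 : ((n + 1).choose k : K) * (n + 1 - k) = (n + 1) * (n.choose k) := by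
        have := Nat.choose_mul_succ_eq n k
        have h3 : ((n.choose k * (n + 1) : ℕ) : K) = (((n + 1).choose k * (n + 1 - k) : ℕ) : K) := by
          rw [this]
        push_cast [Nat.cast_sub (show k ≤ n + 1 by omega)] at h3
        linear_combination -h3
      have n1 : ((n : K) + 1) ≠ 0 := by exact_mod_cast Nat.succ_ne_zero n
      have i1 : (((n + 1).choose (k + 1) : ℕ) : K)⁻¹ = (k + 1) * (((n : K) + 1) * (n.choose k))⁻¹ := by
        rw [← e1]
        have : ((k : K) + 1) ≠ 0 := by exact_mod_cast Nat.succ_ne_zero k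
        field_simp
      have i2 : (((n + 1).choose k : ℕ) : K)⁻¹ = (n + 1 - k) * (((n : K) + 1) * (n.choose k))⁻¹ := by
        rw [← e2]
        have : ((n : K) + 1 - k) ≠ 0 := by
          have : n + 1 - k ≠ 0 := by omega
          have h4 : ((n + 1 - k : ℕ) : K) ≠ 0 := by exact_mod_cast this
          push_cast [Nat.cast_sub (show k ≤ n + 1 by omega)] at h4
          exact h4
        field_simp
      rw [i1, i2]
      field_simp
      ring
    have h1 := sum_congr rfl hpair
    rw [sum_add_distrib, ← mul_sum, ih] at h1
    have h2 := sum_range_succ (fun k => (((n + 1).choose k : ℕ) : K)⁻¹) (n + 1)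
    have h3 := sum_range_succ' (fun k => (((n + 1).choose k : ℕ) : K)⁻¹) (n + 1)
    simp only [Nat.choose_self, Nat.cast_one, inv_one, Nat.choose_zero_right] at h2 h3
    rw [sum_range_succ (fun j => 2 ^ (j + 1) / ((j + 1 : ℕ) : K))]
    have n1 : ((n : K) + 1) ≠ 0 := by exact_mod_cast Nat.succ_ne_zero n
    have n2 : ((n : K) + 1 + 1) ≠ 0 := by exact_mod_cast Nat.succ_ne_zero (n + 1)
    have h4 : 2 * ∑ k ∈ range (n + 1 + 1), (((n + 1).choose k : ℕ) : K)⁻¹ = 2 +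
      (n + 2) / (n + 1) * ((n + 1) / 2 ^ (n + 1) *
        ∑ j ∈ range (n + 1), 2 ^ (j + 1) / ((j + 1 : ℕ) : K)) := by
      linear_combination h1 + h2 + h3
    generalize (∑ j ∈ range (n + 1), 2 ^ (j + 1) / ((j + 1 : ℕ) : K)) = S at *
    generalize (∑ k ∈ range (n + 1 + 1), (((n + 1).choose k : ℕ) : K)⁻¹) = R at *
    have h5 : R = 2⁻¹ * (2 * R) := by simp
    rw [h5, h4]
    push_cast
    field_simp
    ring

lemma sum_choose_div (K : Type*) [Field K] [CharZero K] (n : ℕ) :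
    ∑ k ∈ range n, (2 ^ (k + 1) - 1) / ((k + 1 : ℕ) : K) =
      ∑ k ∈ range n, ((n.choose (k + 1) : ℕ) : K) / ((k + 1 : ℕ) : K) := by
  induction n with
  | zero => simp
  | succ n ih =>
    rw [sum_range_succ, ih]
    have h1 : ∀ k ∈ range (n + 1), (((n + 1).choose (k + 1) : ℕ) : K) / ((k + 1 : ℕ) : K) =
        ((n.choose (k + 1) : ℕ) : K) / ((k + 1 : ℕ) : K) +
          (((n + 1).choose (k + 1) : ℕ) : K) / ((n + 1 : ℕ) : K) := by
      intro k _
      have e1 : ((n + 1).choose (k + 1) : K) * (k + 1) = (n + 1) * (n.choose k) := by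
        exact_mod_cast (Nat.add_one_mul_choose_eq n k).symm
      have e2 : ((n + 1).choose (k + 1) : K) = n.choose k + n.choose (k + 1) := by
        exact_mod_cast Nat.choose_succ_succ n k
      have n1 : ((n : K) + 1) ≠ 0 := by exact_mod_cast Nat.succ_ne_zero n
      have n2 : ((k : K) + 1) ≠ 0 := by exact_mod_cast Nat.succ_ne_zero k
      push_cast
      field_simp
      linear_combination (n + 1 : K) * e2 - e1
    rw [sum_congr rfl h1, sum_add_distrib, sum_range_succ (fun k => ((n.choose (k + 1) : ℕ) : K) / ((k + 1 : ℕ) : K))]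
    simp only [Nat.choose_succ_self, Nat.cast_zero, zero_div, add_zero]
    congr 1
    rw [← sum_div]
    congr 1
    have h2 := Nat.sum_range_choose (n + 1)
    rw [sum_range_succ'] at h2
    have h3 := congrArg (fun x : ℕ => (x : K)) h2
    push_cast [Nat.choose_zero_right] at h3
    linear_combination -h3

lemma alt_choose_sq (m : ℕ) :
    ∑ k ∈ range (2 * m + 1), (-1 : ℤ) ^ k * ((2 * m).choose k : ℤ) ^ 2 = (-1) ^ m * ((2 * m).choose m : ℤ) := by
  have h : ((1 - Polynomial.X : Polynomial ℤ) ^ (2 * m) * (1 + Polynomial.X) ^ (2 * m)) =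
      Polynomial.expand ℤ 2 ((1 - Polynomial.X) ^ (2 * m)) := by
    rw [← mul_pow]
    simp only [map_pow, map_sub, map_one, Polynomial.expand_X]
    congr 1
    ring
  have hc : ∀ n k : ℕ, ((1 - Polynomial.X : Polynomial ℤ) ^ n).coeff k = (-1) ^ k * (n.choose k : ℤ) := by
    intro n k
    have e : (1 - Polynomial.X : Polynomial ℤ) ^ n = ((1 + Polynomial.X) ^ n).comp (Polynomial.C (-1) * Polynomial.X) := by
      simp [sub_eq_add_neg]
    rw [e, Polynomial.comp_C_mul_X_coeff, Polynomial.coeff_one_add_X_pow, mul_comm]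
  have h2 := congrArg (fun f => Polynomial.coeff f (2 * m)) h
  simp only [Polynomial.coeff_mul] at h2
  rw [Finset.Nat.sum_antidiagonal_eq_sum_range_succ_mk, mul_comm 2 m,
    Polynomial.coeff_expand_mul (by norm_num), hc, mul_comm m 2] at h2
  rw [← h2]
  refine sum_congr rfl fun k hk => ?_
  have hk := mem_range.1 hk
  simp only [hc, Polynomial.coeff_one_add_X_pow]
  rw [Nat.choose_symm (by omega)]
  ring

lemma alt_sum {K : Type*} [Field K] (m : ℕ) (g : ℕ → K) :
    ∑ k ∈ range (2 * m), (-1) ^ k * g (k + 1) =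
      ∑ k ∈ range (2 * m), g (k + 1) - 2 * ∑ j ∈ range m, g (2 * (j + 1)) := by
  have h1 := split_parity m (fun t => (-1) ^ (t + 1) * g t)
  rw [split_parity m g]
  have h2 : ∑ k ∈ range (2 * m), (-1 : K) ^ k * g (k + 1) =
      ∑ k ∈ range (2 * m), (-1 : K) ^ (k + 1 + 1) * g (k + 1) := by
    refine sum_congr rfl fun k _ => ?_
    ring
  rw [h2, h1, mul_sum, ← sum_sub_distrib]
  refine sum_congr rfl fun j hj => ?_
  have hj := mem_range.1 hj
  rw [Odd.neg_one_pow (show Odd (2 * (j + 1) + 1) from ⟨_, rfl⟩),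
    Even.neg_one_pow (show Even (2 * m + 1 - 2 * (j + 1) + 1) from ⟨m - j, by omega⟩)]
  ring

end comb

section main
open Finset
variable {p : ℕ} [Fact p.Prime] {m : ℕ}

/-- signed binomials -/
noncomputable def P (p : ℕ) [Fact p.Prime] (m k : ℕ) : ℚ_[p] := (-1) ^ k * (((2 * m).choose k : ℕ) : ℚ_[p])

lemma P_zero : P p m 0 = 1 := by simp [P]

lemma cast_p (hm : p = 2 * m + 1) : (p : ℚ_[p]) = 2 * m + 1 := by
  have := congrArg (fun x : ℕ => (x : ℚ_[p])) hm
  push_cast at this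
  exact this

lemma P_succ (hm : p = 2 * m + 1) (k : ℕ) (hk : k < 2 * m) :
    P p m (k + 1) = P p m k * (1 - p * ((k + 1 : ℕ) : ℚ_[p])⁻¹) := by
  have h := Nat.choose_succ_right_eq (2 * m) k
  have h1 := congrArg (fun x : ℕ => (x : ℚ_[p])) h
  push_cast [Nat.cast_sub hk.le] at h1
  have n1 : ((k : ℚ_[p]) + 1) ≠ 0 := by exact_mod_cast Nat.succ_ne_zero k
  unfold P
  rw [cast_p hm]
  push_cast
  field_simp
  rw [pow_succ]
  linear_combination (-(-1) ^ k) * h1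

lemma one_mem' : (1 : ℚ_[p]) ∈ I p 0 := by simpa using nat_mem (p := p) 1

lemma neg_one_mem (k : ℕ) : ((-1) ^ k : ℚ_[p]) ∈ I p 0 := pow0 (neg_mem one_mem') k

lemma P_mem (k : ℕ) : P p m k ∈ I p 0 := mul0 (neg_one_mem k) (nat_mem _)

lemma P_expand (hm : p = 2 * m + 1) (k : ℕ) (hk : k ≤ 2 * m) :
    P p m k - 1 + p * H p 1 k ∈ I p 2 := by
  induction k with
  | zero => simp [P_zero, H]
  | succ k ih =>
    have ih := ih (by omega)
    have hH : H p 1 (k + 1) = H p 1 k + ((k + 1 : ℕ) : ℚ_[p])⁻¹ := by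
      unfold H; rw [sum_range_succ]; simp
    have hu := inv_mem_lt (p := p) (a := k + 1) (by omega) (by omega)
    rw [P_succ hm k (by omega), hH]
    generalize ((k + 1 : ℕ) : ℚ_[p])⁻¹ = u at *
    have hHk : H p 1 k ∈ I p 0 := H_mem (by omega)
    have e : P p m k * (1 - p * u) - 1 + p * (H p 1 k + u) =
      (1 - p * u) * (P p m k - 1 + p * H p 1 k) + p ^ 2 * (u * H p 1 k) := by ring
    rw [e]
    exact add_mem (mul0 (sub_mem one_mem' (mul0 (nat_mem p) hu)) ih)
      (mul_mem (m := 2) (n := 0) (ppow_mem 2) (mul0 hu hHk))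

lemma P_sub_one (hm : p = 2 * m + 1) (k : ℕ) (hk : k ≤ 2 * m) : P p m k - 1 ∈ I p 1 := by
  have h := sub_mem (mono (n := 1) (by omega) (P_expand hm k hk))
    (mul_mem (m := 1) (n := 0) p_mem (H_mem (p := p) (s := 1) (n := k) (by omega)))
  simpa using h

lemma P_prod (hm : p = 2 * m + 1) (k : ℕ) (hk : k ≤ 2 * m) :
    P p m k = ∏ j ∈ range k, (1 - p * ((j + 1 : ℕ) : ℚ_[p])⁻¹) := by
  induction k with
  | zero => simp [P_zero]
  | succ k ih => rw [P_succ hm k (by omega), prod_range_succ, ih (by omega)]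

lemma P_ne (k : ℕ) (hk : k ≤ 2 * m) : P p m k ≠ 0 := by
  unfold P
  have : (((2 * m).choose k : ℕ) : ℚ_[p]) ≠ 0 := by exact_mod_cast (Nat.choose_pos hk).ne'
  simpa using this

/-- product expansion -/
lemma prod_expand (v : ℕ → ℚ_[p]) (n : ℕ) (hv : ∀ j < n, v j ∈ I p 0) :
    ∏ j ∈ range n, (1 + p ^ 2 * v j) - 1 - p ^ 2 * ∑ j ∈ range n, v j ∈ I p 4 := by
  induction n with
  | zero => simp
  | succ n ih =>
    have ih := ih fun j hj => hv j (by omega)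
    rw [prod_range_succ, sum_range_succ]
    have hs : ∑ j ∈ range n, v j ∈ I p 0 := sum_mem fun j hj => hv j (by
      have := mem_range.1 hj; omega)
    have hvn := hv n (by omega)
    generalize ∏ j ∈ range n, (1 + p ^ 2 * v j) = Q at *
    generalize ∑ j ∈ range n, v j = S at *
    have e : Q * (1 + p ^ 2 * v n) - 1 - p ^ 2 * (S + v n) =
      (1 + p ^ 2 * v n) * (Q - 1 - p ^ 2 * S) + p ^ 4 * (S * v n) := by ring
    rw [e]
    exact add_mem (mul0 (add_mem one_mem' (mul0 (pow0 (nat_mem p) 2) hvn)) ih)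
      (mul_mem (m := 4) (n := 0) (ppow_mem 4) (mul0 hs hvn))

lemma centralBinom_prod (K : Type*) [Field K] [CharZero K] (m : ℕ) :
    ((Nat.centralBinom m : ℕ) : K) = 4 ^ m * ∏ j ∈ range m, ((2 * j + 1) / (2 * (j + 1)) : K) := by
  induction m with
  | zero => simp
  | succ m ih =>
    have h := congrArg (fun x : ℕ => (x : K)) (Nat.succ_mul_centralBinom_succ m)
    push_cast at h
    rw [ih] at h
    rw [prod_range_succ]
    have n1 : ((m : K) + 1) ≠ 0 := by exact_mod_cast Nat.succ_ne_zero m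
    apply mul_left_cancel₀ n1
    rw [h]
    field_simp
    ring

lemma P_half (hm : p = 2 * m + 1) :
    P p m m = 4 ^ m * ∏ j ∈ range m, (1 - p * (2 * ((j + 1 : ℕ) : ℚ_[p]))⁻¹) := by
  have h1 : P p m m = (-1) ^ m * ((Nat.centralBinom m : ℕ) : ℚ_[p]) := rfl
  rw [h1, centralBinom_prod, prod_div_distrib, ← prod_range_reflect (fun j : ℕ => (2 * (j : ℚ_[p]) + 1))]
  rw [← prod_div_distrib]
  have h2 : ((-1 : ℚ_[p])) ^ m = ∏ j ∈ range m, (-1 : ℚ_[p]) := by simp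
  rw [mul_left_comm, h2, ← prod_mul_distrib]
  congr 1
  refine prod_congr rfl fun j hj => ?_
  have hj := mem_range.1 hj
  have n1 : ((j : ℚ_[p]) + 1) ≠ 0 := by exact_mod_cast Nat.succ_ne_zero j
  have h3 : ((m - 1 - j : ℕ) : ℚ_[p]) = m - 1 - j := by
    rw [Nat.sub_sub, Nat.cast_sub (by omega)]; push_cast; ring
  rw [h3, cast_p hm]
  push_cast
  field_simp
  ring

lemma pow16 (h5 : 5 ≤ p) (hm : p = 2 * m + 1) : (2 : ℚ_[p]) ^ (2 * m) - 1 ∈ I p 1 := by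
  have := fermat (p := p) (a := 2) (Nat.not_dvd_of_pos_of_lt (by omega) (by omega))
  rw [show p - 1 = 2 * m by omega] at this
  exact_mod_cast this

/-- Carlitz' congruence -/
lemma carlitz (h5 : 5 ≤ p) (hm : p = 2 * m + 1) :
    P p m m - (2 ^ (2 * m)) ^ 2 + 24⁻¹ * p ^ 3 * H p 3 m ∈ I p 4 := by
  set v : ℕ → ℚ_[p] := fun j => -(4⁻¹) * (((j + 1 : ℕ) : ℚ_[p])⁻¹ * ((p - (j + 1) : ℕ) : ℚ_[p])⁻¹) with hv
  have h2 := half_mem (p := p) h5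
  have h3 := third_mem (p := p) h5
  have h4 : (4 : ℚ_[p])⁻¹ ∈ I p 0 := by
    have := mul0 h2 h2
    convert this using 1
    norm_num
  have h24 : (24 : ℚ_[p])⁻¹ ∈ I p 0 := by
    have := mul0 (mul0 h2 h4) h3
    convert this using 1
    norm_num
  have hv0 : ∀ j < m, v j ∈ I p 0 := by
    intro j hj
    exact mul0 (neg_mem h4) (mul0 (inv_mem_lt (by omega) (by omega)) (inv_mem_lt (by omega) (by omega)))
  have hprod := prod_expand v m hv0
  set Y := ∏ j ∈ range m, (1 - p * (2 * ((j + 1 : ℕ) : ℚ_[p]))⁻¹) with hY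
  have hX1 := P_half (p := p) hm
  rw [← hY] at hX1
  have hX2 : Y ^ 2 = P p m m * ∏ j ∈ range m, (1 + p ^ 2 * v j) := by
    rw [P_prod hm m (by omega), ← prod_mul_distrib, hY, ← prod_pow]
    refine prod_congr rfl fun j hj => ?_
    have hj := mem_range.1 hj
    obtain ⟨u, w, hu, hw, hu0, hw0, rel, -, -, -, -⟩ :=
      inv_facts (p := p) (y := j + 1) (by omega) (by omega)
    rw [hv]
    simp only [mul_inv]
    rw [← hu, ← hw]
    linear_combination ((4⁻¹) * p ^ 2 * u) * rel
  have hXne := P_ne (p := p) (m := m) m (by omega)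
  set Q := ∏ j ∈ range m, (1 + p ^ 2 * v j) with hQ
  have hX3 : P p m m = (2 ^ (2 * m)) ^ 2 * Q := by
    apply mul_left_cancel₀ hXne
    have : (2 : ℚ_[p]) ^ (2 * m) = 4 ^ m := by rw [pow_mul]; norm_num
    rw [this]
    calc P p m m * P p m m = (4 ^ m * Y) * (4 ^ m * Y) := by rw [hX1]
      _ = (4 ^ m) ^ 2 * Y ^ 2 := by ring
      _ = _ := by rw [hX2]; ring
  have hvs : ∑ j ∈ range m, v j - 4⁻¹ * H p 2 m - 4⁻¹ * p * H p 3 m ∈ I p 2 := by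
    have e : ∑ j ∈ range m, v j - 4⁻¹ * H p 2 m - 4⁻¹ * p * H p 3 m = ∑ j ∈ range m, (v j
      - 4⁻¹ * (((j + 1 : ℕ) : ℚ_[p])⁻¹) ^ 2 - 4⁻¹ * p * (((j + 1 : ℕ) : ℚ_[p])⁻¹) ^ 3) := by
      unfold H
      simp only [mul_sum, ← sum_sub_distrib]
    rw [e]
    refine sum_mem fun j hj => ?_
    have hj := mem_range.1 hj
    obtain ⟨u, w, hu, hw, hu0, hw0, rel, -, hh, -, -⟩ :=
      inv_facts (p := p) (y := j + 1) (by omega) (by omega)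
    rw [hv]
    simp only
    rw [← hu, ← hw]
    have := mul0 (mul0 (neg_mem h4) hu0) hh
    convert this using 1
    ring
  have ha2 := a2_val h5 hm
  have hQ2 : Q - 1 + 24⁻¹ * p ^ 3 * H p 3 m ∈ I p 4 := by
    have e : Q - 1 + 24⁻¹ * p ^ 3 * H p 3 m = (Q - 1 - p ^ 2 * ∑ j ∈ range m, v j) +
      p ^ 2 * (∑ j ∈ range m, v j - 4⁻¹ * H p 2 m - 4⁻¹ * p * H p 3 m) +
      p ^ 2 * (4⁻¹ * (H p 2 m + 7 * 6⁻¹ * p * H p 3 m)) := by ring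
    rw [e]
    exact add_mem (add_mem hprod (mul_mem (m := 2) (n := 2) (ppow_mem 2) hvs))
      (mul_mem (m := 2) (n := 2) (ppow_mem 2) (mul0 h4 ha2))
  have hx := pow16 h5 hm
  rw [hX3]
  have hx0 : (2 : ℚ_[p]) ^ (2 * m) ∈ I p 0 := pow0 (by simpa using nat_mem (p := p) 2) _
  generalize (2 : ℚ_[p]) ^ (2 * m) = x at *
  have e : x ^ 2 * Q - x ^ 2 + 24⁻¹ * p ^ 3 * H p 3 m =
     x ^ 2 * (Q - 1 + 24⁻¹ * p ^ 3 * H p 3 m) - (p ^ 3 * (x - 1)) * ((x + 1) * (24⁻¹ * H p 3 m)) := by ring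
  rw [e]
  refine sub_mem (mul0 (pow0 hx0 2) hQ2) (mul_mem (m := 4) (n := 0)
    (mul_mem (m := 3) (n := 1) (ppow_mem 3) hx) ?_)
  exact mul0 (add_mem hx0 one_mem') (mul0 h24 (H_mem (by omega)))

lemma H_succ (s k : ℕ) : H p s (k + 1) = H p s k + (((k + 1 : ℕ) : ℚ_[p])⁻¹) ^ s := by
  unfold H; rw [sum_range_succ]

lemma H_reflect (h5 : 5 ≤ p) (hm : p = 2 * m + 1) (k : ℕ) (hk : k ≤ 2 * m) :
    H p 1 (2 * m - k) - H p 1 k ∈ I p 1 := by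
  induction k with
  | zero =>
    have h := A1_val h5 hm
    have h2 := mul_mem (m := 2) (n := 0) (ppow_mem (p := p) 2)
      (mul0 (mul0 (half_mem h5) (third_mem h5)) (H_mem (p := p) (s := 3) (n := m) (by omega)))
    have := add_mem (mono (n := 1) (by omega) h) (mono (n := 1) (by omega) h2)
    have e0 : H p 1 0 = 0 := by simp [H]
    rw [e0]
    convert this using 1
    simp only [Nat.sub_zero]
    ring
  | succ k ih =>
    have ih := ih (by omega)
    obtain ⟨u, w, hu, hw, hu0, hw0, rel, h1, -, -, -⟩ :=
      inv_facts (p := p) (y := k + 1) (by omega) (by omega)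
    have e1 := H_succ (p := p) 1 k
    have e2 := H_succ (p := p) 1 (2 * m - (k + 1))
    rw [show 2 * m - (k + 1) + 1 = 2 * m - k by omega] at e2
    rw [show p - (k + 1) = 2 * m - k by omega] at hw
    rw [← hu] at e1
    rw [← hw] at e2
    have := sub_mem ih h1
    convert this using 1
    linear_combination -e1 - e2

lemma Xs_val (h5 : 5 ≤ p) (hm : p = 2 * m + 1) :
    ∑ k ∈ range (2 * m), (-1) ^ k * ((((k + 1 : ℕ) : ℚ_[p])⁻¹) ^ 2 * H p 1 k) - 8⁻¹ * H p 3 m ∈ I p 1 := by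
  set f : ℕ → ℚ_[p] := fun t => (-1) ^ (t + 1) * (((t : ℚ_[p])⁻¹) ^ 2 * H p 1 (t - 1)) with hf
  set X := ∑ k ∈ range (2 * m), (-1) ^ k * ((((k + 1 : ℕ) : ℚ_[p])⁻¹) ^ 2 * H p 1 k) with hX
  have hX1 : X = ∑ k ∈ range (2 * m), f (k + 1) := by
    rw [hX]
    refine sum_congr rfl fun k _ => ?_
    simp only [hf, Nat.add_sub_cancel]
    ring
  have hX2 := hX1
  rw [split_reflect] at hX2
  have halt := alt_sum m (fun t => ((t : ℚ_[p])⁻¹) ^ 3)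
  have h8 : ∑ j ∈ range m, (((2 * (j + 1) : ℕ) : ℚ_[p])⁻¹) ^ 3 = 8⁻¹ * H p 3 m := by
    unfold H
    rw [mul_sum]
    refine sum_congr rfl fun j _ => ?_
    rw [Nat.cast_mul, mul_inv, mul_pow]
    norm_num
  simp only [h8] at halt
  change _ = H p 3 (2 * m) - _ at halt
  have hsum : 2 * X + ∑ k ∈ range (2 * m), (-1) ^ k * (((k + 1 : ℕ) : ℚ_[p])⁻¹) ^ 3 ∈ I p 1 := by
    have e : 2 * X + ∑ k ∈ range (2 * m), (-1) ^ k * (((k + 1 : ℕ) : ℚ_[p])⁻¹) ^ 3 =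
      ∑ k ∈ range (2 * m), (f (k + 1) + f (2 * m + 1 - (k + 1)) + (-1) ^ k * (((k + 1 : ℕ) : ℚ_[p])⁻¹) ^ 3) := by
      rw [sum_add_distrib, sum_add_distrib, ← hX1, ← hX2]
      ring
    rw [e]
    refine sum_mem fun k hk => ?_
    have hk := mem_range.1 hk
    obtain ⟨u, w, hu, hw, hu0, hw0, rel, h1, -, -, -⟩ :=
      inv_facts (p := p) (y := k + 1) (by omega) (by omega)
    have hr := H_reflect h5 hm (k + 1) (by omega)
    have hHk : H p 1 (k + 1) ∈ I p 0 := H_mem (by omega)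
    have hHk2 : H p 1 (2 * m - (k + 1)) ∈ I p 0 := H_mem (by omega)
    have e1 := H_succ (p := p) 1 k
    rw [← hu] at e1
    have hsgn : (-1 : ℚ_[p]) ^ (2 * m + 1 - (k + 1) + 1) = -(-1) ^ k := by
      have : (-1 : ℚ_[p]) ^ (2 * m + 1 - (k + 1) + 1) * (-1) ^ k = -1 := by
        rw [← pow_add]
        exact Odd.neg_one_pow ⟨m, by omega⟩
      have h2 : ((-1 : ℚ_[p]) ^ k) * (-1) ^ k = 1 := by
        rw [← mul_pow]; simp
      calc (-1 : ℚ_[p]) ^ (2 * m + 1 - (k + 1) + 1)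
          = ((-1 : ℚ_[p]) ^ (2 * m + 1 - (k + 1) + 1) * (-1) ^ k) * (-1) ^ k := by
            rw [mul_assoc, h2, mul_one]
        _ = _ := by rw [this]; ring
    simp only [hf, Nat.add_sub_cancel]
    rw [hsgn, show 2 * m + 1 - (k + 1) - 1 = 2 * m - (k + 1) by omega, ← hm, ← hu, ← hw]
    have hs := neg_one_mem (p := p) k
    rw [pow_add, pow_add]
    generalize (-1 : ℚ_[p]) ^ k = s at *
    generalize H p 1 (2 * m - (k + 1)) = b at *
    have e2 : s * (-1) ^ 1 * (-1) ^ 1 * (u ^ 2 * H p 1 k) + -s * (w ^ 2 * b) + s * u ^ 3 =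
      -(s * w ^ 2) * (b - H p 1 (k + 1)) - s * H p 1 (k + 1) * (w - u) * (w + u) := by
      rw [e1]; ring
    rw [e2]
    exact sub_mem (mul0 (neg_mem (mul0 hs (pow0 hw0 2))) hr)
      (mul0 (mul0 (mul0 hs hHk) (sub_mem hw0 hu0)) h1)
  have hA3 := A3_mem (p := p) hm
  rw [halt] at hsum
  have := mul0 (half_mem h5) (sub_mem hsum hA3)
  convert this using 1
  ring

lemma T_val (h5 : 5 ≤ p) (hm : p = 2 * m + 1) :
    p * ∑ k ∈ range (2 * m), 2 ^ (k + 1) / ((k + 1 : ℕ) : ℚ_[p]) + 2 * (2 ^ (2 * m) - 1)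
      - 7 * 24⁻¹ * p ^ 3 * H p 3 m ∈ I p 4 := by
  set T := ∑ k ∈ range (2 * m), 2 ^ (k + 1) / ((k + 1 : ℕ) : ℚ_[p]) with hT
  have hp0 := p_ne (p := p)
  have h := sum_choose_div ℚ_[p] (2 * m + 1)
  rw [sum_range_succ, sum_range_succ _ (2 * m), Nat.choose_self, ← hm] at h
  have e1 : ∑ k ∈ range (2 * m), (2 ^ (k + 1) - 1) / ((k + 1 : ℕ) : ℚ_[p]) = T - H p 1 (2 * m) := by
    unfold H
    rw [hT, ← sum_sub_distrib]
    refine sum_congr rfl fun k _ => ?_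
    ring
  have e2 : ∑ k ∈ range (2 * m), ((p.choose (k + 1) : ℕ) : ℚ_[p]) / ((k + 1 : ℕ) : ℚ_[p]) =
      p * ∑ k ∈ range (2 * m), (-1) ^ k * ((((k + 1 : ℕ) : ℚ_[p])⁻¹) ^ 2 * P p m k) := by
    rw [mul_sum]
    refine sum_congr rfl fun k _ => ?_
    have h1 := congrArg (fun x : ℕ => (x : ℚ_[p])) (Nat.add_one_mul_choose_eq (2 * m) k)
    simp only [← hm, Nat.cast_mul] at h1
    have n1 : ((k + 1 : ℕ) : ℚ_[p]) ≠ 0 := by exact_mod_cast Nat.succ_ne_zero k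
    have h2 : ((-1 : ℚ_[p]) ^ k) * (-1) ^ k = 1 := by
      rw [← mul_pow]; simp
    unfold P
    generalize ((k + 1 : ℕ) : ℚ_[p]) = y at *
    field_simp
    linear_combination -h1 - p * ((2 * m).choose k : ℚ_[p]) * h2
  rw [e1, e2] at h
  set W := ∑ k ∈ range (2 * m), (-1) ^ k * ((((k + 1 : ℕ) : ℚ_[p])⁻¹) ^ 2 * P p m k) with hW
  have halt := alt_sum m (fun t => ((t : ℚ_[p])⁻¹) ^ 2)
  have h4 : ∑ j ∈ range m, (((2 * (j + 1) : ℕ) : ℚ_[p])⁻¹) ^ 2 = 4⁻¹ * H p 2 m := by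
    unfold H
    rw [mul_sum]
    refine sum_congr rfl fun j _ => ?_
    rw [Nat.cast_mul, mul_inv, mul_pow]
    norm_num
  simp only [h4] at halt
  change _ = H p 2 (2 * m) - _ at halt
  have hXs := Xs_val h5 hm
  set X := ∑ k ∈ range (2 * m), (-1) ^ k * ((((k + 1 : ℕ) : ℚ_[p])⁻¹) ^ 2 * H p 1 k) with hX
  set A := ∑ k ∈ range (2 * m), (-1) ^ k * (((k + 1 : ℕ) : ℚ_[p])⁻¹) ^ 2 with hA
  have hWX : W - A + p * X ∈ I p 2 := by
    have e : W - A + p * X = ∑ k ∈ range (2 * m), (-1) ^ k * ((((k + 1 : ℕ) : ℚ_[p])⁻¹) ^ 2 *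
        (P p m k - 1 + p * H p 1 k)) := by
      rw [hW, hA, hX, mul_sum, ← sum_sub_distrib, ← sum_add_distrib]
      refine sum_congr rfl fun k _ => ?_
      ring
    rw [e]
    refine sum_mem fun k hk => ?_
    have hk := mem_range.1 hk
    exact mul0 (neg_one_mem k) (mul0 (pow0 (inv_mem_lt (by omega) (by omega)) 2) (P_expand hm k (by omega)))
  have hA1 := A1_val h5 hm
  have hA2 := A2_val h5 hm
  have ha2 := a2_val h5 hm
  have hpT : p * T = p * H p 1 (2 * m) - 2 * (2 ^ (2 * m) - 1) + p ^ 2 * W := by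
    have h3 := congrArg (fun x : ℚ_[p] => p * x) h
    simp only [mul_add, mul_sub, mul_div_cancel₀ _ hp0] at h3
    rw [show (2 : ℚ_[p]) ^ p = 2 * 2 ^ (2 * m) by rw [← pow_succ', ← hm]] at h3
    push_cast at h3
    linear_combination h3
  rw [hpT]
  have e : p * H p 1 (2 * m) - 2 * (2 ^ (2 * m) - 1) + p ^ 2 * W + 2 * (2 ^ (2 * m) - 1)
      - 7 * 24⁻¹ * p ^ 3 * H p 3 m =
      p * (H p 1 (2 * m) - 6⁻¹ * p ^ 2 * H p 3 m) + p ^ 2 * (W - A + p * X) +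
      p ^ 2 * (H p 2 (2 * m) + 3⁻¹ * p * H p 3 m) - p ^ 2 * (2⁻¹ * (H p 2 m + 7 * 6⁻¹ * p * H p 3 m))
      - p ^ 3 * (X - 8⁻¹ * H p 3 m) := by
    rw [halt]; ring
  rw [e]
  refine sub_mem (sub_mem (add_mem (add_mem ?_ ?_) ?_) ?_) ?_
  · exact mul_mem (m := 1) (n := 3) p_mem hA1
  · exact mul_mem (m := 2) (n := 2) (ppow_mem 2) hWX
  · exact mul_mem (m := 2) (n := 2) (ppow_mem 2) hA2
  · exact mul_mem (m := 2) (n := 2) (ppow_mem 2) (mul0 (half_mem h5) ha2)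
  · exact mul_mem (m := 3) (n := 1) (ppow_mem 3) hXs

lemma main5 (h5 : 5 ≤ p) (hm : p = 2 * m + 1) :
    ∑ k ∈ range (2 * m + 1), (((2 * m).choose k : ℕ) : ℚ_[p]) ^ 3 -
      ((2 ^ (2 * m)) ^ 3 + (5 / 8) * (p : ℚ_[p]) ^ 3 * ((bernoulli (p - 3) : ℚ) : ℚ_[p])) ∈ I p 4 := by
  set F := ∑ k ∈ range (2 * m + 1), (((2 * m).choose k : ℕ) : ℚ_[p]) ^ 3 with hF
  have hp0 := p_ne (p := p)
  have hdiff : F - 4 * P p m m + 6 * 2 ^ (2 * m) - 4 +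
      ∑ k ∈ range (2 * m + 1), (((2 * m).choose k : ℕ) : ℚ_[p])⁻¹ ∈ I p 4 := by
    have s2 := congrArg (fun x : ℤ => (x : ℚ_[p])) (alt_choose_sq m)
    push_cast at s2
    have s1 := congrArg (fun x : ℕ => (x : ℚ_[p])) (Nat.sum_range_choose (2 * m))
    push_cast at s1
    have s0 : ∑ k ∈ range (2 * m + 1), (-1 : ℚ_[p]) ^ k = 1 := by
      rw [neg_one_geom_sum]
      simp
    have e : F - 4 * P p m m + 6 * 2 ^ (2 * m) - 4 +
      ∑ k ∈ range (2 * m + 1), (((2 * m).choose k : ℕ) : ℚ_[p])⁻¹ =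
      ∑ k ∈ range (2 * m + 1), (((((2 * m).choose k : ℕ) : ℚ_[p]) ^ 3 -
        4 * ((-1) ^ k * (((2 * m).choose k : ℕ) : ℚ_[p]) ^ 2) +
        6 * (((2 * m).choose k : ℕ) : ℚ_[p]) - 4 * (-1) ^ k) + (((2 * m).choose k : ℕ) : ℚ_[p])⁻¹) := by
      rw [sum_add_distrib, sum_sub_distrib, sum_add_distrib, sum_sub_distrib, ← mul_sum, ← mul_sum,
        ← mul_sum, s0, s1, s2]
      unfold P
      ring
    rw [e]
    refine sum_mem fun k hk => ?_
    have hk := mem_range.1 hk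
    have hd := P_sub_one hm k (by omega)
    have hne := P_ne (p := p) (m := m) k (by omega)
    have hci : (((2 * m).choose k : ℕ) : ℚ_[p])⁻¹ ∈ I p 0 := by
      apply inv_mem
      intro hdvd
      have h1 : p ∣ (2 * m).factorial := by
        rw [← Nat.choose_mul_factorial_mul_factorial (show k ≤ 2 * m by omega), mul_assoc]
        exact hdvd.mul_right _
      have := ((Fact.out : p.Prime).dvd_factorial).1 h1
      omega
    have hc0 : (((2 * m).choose k : ℕ) : ℚ_[p]) ≠ 0 := by
      exact_mod_cast (Nat.choose_pos (by omega)).ne'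
    have h2 : ((-1 : ℚ_[p]) ^ k) * (-1) ^ k = 1 := by
      rw [← mul_pow]; simp
    unfold P at hd
    generalize (((2 * m).choose k : ℕ) : ℚ_[p]) = c at *
    generalize (-1 : ℚ_[p]) ^ k = s at *
    have e2 : c ^ 3 - 4 * (s * c ^ 2) + 6 * c - 4 * s + c⁻¹ = c⁻¹ * (s * c - 1) ^ 4 := by
      field_simp
      linear_combination (-(c ^ 4) * (s * s + 1) + 4 * c ^ 3 * s - 6 * c ^ 2) * h2
    rw [e2]
    exact mul0 hci (pow_mem hd 4)
  rw [sum_inv_choose] at hdiff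
  rw [sum_range_succ] at hdiff
  have hT := T_val h5 hm
  set T := ∑ k ∈ range (2 * m), 2 ^ (k + 1) / ((k + 1 : ℕ) : ℚ_[p]) with hTdef
  have hx := pow16 h5 hm
  have hC := carlitz h5 hm
  have ha3 := a3_val h5 hm
  have hxi : ((2 : ℚ_[p]) ^ (2 * m))⁻¹ ∈ I p 0 := by
    rw [← inv_pow]; exact pow0 (half_mem h5) _
  have hx0 : (2 : ℚ_[p]) ^ (2 * m) ≠ 0 := pow_ne_zero _ two_ne_zero
  have h2 := half_mem (p := p) h5
  have h3 := third_mem (p := p) h5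
  have hH := H_mem (p := p) (s := 3) (n := m) (by omega)
  rw [← hm, show ((2 * m : ℕ) : ℚ_[p]) + 1 = p by rw [cast_p hm]; push_cast; ring,
    show (2 : ℚ_[p]) ^ p = 2 * 2 ^ (2 * m) by rw [← pow_succ', ← hm]] at hdiff
  generalize ((bernoulli (p - 3) : ℚ) : ℚ_[p]) = B at *
  generalize (2 : ℚ_[p]) ^ (2 * m) = x at *
  generalize H p 3 m = a at *
  have e : F - (x ^ 3 + 5 / 8 * p ^ 3 * B) =
      (F - 4 * P p m m + 6 * x - 4 + p / (2 * x) * (T + 2 * x / p)) +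
      4 * (P p m m - x ^ 2 + 24⁻¹ * p ^ 3 * a) -
      2⁻¹ * x⁻¹ * (p * T + 2 * (x - 1) - 7 * 24⁻¹ * p ^ 3 * a) -
      x⁻¹ * (x - 1) ^ 4 + (7 * (2⁻¹ ^ 4 * 3⁻¹) * x⁻¹ * a) * (p ^ 3 * (x - 1)) -
      (5 * 2⁻¹ ^ 4) * (p ^ 3 * (a + 2 * B)) := by
    field_simp
    ring
  rw [e]
  have hn : ∀ k : ℕ, ((k : ℕ) : ℚ_[p]) ∈ I p 0 := nat_mem
  have hI4 : (4 : ℚ_[p]) ∈ I p 0 := by simpa using hn 4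
  have hI7 : (7 : ℚ_[p]) ∈ I p 0 := by simpa using hn 7
  have hI5 : (5 : ℚ_[p]) ∈ I p 0 := by simpa using hn 5
  refine sub_mem (add_mem (sub_mem (sub_mem (add_mem hdiff ?_) ?_) ?_) ?_) ?_
  · exact mul0 hI4 hC
  · exact mul0 (mul0 h2 hxi) hT
  · exact mul0 hxi (pow_mem hx 4)
  · exact mul0 (mul0 (mul0 (mul0 hI7 (mul0 (pow0 h2 4) h3)) hxi) hH)
      (mul_mem (m := 3) (n := 1) (ppow_mem 3) hx)
  · exact mul0 (mul0 hI5 (pow0 h2 4)) (mul_mem (m := 3) (n := 1) (ppow_mem 3) ha3)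

end main
end PanCube

theorem pan_cor_cube (p : ℕ) [Fact p.Prime] (hodd : Odd p) :
    ‖(((∑ k ∈ Finset.range p, ((p - 1).choose k : ℚ) ^ 3)
        - (8 ^ (p - 1) + (5 / 8) * (p : ℚ) ^ 3 * bernoulli (p - 3)) : ℚ) : ℚ_[p])‖
      ≤ (p : ℝ) ^ (-(4 : ℤ)) := by
  have key := (PanCube.mem_iff_norm (p := p) (n := 4) (x := (((∑ k ∈ Finset.range p, ((p - 1).choose k : ℚ) ^ 3)
        - (8 ^ (p - 1) + (5 / 8) * (p : ℚ) ^ 3 * bernoulli (p - 3)) : ℚ) : ℚ_[p]))).1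
  refine key ?_
  have hpr : p.Prime := Fact.out
  obtain ⟨m, hm⟩ := hodd
  by_cases h5 : 5 ≤ p
  · have h := PanCube.main5 h5 hm
    rw [← hm] at h
    rw [show p - 1 = 2 * m by omega]
    push_cast
    convert h using 3
    rw [← pow_mul, mul_comm (2 * m) 3, pow_mul 2 3]
    norm_num
  · have : p = 3 := by
      have := hpr.two_le
      omega
    subst this
    have h1 := PanCube.inv_mem (p := 3) (a := 8) (by norm_num)
    have h2 := PanCube.mul_mem (m := 4) (n := 0) (PanCube.ppow_mem (p := 3) 4)
      (PanCube.mul0 (PanCube.int_mem (p := 3) (-7)) h1)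
    convert h2 using 1
    norm_num [Finset.sum_range_succ, Nat.choose]
end

section
/- For every odd prime p, Σ_{k=0}^{p-1} (-1)^k C(p-1,k)^4 ≡ 16^{p-1} + 2 p^3 B_{p-3} (mod p^4), as a congruence of p-integral rationals. -/
open Finset

namespace PanCor

section ringpart
variable {R : Type*} [CommRing R]

/-- the truncated product `∏_{j ≤ k} (1 - t P / j)` -/
def y (P : R) (u : ℕ → R) (t : R) (k : ℕ) : R := ∏ i ∈ range k, (1 - t * P * u (i + 1))

/-- harmonic-type sums -/
def H (u : ℕ → R) (s k : ℕ) : R := ∑ i ∈ range k, u (i + 1) ^ s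

lemma y_succ (P : R) (u : ℕ → R) (t : R) (k : ℕ) :
    y P u t (k + 1) = y P u t k * (1 - t * P * u (k + 1)) := prod_range_succ _ _

lemma H_succ (u : ℕ → R) (s k : ℕ) : H u s (k + 1) = H u s k + u (k + 1) ^ s :=
  sum_range_succ _ _

lemma cube_rel (P : R) (hP : P ^ 4 = 0) (u : ℕ → R) (k : ℕ) :
    y P u 1 k ^ 3 * y P u (-1) k = y P u 2 k * (1 + 2 * P ^ 3 * H u 3 k) := by
  induction k with
  | zero => simp [y, H]
  | succ k ih =>
    simp only [y_succ, H_succ]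
    generalize y P u 1 k = a at *
    generalize y P u (-1) k = b at *
    generalize y P u 2 k = c at *
    generalize H u 3 k = d at *
    generalize u (k + 1) = x at *
    linear_combination (1 - P * x) ^ 3 * (1 + P * x) * ih
      + (c * (1 + 2 * P ^ 3 * d) * (- x ^ 4) + 4 * c * x ^ 4 + c * 2 * d * 2 * x ^ 3 * P ^ 2 ) * hP

lemma sq_rel (P : R) (hP : P ^ 4 = 0) (u : ℕ → R) (k : ℕ) :
    y P u 2 k = y P u 1 k ^ 2 * (1 - P ^ 2 * H u 2 k - 2 * P ^ 3 * H u 3 k) := by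
  induction k with
  | zero => simp [y, H]
  | succ k ih =>
    simp only [y_succ, H_succ]
    generalize y P u 1 k = a at *
    generalize y P u 2 k = c at *
    generalize H u 3 k = d at *
    generalize H u 2 k = e at *
    generalize u (k + 1) = x at *
    rw [ih]
    grind

lemma P3_y (P : R) (hP : P ^ 4 = 0) (u : ℕ → R) (t : R) (k : ℕ) :
    P ^ 3 * y P u t k = P ^ 3 := by
  induction k with
  | zero => simp [y]
  | succ k ih =>
    rw [y_succ]
    linear_combination (1 - t * P * u (k + 1)) * ih - t * u (k + 1) * hP

lemma isUnit_y (P : R) (hP : P ^ 4 = 0) (u : ℕ → R) (t : R) (k : ℕ) :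
    IsUnit (y P u t k) := by
  have hn : IsNilpotent P := ⟨4, hP⟩
  unfold y
  rw [IsUnit.prod_iff]
  intro i _
  apply IsNilpotent.isUnit_one_sub
  rw [mul_assoc, mul_comm P, ← mul_assoc]
  exact (Commute.all _ _).isNilpotent_mul_left hn

lemma alt_sum (f : ℕ → R) (n : ℕ) :
    ∑ k ∈ range (2 * n + 1), (-1) ^ k * ∑ i ∈ range k, f (i + 1) = ∑ i ∈ range n, f (2 * i + 2) := by
  induction n with
  | zero => simp
  | succ n ih =>
    rw [show 2 * (n + 1) + 1 = 2 * n + 1 + 1 + 1 by ring, sum_range_succ, sum_range_succ, ih,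
      sum_range_succ _ n, sum_range_succ _ (2 * n + 1)]
    have : (-1 : R) ^ (2 * n + 1) = -1 := by rw [pow_succ, pow_mul]; simp
    rw [show (-1 : R) ^ (2 * n + 1 + 1) = 1 by rw [pow_succ, this]; simp, this]
    ring

end ringpart

lemma prod_pair {M : Type*} [CommMonoid M] (f : ℕ → M) (n : ℕ) :
    ∏ i ∈ range (2 * n), f (i + 1) = ∏ i ∈ range n, (f (i + 1) * f (2 * n - i)) := by
  rw [two_mul, prod_range_add, prod_mul_distrib]
  congr 1
  rw [← prod_range_reflect]
  apply prod_congr rfl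
  intro i hi
  rw [mem_range] at hi
  congr 1
  omega

lemma sum_pair {M : Type*} [AddCommMonoid M] (f : ℕ → M) (n : ℕ) :
    ∑ i ∈ range (2 * n), f (i + 1) = ∑ i ∈ range n, (f (i + 1) + f (2 * n - i)) := by
  rw [two_mul, sum_range_add, sum_add_distrib]
  congr 1
  rw [← sum_range_reflect]
  apply sum_congr rfl
  intro i hi
  rw [mem_range] at hi
  congr 1
  omega

lemma sum_evenodd {M : Type*} [AddCommMonoid M] (f : ℕ → M) (n : ℕ) :
    ∑ i ∈ range (2 * n), f (i + 1) = ∑ i ∈ range n, (f (2 * i + 2) + f (2 * n - 1 - 2 * i)) := by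
  have h1 : ∑ i ∈ range (2 * n), f (i + 1) = ∑ i ∈ range n, (f (2 * i + 2) + f (2 * i + 1)) := by
    induction n with
    | zero => simp
    | succ n ih =>
      rw [show 2 * (n + 1) = 2 * n + 1 + 1 by ring, sum_range_succ, sum_range_succ, ih,
        sum_range_succ _ n, add_assoc, add_comm (f (2 * n + 1))]
  rw [h1, sum_add_distrib, sum_add_distrib]
  congr 1
  rw [← sum_range_reflect]
  apply sum_congr rfl
  intro i hi
  rw [mem_range] at hi
  congr 1
  omega

/-- Alternating Vandermonde convolution. -/
lemma conv_id (M n : ℕ) :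
    ∑ k ∈ range (2 * n + 1), (-1 : ℤ) ^ k * (M.choose k) * (M.choose (2 * n - k))
      = (-1) ^ n * M.choose n := by
  have h : ((1 - Polynomial.X : Polynomial ℤ) ^ M * (1 + Polynomial.X) ^ M)
      = Polynomial.expand ℤ 2 ((1 - Polynomial.X) ^ M) := by
    rw [← mul_pow]
    simp only [map_pow, map_sub, map_one, Polynomial.expand_X]
    ring
  have hc : ∀ k, ((1 - Polynomial.X : Polynomial ℤ) ^ M).coeff k = (-1) ^ k * M.choose k := by
    intro k
    have h2 : (1 - Polynomial.X : Polynomial ℤ) ^ M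
        = ((1 + Polynomial.X) ^ M).comp (Polynomial.C (-1) * Polynomial.X) := by
      simp [sub_eq_add_neg]
    rw [h2, Polynomial.comp_C_mul_X_coeff, Polynomial.coeff_one_add_X_pow]
    ring
  have h3 := congrArg (fun q => q.coeff (2 * n)) h
  simp only [Polynomial.coeff_mul] at h3
  rw [Polynomial.coeff_expand (by norm_num), if_pos (by simp),
    Nat.mul_div_cancel_left _ (by norm_num), hc,
    Finset.Nat.sum_antidiagonal_eq_sum_range_succ
      (fun i j => ((1 - Polynomial.X : Polynomial ℤ) ^ M).coeff i * ((1 + Polynomial.X) ^ M).coeff j)] at h3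
  rw [← h3]
  apply sum_congr rfl
  intro k _
  rw [hc, Polynomial.coeff_one_add_X_pow]

/-- the product behind the congruence of Morley -/
lemma morley_prod (n : ℕ) :
    ∏ j ∈ range (2 * n), (2 * (2 * ((j : ℤ) + 1) - (2 * n + 1)))
      = (-1) ^ n * (2 * n).choose n * (2 * n).factorial := by
  have h1 : (∏ j ∈ range n, (2 * (2 * (j : ℤ) + 1))) * (n.factorial : ℤ) = (2 * n).factorial := by
    induction n with
    | zero => simp
    | succ n ih =>
      rw [prod_range_succ, show 2 * (n + 1) = 2 * n + 1 + 1 by ring, Nat.factorial_succ,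
        Nat.factorial_succ, Nat.factorial_succ]
      push_cast
      rw [← ih]
      ring
  have h2 : ((2 * n).choose n : ℤ) * n.factorial * n.factorial = (2 * n).factorial := by
    have := Nat.choose_mul_factorial_mul_factorial (show n ≤ 2 * n by omega)
    rw [show 2 * n - n = n by omega] at this
    exact_mod_cast this
  have h3 : ∏ j ∈ range (2 * n), (2 * (2 * ((j : ℤ) + 1) - (2 * n + 1)))
      = (-1) ^ n * (∏ j ∈ range n, (2 * (2 * (j : ℤ) + 1))) ^ 2 := by
    rw [two_mul n, prod_range_add, ← prod_range_reflect, sq, ← mul_assoc]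
    congr 1
    · have : (-1 : ℤ) ^ n = ∏ j ∈ range n, (-1) := by simp
      rw [this, ← prod_mul_distrib]
      apply prod_congr rfl
      intro j hj
      rw [mem_range] at hj
      rw [Nat.sub_sub, Nat.cast_sub (by omega)]
      push_cast
      ring
    · apply prod_congr rfl
      intro j hj
      push_cast
      ring
  rw [h3]
  have hf : (n.factorial : ℤ) ≠ 0 := by exact_mod_cast n.factorial_ne_zero
  have h4 : (∏ j ∈ range n, (2 * (2 * (j : ℤ) + 1))) = (2 * n).choose n * n.factorial := by
    apply mul_right_cancel₀ hf
    rw [h1, h2]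
  rw [sq]
  nth_rewrite 1 [h4]
  rw [← h1]
  ring

section mainpart
variable {R : Type*} [CommRing R]

lemma y_choose (P : R) (u : ℕ → R) (t : R) (M L : ℕ) (hM : (M : R) + 1 = t * P) (hL : L ≤ M)
    (hu : ∀ j, 1 ≤ j → j ≤ L → (j : R) * u j = 1) (k : ℕ) (hk : k ≤ L) :
    y P u t k = (-1) ^ k * M.choose k := by
  induction k with
  | zero => simp [y]
  | succ k ih =>
    rw [y_succ, ih (by omega), ← hM]
    have h1 := hu (k + 1) (by omega) hk
    have h2 : (M.choose (k + 1) : R) * (k + 1) = M.choose k * (M - k) := by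
      rw [← Nat.cast_sub (by omega)]
      have h := congrArg (Nat.cast : ℕ → R) (Nat.choose_succ_right_eq M k)
      push_cast at h
      exact h
    push_cast at h1
    rw [pow_succ]
    linear_combination ((-1) ^ k * (M.choose k : R) + (-1) ^ k * M.choose (k + 1)) * (-h1)
       + (-1) ^ k * u (k + 1) * h2

lemma choose_refl (P : R) (u : ℕ → R) (n : ℕ) (hPn : P = 2 * (n : R) + 1)
    (hu : ∀ j, 1 ≤ j → j ≤ 2 * n → (j : R) * u j = 1) (k : ℕ) (hk : k ≤ 2 * n) :
    ((4 * n + 1).choose (2 * n - k) : R) * y P u (-1) k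
      = (4 * n + 1).choose (2 * n) * ((-1) ^ k * y P u 1 k) := by
  induction k with
  | zero => simp [y]
  | succ k ih =>
    have ih := ih (by omega)
    rw [y_succ, y_succ]
    have h1 := hu (k + 1) (by omega) hk
    obtain ⟨m, hm⟩ : ∃ m, 2 * n = m + (k + 1) := ⟨2 * n - (k + 1), by omega⟩
    have h2 := Nat.choose_succ_right_eq (4 * n + 1) m
    rw [show 4 * n + 1 - m = 2 * n + 1 + (k + 1) by omega] at h2
    have h3 : ((4 * n + 1).choose (m + 1) : R) * (m + 1)
      = (4 * n + 1).choose m * (2 * n + 1 + (k + 1)) := by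
      have h := congrArg (Nat.cast : ℕ → R) h2
      push_cast at h
      exact h
    have hm' : 2 * (n : R) = m + (k + 1) := by
      have h := congrArg (Nat.cast : ℕ → R) hm
      push_cast at h
      exact h
    rw [show 2 * n - k = m + 1 by omega] at ih
    rw [show 2 * n - (k + 1) = m by omega]
    rw [hPn, pow_succ] at *
    push_cast at h1
    generalize y (2 * (n : R) + 1) u 1 k = a at *
    generalize y (2 * (n : R) + 1) u (-1) k = b at *
    generalize ((4 * n + 1).choose (m + 1) : R) = c1 at *
    generalize ((4 * n + 1).choose m : R) = c2 at *
    generalize ((4 * n + 1).choose (2 * n) : R) = c at *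
    generalize u (k + 1) = x at *
    generalize (-1 : R) ^ k = e at *
    have e1 : 1 - -1 * (2 * (n : R) + 1) * x = (2 * n + 1 + (k + 1)) * x := by
      linear_combination -h1
    have e2 : 1 - 1 * (2 * (n : R) + 1) * x = - ((m + 1) * x) := by
      linear_combination -h1 - x * hm'
    rw [e1, e2]
    linear_combination (-b * x) * h3 + (m + 1) * x * ih

lemma prod_one_add (P : R) (hP : P ^ 4 = 0) (c : R) (w : ℕ → R) (n : ℕ) :
    ∏ i ∈ range n, (1 + c * P ^ 2 * w i) = 1 + c * P ^ 2 * ∑ i ∈ range n, w i := by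
  induction n with
  | zero => simp
  | succ n ih =>
    rw [prod_range_succ, sum_range_succ, ih]
    linear_combination (c * c * w n * ∑ i ∈ range n, w i) * hP

lemma y_full (P : R) (hP : P ^ 4 = 0) (u : ℕ → R) (t : R) (n : ℕ) (hPn : P = 2 * (n : R) + 1)
    (hu : ∀ j, 1 ≤ j → j ≤ 2 * n → (j : R) * u j = 1) :
    y P u t (2 * n) = 1 + (t ^ 2 - t) * P ^ 2 * ∑ i ∈ range n, u (i + 1) * u (2 * n - i) := by
  rw [← prod_one_add P hP]
  unfold y
  rw [prod_pair (fun j => 1 - t * P * u j)]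
  apply prod_congr rfl
  intro i hi
  rw [mem_range] at hi
  have h1 := hu (i + 1) (by omega) (by omega)
  have h2 := hu (2 * n - i) (by omega) (by omega)
  rw [Nat.cast_sub (by omega)] at h2
  push_cast at h1 h2
  have h3 : 2 * (n : R) = P - 1 := by rw [hPn]; ring
  rw [h3] at h2
  linear_combination t * P * u (2 * n - i) * h1 + t * P * u (i + 1) * h2

lemma inv_refl (P : R) (hP : P ^ 4 = 0) (u : ℕ → R) (n : ℕ) (hPn : P = 2 * (n : R) + 1)
    (hu : ∀ j, 1 ≤ j → j ≤ 2 * n → (j : R) * u j = 1) (a : ℕ) (h1 : 1 ≤ a) (h2 : a ≤ 2 * n) :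
    P ^ 2 * u (2 * n + 1 - a) = - P ^ 2 * (u a + P * u a ^ 2) := by
  have h1' := hu a (by omega) (by omega)
  have h2' := hu (2 * n + 1 - a) (by omega) (by omega)
  rw [Nat.cast_sub (by omega)] at h2'
  push_cast at h2'
  rw [← hPn] at h2'
  generalize u (2 * n + 1 - a) = v at *
  generalize u a = x at *
  linear_combination (v * x ^ 2) * hP - P ^ 2 * (x + P * x ^ 2) * h2' - P ^ 2 * v * (1 + P * x) * h1'

lemma W_eq (P : R) (hP : P ^ 4 = 0) (u : ℕ → R) (n : ℕ) (hPn : P = 2 * (n : R) + 1)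
    (hu : ∀ j, 1 ≤ j → j ≤ 2 * n → (j : R) * u j = 1) :
    P ^ 2 * ∑ i ∈ range n, u (i + 1) * u (2 * n - i) = - P ^ 2 * H u 2 n - P ^ 3 * H u 3 n := by
  unfold H
  rw [mul_sum, mul_sum, mul_sum, ← sum_sub_distrib]
  apply sum_congr rfl
  intro i hi
  rw [mem_range] at hi
  have h := inv_refl P hP u n hPn hu (i + 1) (by omega) (by omega)
  rw [show 2 * n + 1 - (i + 1) = 2 * n - i by omega] at h
  linear_combination u (i + 1) * h

lemma H2_eq (P : R) (hP : P ^ 4 = 0) (u : ℕ → R) (n : ℕ) (hn : 1 ≤ n) (hPn : P = 2 * (n : R) + 1)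
    (hu : ∀ j, 1 ≤ j → j ≤ 2 * n → (j : R) * u j = 1) :
    6 * (P ^ 2 * H u 2 n) = - 7 * (P ^ 3 * H u 3 n) := by
  have hsq : ∀ a, 1 ≤ a → a ≤ 2 * n →
      P ^ 2 * u (2 * n + 1 - a) ^ 2 = P ^ 2 * u a ^ 2 + 2 * P ^ 3 * u a ^ 3 := by
    intro a h1 h2
    have h := inv_refl P hP u n hPn hu a h1 h2
    linear_combination (u (2 * n + 1 - a) - u a - P * u a ^ 2) * h + u a ^ 4 * hP
  have hdbl : ∀ i, i < n → 2 * u (2 * i + 2) = u (i + 1) := by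
    intro i hi
    have h1 := hu (i + 1) (by omega) (by omega)
    have h2 := hu (2 * i + 2) (by omega) (by omega)
    push_cast at h1 h2
    linear_combination u (i + 1) * h2 - 2 * u (2 * i + 2) * h1
  have e1 : P ^ 2 * H u 2 (2 * n) = 2 * (P ^ 2 * H u 2 n) + 2 * (P ^ 3 * H u 3 n) := by
    unfold H
    rw [sum_pair (fun j => u j ^ 2)]
    simp only [mul_sum]
    rw [← sum_add_distrib]
    apply sum_congr rfl
    intro i hi
    rw [mem_range] at hi
    have h := hsq (i + 1) (by omega) (by omega)
    rw [show 2 * n + 1 - (i + 1) = 2 * n - i by omega] at h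
    linear_combination h
  have e2 : 4 * (P ^ 2 * H u 2 (2 * n)) = 2 * (P ^ 2 * H u 2 n) + (P ^ 3 * H u 3 n) := by
    unfold H
    rw [sum_evenodd (fun j => u j ^ 2)]
    simp only [mul_sum]
    rw [← sum_add_distrib]
    apply sum_congr rfl
    intro i hi
    rw [mem_range] at hi
    have h := hsq (2 * i + 2) (by omega) (by omega)
    rw [show 2 * n + 1 - (2 * i + 2) = 2 * n - 1 - 2 * i by omega] at h
    rw [← hdbl i hi]
    linear_combination 4 * h
  linear_combination -4 * e1 + e2

lemma main_sum (P : R) (hP : P ^ 4 = 0) (u : ℕ → R) (n : ℕ) (hPn : P = 2 * (n : R) + 1)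
    (hu : ∀ j, 1 ≤ j → j ≤ 2 * n → (j : R) * u j = 1) :
    8 * (y P u 2 (2 * n) * ∑ k ∈ range (2 * n + 1), (-1) ^ k * ((2 * n).choose k : R) ^ 4)
      = 8 * y P u 2 n + 2 * (P ^ 3 * H u 3 n) := by
  have hy1 : ∀ k, k ≤ 2 * n → y P u 1 k = (-1) ^ k * (2 * n).choose k := fun k hk =>
    y_choose P u 1 (2 * n) (2 * n) (by rw [hPn]; push_cast; ring) le_rfl hu k hk
  have hy2 : ∀ k, k ≤ 2 * n → y P u 2 k = (-1) ^ k * (4 * n + 1).choose k := fun k hk =>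
    y_choose P u 2 (4 * n + 1) (2 * n) (by rw [hPn]; push_cast; ring) (by omega) hu k hk
  have hs : ∀ k : ℕ, ((-1 : R) ^ k) * (-1) ^ k = 1 := fun k => by
    rw [← mul_pow]; simp
  have hN : y P u 2 (2 * n) = (4 * n + 1).choose (2 * n) := by
    rw [hy2 _ le_rfl, pow_mul]; simp
  have hterm : ∀ k, k ≤ 2 * n → y P u 2 (2 * n) * ((2 * n).choose k : R) ^ 4
      = (4 * n + 1).choose k * (4 * n + 1).choose (2 * n - k) * (1 + 2 * P ^ 3 * H u 3 k) := by
    intro k hk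
    apply (isUnit_y P hP u (-1) k).mul_right_cancel
    have h1 := cube_rel P hP u k
    have h2 := choose_refl P u n hPn hu k hk
    have h3 : ((2 * n).choose k : R) ^ 4 = y P u 1 k ^ 4 := by
      rw [hy1 k hk]
      linear_combination (-((2 * n).choose k : R) ^ 4) * (((-1) ^ k * (-1) ^ k) + 1) * hs k
    have h4 : ((4 * n + 1).choose k : R) = (-1) ^ k * y P u 2 k := by
      rw [hy2 k hk]
      linear_combination (-((4 * n + 1).choose k : R)) * hs k
    rw [h3, h4, hN]
    linear_combination ((4 * n + 1).choose (2 * n) * y P u 1 k) * h1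
      - ((-1) ^ k * y P u 2 k * (1 + 2 * P ^ 3 * H u 3 k)) * h2
      - ((4 * n + 1).choose (2 * n) * y P u 1 k * y P u 2 k * (1 + 2 * P ^ 3 * H u 3 k)) * hs k
  have hP3 : ∀ k, k ≤ 2 * n →
      P ^ 3 * ((4 * n + 1).choose k * (4 * n + 1).choose (2 * n - k) : R) = P ^ 3 := by
    intro k hk
    have h1 := P3_y P hP u 2 k
    have h2 := P3_y P hP u 2 (2 * n - k)
    rw [hy2 _ hk] at h1
    rw [hy2 _ (by omega)] at h2
    have h3 : (-1 : R) ^ k * (-1) ^ (2 * n - k) = 1 := by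
      rw [← pow_add, show k + (2 * n - k) = 2 * n by omega, pow_mul]; simp
    linear_combination ((-1) ^ (2 * n - k) * (4 * n + 1).choose (2 * n - k)) * h1 + h2
      - P ^ 3 * ((4 * n + 1).choose k * (4 * n + 1).choose (2 * n - k) : R) * h3
  have hconv : ∑ k ∈ range (2 * n + 1), (-1 : R) ^ k *
      ((4 * n + 1).choose k * (4 * n + 1).choose (2 * n - k)) = y P u 2 n := by
    rw [hy2 n (by omega)]
    have h := congrArg (Int.cast : ℤ → R) (conv_id (4 * n + 1) n)
    push_cast at h
    rw [← h]
    apply sum_congr rfl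
    intro k _
    ring
  have halt := alt_sum (fun j => u j ^ 3) n
  have hdbl : ∀ i, i < n → 2 * u (2 * i + 2) = u (i + 1) := by
    intro i hi
    have h1 := hu (i + 1) (by omega) (by omega)
    have h2 := hu (2 * i + 2) (by omega) (by omega)
    push_cast at h1 h2
    linear_combination u (i + 1) * h2 - 2 * u (2 * i + 2) * h1
  have h8 : 8 * ∑ k ∈ range (2 * n + 1), (-1 : R) ^ k * H u 3 k = H u 3 n := by
    unfold H
    rw [halt, mul_sum]
    apply sum_congr rfl
    intro i hi
    rw [mem_range] at hi
    rw [← hdbl i hi]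
    ring
  have hmain : y P u 2 (2 * n) * ∑ k ∈ range (2 * n + 1), (-1) ^ k * ((2 * n).choose k : R) ^ 4
      = y P u 2 n + 2 * P ^ 3 * ∑ k ∈ range (2 * n + 1), (-1 : R) ^ k * H u 3 k := by
    rw [← hconv, mul_sum, mul_sum, ← sum_add_distrib]
    apply sum_congr rfl
    intro k hk
    rw [mem_range] at hk
    linear_combination (-1) ^ k * hterm k (by omega) + (-1) ^ k * 2 * H u 3 k * hP3 k (by omega)
  linear_combination 8 * hmain + 2 * P ^ 3 * h8

lemma morley (P : R) (hP : P ^ 4 = 0) (u : ℕ → R) (n : ℕ) (hn : 1 ≤ n)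
    (hPn : P = 2 * (n : R) + 1)
    (hu : ∀ j, 1 ≤ j → j ≤ 2 * n → (j : R) * u j = 1) :
    4 * y P u 1 n = 4 ^ (2 * n) * (4 + P ^ 2 * H u 2 n + P ^ 3 * H u 3 n) := by
  have hy1 : y P u 1 n = (-1) ^ n * (2 * n).choose n :=
    y_choose P u 1 (2 * n) (2 * n) (by rw [hPn]; push_cast; ring) le_rfl hu n (by omega)
  have h2 := hu 2 (by omega) (by omega)
  push_cast at h2
  have hf : ((2 * n).factorial : R) * ∏ i ∈ range (2 * n), u (i + 1) = 1 := by
    rw [← Finset.prod_range_add_one_eq_factorial]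
    push_cast
    rw [← prod_mul_distrib]
    apply prod_eq_one
    intro i hi
    rw [mem_range] at hi
    exact_mod_cast hu (i + 1) (by omega) (by omega)
  have hm := congrArg (Int.cast : ℤ → R) (morley_prod n)
  push_cast at hm
  rw [← hPn] at hm
  have hz : y P u 1 n = 4 ^ (2 * n) * y P u (u 2) (2 * n) := by
    rw [hy1]
    have : (-1 : R) ^ n * (2 * n).choose n
        = (∏ j ∈ range (2 * n), (2 * (2 * ((j : R) + 1) - P))) * ∏ i ∈ range (2 * n), u (i + 1) := by
      rw [hm]
      linear_combination (-(-1 : R) ^ n * (2 * n).choose n) * hf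
    rw [this, ← prod_mul_distrib]
    have h4 : (4 : R) ^ (2 * n) = ∏ j ∈ range (2 * n), 4 := by simp
    unfold y
    rw [h4, ← prod_mul_distrib]
    apply prod_congr rfl
    intro i hi
    rw [mem_range] at hi
    have h1 := hu (i + 1) (by omega) (by omega)
    push_cast at h1
    linear_combination 4 * h1 + 2 * P * u (i + 1) * h2
  rw [hz, y_full P hP u _ n hPn hu]
  have hW := W_eq P hP u n hPn hu
  linear_combination (-(4 : R) ^ (2 * n)) * hW + 4 ^ (2 * n) * (P ^ 2 *
    ∑ i ∈ range n, u (i + 1) * u (2 * n - i)) * (2 * u 2 - 1) * h2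

lemma pow_expand (P : R) (hP : P ^ 4 = 0) (x : R) (m : ℕ) :
    P ^ 2 * (P + x) ^ (m + 1) = P ^ 2 * (x ^ (m + 1) + (m + 1) * P * x ^ m) := by
  induction m with
  | zero => simp; ring
  | succ m ih =>
    rw [pow_succ (P + x), ← mul_assoc, ih]
    push_cast
    linear_combination (m + 1) * x ^ m * hP

lemma bern_rel (P : R) (hP : P ^ 4 = 0) (u : ℕ → R) (n m : ℕ) (hm : 2 * n = m + 3)
    (hPn : P = 2 * (n : R) + 1)
    (hu : ∀ j, 1 ≤ j → j ≤ 2 * n → (j : R) * u j = 1)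
    (hF : ∀ j : ℕ, 1 ≤ j → j ≤ 2 * n → P ^ 3 * (j : R) ^ (2 * n) = P ^ 3) (b c : R)
    (hT : ∑ j ∈ range (2 * n), ((j : R) + 1) ^ (m + 1) = P * b + P ^ 2 * c) :
    P ^ 3 * H u 3 n = -2 * (P ^ 3 * b) := by
  have hmodd : Even (m + 1) := ⟨n - 1, by omega⟩
  have hmodd' : Odd m := by
    by_contra h
    rw [Nat.not_odd_iff_even] at h
    exact absurd hmodd (by rw [Nat.even_add_one]; simpa using h)
  have h3 := hu 3 (by omega) (by omega)
  push_cast at h3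
  have hmR : (m : R) = P - 4 := by
    have : 2 * (n : R) = m + 3 := by
      have h := congrArg (Nat.cast : ℕ → R) hm
      push_cast at h
      exact h
    rw [hPn, this]; ring
  have hD : P ^ 3 * H u 3 n = P ^ 3 * ∑ i ∈ range n, ((i : R) + 1) ^ m := by
    unfold H
    rw [mul_sum, mul_sum]
    apply sum_congr rfl
    intro i hi
    rw [mem_range] at hi
    have h1 := hu (i + 1) (by omega) (by omega)
    have h2 := hF (i + 1) (by omega) (by omega)
    push_cast at h1 h2
    rw [hm, pow_add] at h2
    have h4 : (((i : R) + 1) * u (i + 1)) ^ 3 = 1 := by rw [h1]; simp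
    linear_combination (-u (i + 1) ^ 3) * h2 + P ^ 3 * ((i : R) + 1) ^ m * h4
  have hpow : ∀ a : ℕ, a ≤ 2 * n + 1 → P ^ 2 * ((2 * n + 1 - a : ℕ) : R) ^ (m + 1)
      = P ^ 2 * (a : R) ^ (m + 1) + 3 * P ^ 3 * (a : R) ^ m := by
    intro a h
    rw [Nat.cast_sub h]
    push_cast
    rw [← hPn, sub_eq_add_neg, pow_expand P hP, hmodd.neg_pow, hmodd'.neg_pow, hmR]
    linear_combination (-(a : R) ^ m) * hP
  have hT1 : ∑ j ∈ range (2 * n), (((j + 1 : ℕ)) : R) ^ (m + 1) = P * b + P ^ 2 * c := by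
    rw [← hT]; push_cast; rfl
  have e1 : P ^ 3 * b = 2 * (P ^ 2 * ∑ i ∈ range n, ((i : R) + 1) ^ (m + 1))
      + 3 * (P ^ 3 * ∑ i ∈ range n, ((i : R) + 1) ^ m) := by
    have : P ^ 3 * b = P ^ 2 * ∑ j ∈ range (2 * n), (((j + 1 : ℕ)) : R) ^ (m + 1) := by
      rw [hT1]; linear_combination (-c) * hP
    rw [this, sum_pair (fun j : ℕ => (j : R) ^ (m + 1))]
    simp only [mul_sum]
    rw [← sum_add_distrib]
    apply sum_congr rfl
    intro i hi
    rw [mem_range] at hi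
    have h := hpow (i + 1) (by omega)
    rw [show 2 * n + 1 - (i + 1) = 2 * n - i by omega] at h
    push_cast at h ⊢
    linear_combination h
  have e2 : P ^ 3 * b = 2 * 2 ^ (m + 1) * (P ^ 2 * ∑ i ∈ range n, ((i : R) + 1) ^ (m + 1))
      + 3 * 2 ^ m * (P ^ 3 * ∑ i ∈ range n, ((i : R) + 1) ^ m) := by
    have : P ^ 3 * b = P ^ 2 * ∑ j ∈ range (2 * n), (((j + 1 : ℕ)) : R) ^ (m + 1) := by
      rw [hT1]; linear_combination (-c) * hP
    rw [this, sum_evenodd (fun j : ℕ => (j : R) ^ (m + 1))]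
    simp only [mul_sum]
    rw [← sum_add_distrib]
    apply sum_congr rfl
    intro i hi
    rw [mem_range] at hi
    have h := hpow (2 * i + 2) (by omega)
    rw [show 2 * n + 1 - (2 * i + 2) = 2 * n - 1 - 2 * i by omega] at h
    have h6 : ((2 * i + 2 : ℕ) : R) = 2 * ((i : R) + 1) := by push_cast; ring
    rw [h6, mul_pow, mul_pow] at h
    rw [h6, mul_pow]
    linear_combination h
  have h2 := hF 2 (by omega) (by omega)
  rw [hm] at h2
  push_cast at h2
  rw [hD]
  generalize ∑ i ∈ range n, ((i : R) + 1) ^ m = D at *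
  generalize ∑ i ∈ range n, ((i : R) + 1) ^ (m + 1) = A at *
  -- from e1, e2 and Fermat for 2
  have e3 : 3 * (P ^ 3 * D) = 3 * (-2 * (P ^ 3 * b)) := by
    linear_combination (2 * b - 3 * D) * h2 - 8 * 2 ^ (m + 1) * e1 + 8 * e2
  linear_combination u 3 * e3 - (P ^ 3 * D + 2 * (P ^ 3 * b)) * h3

lemma ring_main (P : R) (hP : P ^ 4 = 0) (u : ℕ → R) (n m : ℕ) (hm : 2 * n = m + 3)
    (hPn : P = 2 * (n : R) + 1)
    (hu : ∀ j, 1 ≤ j → j ≤ 2 * n → (j : R) * u j = 1)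
    (hF : ∀ j : ℕ, 1 ≤ j → j ≤ 2 * n → P ^ 3 * (j : R) ^ (2 * n) = P ^ 3) (b c : R)
    (hT : ∑ j ∈ range (2 * n), ((j : R) + 1) ^ (m + 1) = P * b + P ^ 2 * c) :
    ∑ k ∈ range (2 * n + 1), (-1) ^ k * ((2 * n).choose k : R) ^ 4
      = 16 ^ (2 * n) + 2 * P ^ 3 * b := by
  have hb := bern_rel P hP u n m hm hPn hu hF b c hT
  have h1 := main_sum P hP u n hPn hu
  have h2 := morley P hP u n (by omega) hPn hu
  have h3 := H2_eq P hP u n (by omega) hPn hu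
  have h4 := sq_rel P hP u n
  have h5 := y_full P hP u 2 n hPn hu
  have h6 := W_eq P hP u n hPn hu
  have h7 := P3_y P hP u 1 n
  have i2 := hu 2 (by omega) (by omega)
  have i3 := hu 3 (by omega) (by omega)
  push_cast at i2 i3
  have h8 : P ^ 3 * (4 : R) ^ (2 * n) = P ^ 3 := by
    have := hF 2 (by omega) (by omega)
    push_cast at this
    rw [show (4 : R) = 2 * 2 by norm_num, mul_pow]
    linear_combination (1 + 2 ^ (2 * n)) * this
  have h16 : (16 : R) ^ (2 * n) = 4 ^ (2 * n) * 4 ^ (2 * n) := by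
    rw [← mul_pow]; norm_num
  rw [h16]
  have iu : ∃ v : R, 2 * v = 1 ∧ ∃ w : R, 3 * w = 1 := ⟨_, i2, _, i3⟩
  obtain ⟨v, hv, w, hw⟩ := iu
  generalize ∑ i ∈ range n, u (i + 1) * u (2 * n - i) = W at *
  generalize ∑ k ∈ range (2 * n + 1), (-1) ^ k * ((2 * n).choose k : R) ^ 4 = S at *
  generalize y P u 1 n = a at *
  generalize y P u 2 n = d at *
  generalize y P u 2 (2 * n) = C at *
  generalize (4 : R) ^ (2 * n) = F at *
  generalize H u 2 n = h at *
  generalize H u 3 n = g at *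
  have Pb : P * (P ^ 3 * b) = 0 := by linear_combination b * hP
  have Pg : P * (P ^ 3 * g) = 0 := by linear_combination g * hP
  -- everything in terms of E
  set E := P ^ 3 * g with hE
  have eH : P ^ 2 * h = -7 * (v * w * E) := by
    linear_combination v * w * h3 - P ^ 2 * h * (3 * w * hv + hw)
  have eW : P ^ 2 * W = v * w * E := by
    linear_combination h6 - eH + E * (3 * w * hv + hw)
  have eC : C = 1 + 2 * (v * w * E) := by rw [h5]; linear_combination 2 * eW
  have EF : E * F = E := by rw [hE]; linear_combination g * h8
  have Ea : E * a = E := by rw [hE]; linear_combination g * h7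
  have EE : E * E = 0 := by rw [hE]; linear_combination g ^ 2 * P ^ 2 * hP
  have E6 : E = 6 * (v * w * E) := by linear_combination -E * (3 * w * hv + hw)
  generalize hG : v * w * E = G at *
  have GF : G * F = G := by rw [← hG]; linear_combination v * w * EF
  have Ga : G * a = G := by rw [← hG]; linear_combination v * w * Ea
  have EG : E * G = 0 := by rw [← hG]; linear_combination v * w * EE
  have ea : 4 * a = 4 * F - G := by
    linear_combination h2 + F * eH + F * E6 - GF
  have ed : d = a ^ 2 - 5 * G := by
    linear_combination h4 - a ^ 2 * eH - 2 * a ^ 2 * E6 - 5 * (a + 1) * Ga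
  have Ed : E * d = E := by
    linear_combination E * ed + (a + 1) * Ea - 5 * EG
  have ES : E * S = E := by
    have h9 : 8 * (E * S) = 8 * E := by
      linear_combination E * h1 - 8 * E * S * eC - 16 * S * EG + 8 * Ed + 2 * EE
    linear_combination v ^ 3 * h9 - (E * S - E) * (4 * v ^ 2 + 2 * v + 1) * hv
  have GS : G * S = G := by rw [← hG]; linear_combination v * w * ES
  have eS : 8 * S = 8 * d + 2 * E - 16 * G := by
    linear_combination h1 - 8 * S * eC - 16 * GS
  have ea2 : 16 * a ^ 2 = 16 * F ^ 2 - 8 * G := by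
    linear_combination (4 * a + 4 * F) * ea - 4 * Ga - 4 * GF
  have h10 : 16 * S = 16 * (F * F + 2 * P ^ 3 * b) := by
    linear_combination 2 * eS + 16 * ed + ea2 - 16 * hb + 20 * E6
  linear_combination v ^ 4 * h10 - (S - (F * F + 2 * P ^ 3 * b)) *
    (8 * v ^ 3 + 4 * v ^ 2 + 2 * v + 1) * hv

end mainpart

section padic
variable (p : ℕ) [hp : Fact p.Prime]

lemma inv_mem (a : ℕ) (h1 : 1 ≤ a) (h2 : a < p) :
    ((a : ℚ_[p]))⁻¹ ∈ PadicInt.subring p := by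
  rw [PadicInt.mem_subring_iff, norm_inv, Padic.norm_natCast_eq_one_iff.2, inv_one]
  exact (Nat.coprime_of_lt_prime (by omega) h2 hp.out)

lemma bern'_mem (n : ℕ) (hn : n + 1 < p) : ((bernoulli' n : ℚ) : ℚ_[p]) ∈ PadicInt.subring p := by
  induction n using Nat.strong_induction_on with
  | _ n ih =>
    rw [bernoulli'_def]
    push_cast
    refine sub_mem (one_mem _) (sum_mem fun k hk => ?_)
    rw [mem_range] at hk
    refine mul_mem ?_ (ih k hk (by omega))
    rw [div_eq_mul_inv]
    refine mul_mem (natCast_mem _ _) ?_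
    have := inv_mem p (n - k + 1) (by omega) (by omega)
    rw [Nat.cast_add, Nat.cast_sub hk.le] at this
    simpa using this

lemma bern_mem (n : ℕ) (hn : n + 1 < p) : ((bernoulli n : ℚ) : ℚ_[p]) ∈ PadicInt.subring p := by
  unfold bernoulli
  push_cast
  exact mul_mem (pow_mem (neg_mem (one_mem _)) _) (bern'_mem p n hn)

lemma power_sum (m : ℕ) (hm : m + 2 < p) : ∃ b c : ℤ_[p],
    (b : ℚ_[p]) = ((bernoulli m : ℚ) : ℚ_[p]) ∧
    ∑ k ∈ range p, (k : ℤ_[p]) ^ m = p * b + p ^ 2 * c := by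
  have hc : ∑ i ∈ range m, ((bernoulli i : ℚ) : ℚ_[p]) * ((m + 1).choose i) *
      (p : ℚ_[p]) ^ (m - 1 - i) * ((m + 1 : ℕ) : ℚ_[p])⁻¹ ∈ PadicInt.subring p := by
    refine sum_mem fun i hi => ?_
    rw [mem_range] at hi
    exact mul_mem (mul_mem (mul_mem (bern_mem p i (by omega)) (natCast_mem _ _))
      (pow_mem (natCast_mem _ _) _)) (inv_mem p (m + 1) (by omega) (by omega))
  obtain ⟨b, hb⟩ : ∃ b : ℤ_[p], PadicInt.Coe.ringHom b = ((bernoulli m : ℚ) : ℚ_[p]) :=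
    ⟨⟨_, bern_mem p m (by omega)⟩, rfl⟩
  obtain ⟨c, hc'⟩ : ∃ c : ℤ_[p], PadicInt.Coe.ringHom c =
      ∑ i ∈ range m, ((bernoulli i : ℚ) : ℚ_[p]) * ((m + 1).choose i) *
      (p : ℚ_[p]) ^ (m - 1 - i) * ((m + 1 : ℕ) : ℚ_[p])⁻¹ := ⟨⟨_, hc⟩, rfl⟩
  refine ⟨b, c, hb, ?_⟩
  have hinj : Function.Injective (PadicInt.Coe.ringHom (p := p)) := Subtype.coe_injective
  apply hinj
  simp only [map_sum, map_add, map_mul, map_pow, map_natCast]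
  rw [hb, hc']
  have h := congrArg (Rat.cast : ℚ → ℚ_[p]) (sum_range_pow p m)
  push_cast at h ⊢
  rw [h, sum_range_succ, add_comm]
  have hne : ((m : ℚ_[p]) + 1) ≠ 0 := by exact_mod_cast Nat.succ_ne_zero m
  congr 1
  · simp
    field_simp
  · rw [mul_sum]
    apply sum_congr rfl
    intro i hi
    rw [mem_range] at hi
    rw [show m + 1 - i = m - 1 - i + 2 by omega, pow_add]
    field_simp

end padic

end PanCor

theorem pan_cor_fourth (p : ℕ) [Fact p.Prime] (hodd : Odd p) :
    ‖(((∑ k ∈ Finset.range p, (-1 : ℚ) ^ k * ((p - 1).choose k : ℚ) ^ 4)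
        - (16 ^ (p - 1) + 2 * (p : ℚ) ^ 3 * bernoulli (p - 3)) : ℚ) : ℚ_[p])‖
      ≤ (p : ℝ) ^ (-(4 : ℤ)) := by
  have hp : p.Prime := Fact.out
  have h2 := hp.two_le
  obtain ⟨n, hn⟩ := hodd
  obtain ⟨b, c, hb, hT⟩ := PanCor.power_sum p (p - 3) (by omega)
  have key : (∑ k ∈ Finset.range p, (-1 : ℤ_[p]) ^ k * ((p - 1).choose k : ℤ_[p]) ^ 4)
        - (16 ^ (p - 1) + 2 * (p : ℤ_[p]) ^ 3 * b) ∈ Ideal.span {(p : ℤ_[p]) ^ 4} := by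
    rcases Nat.lt_or_ge n 2 with h | h
    · have : p = 3 := by omega
      subst this
      have hb1 : b = 1 := by
        apply Subtype.ext
        rw [hb]
        simp
      rw [hb1, Ideal.mem_span_singleton]
      refine ⟨-4, ?_⟩
      simp [Finset.sum_range_succ]
      norm_num
    · rw [← PadicInt.ker_toZModPow, RingHom.mem_ker]
      obtain ⟨m, hm⟩ : ∃ m, 2 * n = m + 3 := ⟨2 * n - 3, by omega⟩
      have hP : (p : ZMod (p ^ 4)) ^ 4 = 0 := by
        exact_mod_cast ZMod.natCast_self (p ^ 4)
      have hT' := congrArg (PadicInt.toZModPow (p := p) 4) hT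
      simp only [map_sum, map_add, map_mul, map_pow, map_natCast] at hT'
      rw [show p - 3 = m + 1 by omega, show Finset.range p = Finset.range (2 * n + 1) by rw [← hn],
        Finset.sum_range_succ'] at hT'
      have := PanCor.ring_main (p : ZMod (p ^ 4)) hP (fun j => (j : ZMod (p ^ 4))⁻¹) n m hm
        (by conv_lhs => rw [show ((p : ℕ) : ZMod (p ^ 4)) = ((2 * n + 1 : ℕ) : ZMod (p ^ 4)) from congrArg _ hn]
            push_cast; rfl)
        (by
          intro j h1 h3
          exact ZMod.coe_mul_inv_eq_one j
            ((Nat.coprime_of_lt_prime (by omega) (by omega) hp).symm.pow_right 4))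
        (by
          intro j h1 h3
          have hj := Int.ModEq.pow_card_sub_one_eq_one hp (n := (j : ℤ))
            (Nat.isCoprime_iff_coprime.2 (Nat.coprime_of_lt_prime (by omega) (by omega) hp).symm)
          rw [show p - 1 = 2 * n by omega] at hj
          obtain ⟨d, hd⟩ := hj.symm.dvd
          have hd' := congrArg (Int.cast : ℤ → ZMod (p ^ 4)) hd
          push_cast at hd'
          linear_combination (p : ZMod (p ^ 4)) ^ 3 * hd' + d * hP)
        (PadicInt.toZModPow 4 b) (PadicInt.toZModPow 4 c)
        (by simpa using hT')
      simp only [map_sum, map_sub, map_add, map_mul, map_pow, map_natCast, map_neg, map_one, map_ofNat]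
      rw [show p - 1 = 2 * n by omega, show Finset.range p = Finset.range (2 * n + 1) by rw [← hn],
        this, sub_self]
  rw [← PadicInt.norm_le_pow_iff_mem_span_pow] at key
  rw [PadicInt.norm_def] at key
  have hk : ∀ z : ℤ_[p], (z : ℚ_[p]) = PadicInt.Coe.ringHom z := fun _ => rfl
  rw [hk] at key
  simp only [map_sum, map_sub, map_add, map_mul, map_pow, map_natCast, map_neg, map_one,
    map_ofNat] at key
  rw [hk] at hb
  rw [hb] at key
  push_cast at key ⊢
  exact key
end
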